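/- Let X = π_p(X̃) ⊂ P^{n+c} be a variety of almost minimal degree obtained by projecting a smooth (non-cone) variety of minimal degree X̃ ⊂ P^{n+c+1} from a point p ∉ X̃, with c ≥ 3 and n ≥ 2. If depth(X) = n − 1, then n ≤ 5. -/

import Mathlib

/-!
Common framework: a projective variety `X ⊆ ℙ^N` over a field `k` is represented by its
affine cone `C ⊆ (ι → k)` (with `ι` the index type of homogeneous coordinates,
`Fintype.card ι = N + 1`).  All projective notions (vanishing ideal, `a₂`, Hilbert
function, dimension, degree, depth, base locus of quadrics, irreducible components,
scrolls and divisors on them, sectional genus, maximal sectional regularity) are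
defined concretely below.
-/

open MvPolynomial

noncomputable section

namespace PaperQuadrics

variable (k : Type) [Field k] (ι : Type) [Fintype ι] [DecidableEq ι]

/-- The vanishing ideal of a subset `C` of the affine cone `ι → k`. -/
def vanIdeal (C : Set (ι → k)) : Ideal (MvPolynomial ι k) :=
  ⨅ x ∈ C, RingHom.ker (MvPolynomial.eval x)

/-- The degree-`m` graded piece of an ideal of the polynomial ring. -/
def idealPiece (I : Ideal (MvPolynomial ι k)) (m : ℕ) : Submodule k (MvPolynomial ι k) :=
  Submodule.restrictScalars k I ⊓ homogeneousSubmodule ι k m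

/-- The space of quadrics vanishing on `C`, i.e. `H⁰(ℙ^N, I_C(2))`. -/
def quadrics (C : Set (ι → k)) : Submodule k (MvPolynomial ι k) :=
  idealPiece k ι (vanIdeal k ι C) 2

/-- `a₂(C) = h⁰(ℙ^N, I_C(2))`, the number of linearly independent quadrics through `C`. -/
def a2 (C : Set (ι → k)) : ℕ := Module.finrank k (quadrics k ι C)

/-- The Hilbert function of `R/I` in degree `m`. -/
def idealHilb (I : Ideal (MvPolynomial ι k)) (m : ℕ) : ℕ :=
  Module.finrank k (homogeneousSubmodule ι k m) - Module.finrank k (idealPiece k ι I m)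

/-- The Hilbert function of the homogeneous coordinate ring of `C`. -/
def hilb (C : Set (ι → k)) (m : ℕ) : ℕ := idealHilb k ι (vanIdeal k ι C) m

/-- `C ⊆ ι → k` is the affine cone of an irreducible projective variety:
it is a Zariski-closed cone whose vanishing ideal is prime. -/
structure IsProjVariety (C : Set (ι → k)) : Prop where
  zero_mem : (0 : ι → k) ∈ C
  smul_mem : ∀ x ∈ C, ∀ t : k, t • x ∈ C
  closed : C = {x | ∀ f ∈ vanIdeal k ι C, MvPolynomial.eval x f = 0}
  prime : (vanIdeal k ι C).IsPrime

/-- Nondegenerate: no nonzero linear form vanishes identically on `C`. -/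
def Nondeg (C : Set (ι → k)) : Prop :=
  ∀ f ∈ homogeneousSubmodule ι k 1, (∀ x ∈ C, MvPolynomial.eval x f = 0) → f = 0

/-- The projective variety with cone `C` has dimension `n`
(so the affine cone has Krull dimension `n + 1`). -/
def HasDim (C : Set (ι → k)) (n : ℕ) : Prop :=
  ringKrullDim (MvPolynomial ι k ⧸ vanIdeal k ι C) = (n + 1 : ℕ)

/-- `C` (of projective dimension `n`) has degree `d`:
the Hilbert function satisfies `hF(m) · n! / mⁿ → d`. -/
def HasDegree (C : Set (ι → k)) (n d : ℕ) : Prop :=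
  Filter.Tendsto (fun m : ℕ => (hilb k ι C m : ℝ) * (Nat.factorial n : ℝ) / (m : ℝ) ^ n)
    Filter.atTop (nhds (d : ℝ))

/-- `Q(C)`: the common zero set (base locus) of all quadrics through `C`. -/
def quadZero (C : Set (ι → k)) : Set (ι → k) :=
  {x | ∀ f ∈ quadrics k ι C, MvPolynomial.eval x f = 0}

/-- `fs` is a regular sequence on `R/I`. -/
def IsRegSeqOn (I : Ideal (MvPolynomial ι k)) (fs : List (MvPolynomial ι k)) : Prop :=
  (∀ i : Fin fs.length, ∀ g : MvPolynomial ι k,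
      fs.get i * g ∈ I ⊔ Ideal.span {h | ∃ j : Fin fs.length, j < i ∧ fs.get j = h} →
      g ∈ I ⊔ Ideal.span {h | ∃ j : Fin fs.length, j < i ∧ fs.get j = h}) ∧
  I ⊔ Ideal.span {h | ∃ j : Fin fs.length, fs.get j = h} ≠ ⊤

/-- Arithmetic depth of the homogeneous coordinate ring of `C`: the supremum of lengths of
regular sequences of elements of the irrelevant maximal ideal. -/
def arithDepth (C : Set (ι → k)) : ℕ :=
  sSup {l : ℕ | ∃ fs : List (MvPolynomial ι k), fs.length = l ∧
    (∀ f ∈ fs, MvPolynomial.coeff 0 f = 0) ∧ IsRegSeqOn k ι (vanIdeal k ι C) fs}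

/-- `Z` is an irreducible Zariski-closed cone. -/
def IsIrredClosed (Z : Set (ι → k)) : Prop :=
  Z = {x | ∀ f ∈ vanIdeal k ι Z, MvPolynomial.eval x f = 0} ∧ (vanIdeal k ι Z).IsPrime

/-- `Z` is an irreducible component of `Q`: an irreducible closed subset of `Q`, maximal
among the irreducible closed subsets of `Q`. -/
def IsComponentOf (Z Q : Set (ι → k)) : Prop :=
  IsIrredClosed k ι Z ∧ Z ⊆ Q ∧
    ∀ Z' : Set (ι → k), IsIrredClosed k ι Z' → Z ⊆ Z' → Z' ⊆ Q → Z' = Z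

/-- `C` is smooth away from the cone vertex, of codimension `c`: at each nonzero point the
Jacobian of the vanishing ideal has rank `c` (valid criterion in characteristic `0`). -/
def IsSmoothOfCodim (C : Set (ι → k)) (c : ℕ) : Prop :=
  ∀ x ∈ C, x ≠ (0 : ι → k) →
    Module.finrank k (Submodule.span k
      {v : ι → k | ∃ f ∈ vanIdeal k ι C,
        v = fun i => MvPolynomial.eval x (MvPolynomial.pderiv i f)}) = c

/-- The projective variety with affine cone `C` is a cone (in the projective sense):
there is a vertex point `[v]` such that `C` is stable under the join with `[v]`. -/
def IsConeVariety (C : Set (ι → k)) : Prop :=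
  ∃ v ∈ C, v ≠ 0 ∧ ∀ x ∈ C, ∀ s t : k, s • x + t • v ∈ C

/-- `C` (an `n`-dimensional variety of degree `d`) has sectional genus `g`: a general linear
curve section (cut by `n - 1` general hyperplanes) has Hilbert polynomial `d·m + 1 - g`. -/
def SectionalGenus (n : ℕ) (C : Set (ι → k)) (d g : ℕ) : Prop :=
  ∃ P : MvPolynomial (Fin (n - 1) × ι) k, P ≠ 0 ∧
    ∀ w : Fin (n - 1) → ι → k, MvPolynomial.eval (fun q => w q.1 q.2) P ≠ 0 →
      ∀ᶠ m in Filter.atTop,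
        (hilb k ι (C ∩ {x | ∀ j, ∑ i, w j i * x i = 0}) m : ℤ) = d * m + 1 - g

/-- `C` (an `n`-dimensional variety of degree `c + 3`) is a variety of maximal sectional
regularity: there is an `n`-dimensional linear subspace `F(X) = ℙ(L)` such that
`X ∩ F(X)` is (scheme-theoretically) a hypersurface of degree `4` in `F(X) ≅ ℙⁿ`,
detected by the Hilbert function of the ideal sum. -/
def IsVMSR (n : ℕ) (C : Set (ι → k)) : Prop :=
  ∃ L : Submodule k (ι → k), Module.finrank k L = n + 1 ∧
    ∀ᶠ m in Filter.atTop,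
      idealHilb k ι (vanIdeal k ι C ⊔ vanIdeal k ι (L : Set (ι → k))) m =
        Nat.choose (m + n) n - Nat.choose (m - 4 + n) n

end PaperQuadrics

namespace PaperQuadrics

variable {k : Type} [Field k]

/-- The parametrization of the rational normal scroll `S(a₀, …, aₙ)` (so the scroll has
dimension `n + 1`): homogeneous coordinates are indexed by `(i, j)`, `0 ≤ j ≤ aᵢ`,
and the point of parameters `(s : t) ∈ ℙ¹`, `λ` has coordinates `λᵢ sʲ t^{aᵢ - j}`. -/
def scrollParam (n : ℕ) (a : Fin (n + 1) → ℕ) (s t : k) (lam : Fin (n + 1) → k) :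
    ((i : Fin (n + 1)) × Fin (a i + 1)) → k :=
  fun x => lam x.1 * s ^ (x.2 : ℕ) * t ^ (a x.1 - (x.2 : ℕ))

/-- The affine cone of the scroll `S(a₀, …, aₙ) ⊆ ℙ^{n+1+c-1}`, `c = Σ aᵢ`. -/
def scrollCone (n : ℕ) (a : Fin (n + 1) → ℕ) :
    Set (((i : Fin (n + 1)) × Fin (a i + 1)) → k) :=
  {v | ∃ s t lam, v = scrollParam n a s t lam}

/-- Global sections of `O_Y(A·H + b·F)` on the scroll `Y = S(a₀, …, aₙ)`, realized as
bihomogeneous polynomials in `s, t` (the `ℙ¹`-coordinates) and `T₀, …, Tₙ` (the fiber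
coordinates): each monomial has total `T`-degree `A` and `(s,t)`-degree `b + Σ mᵢ aᵢ`. -/
def sectionSpace (k : Type) [Field k] (n : ℕ) (a : Fin (n + 1) → ℕ) (A b : ℤ) :
    Submodule k (MvPolynomial (Fin 2 ⊕ Fin (n + 1)) k) where
  carrier := {F | ∀ m ∈ F.support,
    ((∑ i, m (Sum.inr i) : ℕ) : ℤ) = A ∧
    ((m (Sum.inl 0) + m (Sum.inl 1) : ℕ) : ℤ)
      = b + ∑ i, (m (Sum.inr i) : ℤ) * (a i : ℤ)}
  add_mem' := by
    intro p q hp hq m hm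
    rcases Finset.mem_union.mp (MvPolynomial.support_add hm) with h | h
    · exact hp m h
    · exact hq m h
  zero_mem' := by
    intro m hm
    simp at hm
  smul_mem' := by
    intro c p hp m hm
    exact hp m (MvPolynomial.support_smul hm)

/-- The affine cone of the effective divisor `X ≡ A·H + b·F` on the scroll cut out by a
section `F`: the points of the scroll whose parameters are zeros of `F`. -/
def divisorCone (n : ℕ) (a : Fin (n + 1) → ℕ)
    (F : MvPolynomial (Fin 2 ⊕ Fin (n + 1)) k) :
    Set (((i : Fin (n + 1)) × Fin (a i + 1)) → k) :=
  {v | ∃ s t lam, v = scrollParam n a s t lam ∧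
     MvPolynomial.eval (Sum.elim (fun j : Fin 2 => if j = 0 then s else t) lam) F = 0}

end PaperQuadrics

open PaperQuadrics

section RegularSequence

open scoped Pointwise

universe u

open RingTheory.Sequence IsLocalRing in
theorem exists_notMem_smul_top_of_ne_zero {R : Type*} [CommRing R] [IsNoetherianRing R]
    [IsLocalRing R] {M : Type*} [AddCommGroup M] [Module R M] [Module.Finite R M]
    {f : R} (hf : f ∈ maximalIdeal R) (hreg : IsSMulRegular M f) {x : M} (hx : x ≠ 0) :
    ∃ x' : M, x' ∉ f • (⊤ : Submodule R M) ∧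
      Ideal.torsionOf R M x' = Ideal.torsionOf R M x ∧ ∃ j : ℕ, x = f ^ j • x' := by
  classical
  have hK : ∃ j : ℕ, ¬ ∃ y : M, x = f ^ j • y := by
    by_contra! hcon
    apply hx
    have h1 : x ∈ (⨅ i : ℕ, (Ideal.span {f}) ^ i • (⊤ : Submodule R M)) := by
      rw [Submodule.mem_iInf]
      intro i
      obtain ⟨y, hy⟩ := hcon i
      rw [hy]
      exact Submodule.smul_mem_smul (Ideal.pow_mem_pow (Ideal.mem_span_singleton_self f) i) trivial
    rw [Ideal.iInf_pow_smul_eq_bot_of_isLocalRing] at h1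
    · simpa using h1
    · intro h
      have : f ∈ (Ideal.span {f} : Ideal R) := Ideal.mem_span_singleton_self f
      apply (maximalIdeal.isMaximal R).ne_top
      rw [eq_top_iff, ← h, Ideal.span_singleton_le_iff_mem]
      exact hf
  have h0 := Nat.find_spec hK
  have hpos : Nat.find hK ≠ 0 := by
    intro h
    rw [h] at h0
    exact h0 ⟨x, by simp⟩
  obtain ⟨j, hj⟩ := Nat.exists_eq_succ_of_ne_zero hpos
  have h1 := Nat.find_min hK (m := j) (by omega)
  push Not at h1
  obtain ⟨x', hx'⟩ := h1
  refine ⟨x', ?_, ?_, j, hx'⟩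
  · intro hmem
    obtain ⟨y, -, hy⟩ := Submodule.mem_smul_pointwise_iff_exists _ _ _ |>.1 hmem
    apply h0
    rw [hj]
    exact ⟨y, by rw [hx', ← hy, smul_smul, pow_succ]⟩
  · ext a
    rw [Ideal.mem_torsionOf_iff, Ideal.mem_torsionOf_iff, hx', smul_comm]
    constructor
    · intro h; rw [h, smul_zero]
    · intro h
      exact (hreg.pow j) (by simpa using h)

theorem ringKrullDim_quotient_add_one_le_of_torsionOf_le {R : Type*} [CommRing R]
    {M : Type*} [AddCommGroup M] [Module R M]
    {f : R} (hreg : IsSMulRegular M f) (x : M) {b : Ideal R}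
    (hb : Ideal.torsionOf R M x ≤ b) (hfb : f ∈ b) :
    ringKrullDim (R ⧸ b) + 1 ≤ ringKrullDim (R ⧸ Ideal.torsionOf R M x) := by
  refine ringKrullDim_succ_le_of_surjective (Ideal.Quotient.factor hb)
    (Ideal.Quotient.factor_surjective hb) (r := Ideal.Quotient.mk _ f) ?_ ?_
  · rw [mem_nonZeroDivisors_iff_right]
    intro a ha
    obtain ⟨a, rfl⟩ := Ideal.Quotient.mk_surjective a
    rw [← map_mul, Ideal.Quotient.eq_zero_iff_mem, Ideal.mem_torsionOf_iff, mul_comm,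
      mul_smul] at ha
    rw [Ideal.Quotient.eq_zero_iff_mem, Ideal.mem_torsionOf_iff]
    exact hreg (by simpa using ha)
  · rw [Ideal.Quotient.factor_mk, Ideal.Quotient.eq_zero_iff_mem]
    exact hfb

theorem ringKrullDim_quotient_le_of_le {R : Type*} [CommRing R] {a b : Ideal R} (h : a ≤ b) :
    ringKrullDim (R ⧸ b) ≤ ringKrullDim (R ⧸ a) :=
  ringKrullDim_le_of_surjective (Ideal.Quotient.factor h) (Ideal.Quotient.factor_surjective h)

open RingTheory.Sequence IsLocalRing in
/-- The length of a weakly regular sequence in the maximal ideal is bounded by the dimension of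
the annihilator of any nonzero element. -/
theorem length_le_ringKrullDim_quotient_torsionOf {R : Type*} [CommRing R] [IsNoetherianRing R]
    [IsLocalRing R] (fs : List R) (hfs : ∀ f ∈ fs, f ∈ maximalIdeal R) :
    ∀ {M : Type u} [AddCommGroup M] [Module R M] [Module.Finite R M], IsWeaklyRegular M fs →
    ∀ x : M, x ≠ 0 → (fs.length : WithBot ℕ∞) ≤ ringKrullDim (R ⧸ Ideal.torsionOf R M x) := by
  induction fs with
  | nil =>
    intro M _ _ _ _ x hx
    have : Nontrivial (R ⧸ Ideal.torsionOf R M x) := by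
      apply Ideal.Quotient.nontrivial_iff.2
      rw [Ne, Ideal.eq_top_iff_one, Ideal.mem_torsionOf_iff, one_smul]
      exact hx
    simpa using ringKrullDim_nonneg_of_nontrivial
  | cons f fs ih =>
    intro M _ _ _ hreg x hx
    rw [isWeaklyRegular_cons_iff] at hreg
    obtain ⟨x', h1, h2, -⟩ := exists_notMem_smul_top_of_ne_zero (hfs f (by simp)) hreg.1 hx
    have hne : (Submodule.Quotient.mk x' : QuotSMulTop f M) ≠ 0 := by
      rwa [Ne, Submodule.Quotient.mk_eq_zero]
    have h3 := ih (fun g hg => hfs g (by simp [hg])) hreg.2 _ hne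
    have h4 := ringKrullDim_quotient_add_one_le_of_torsionOf_le hreg.1 x'
      (b := Ideal.torsionOf R _ (Submodule.Quotient.mk x' : QuotSMulTop f M)) (by
        intro a ha
        rw [Ideal.mem_torsionOf_iff] at ha ⊢
        rw [← Submodule.Quotient.mk_smul, ha, Submodule.Quotient.mk_zero]) (by
        rw [Ideal.mem_torsionOf_iff, ← Submodule.Quotient.mk_smul, Submodule.Quotient.mk_eq_zero]
        exact Submodule.smul_mem_pointwise_smul _ _ _ trivial)
    rw [h2] at h4
    refine le_trans ?_ h4
    push_cast [List.length_cons]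
    gcongr

open RingTheory.Sequence IsLocalRing in
/-- An ideal of small dimension cannot multiply an element into `l M` unless the element already
lies in `l M`, provided the module has a long enough weakly regular sequence. -/
theorem mem_smul_top_of_ringKrullDim_lt {R : Type*} [CommRing R] [IsNoetherianRing R]
    [IsLocalRing R] (d : ℕ) :
    ∀ {M : Type u} [AddCommGroup M] [Module R M] [Module.Finite R M] (fs : List R),
    (∀ f ∈ fs, f ∈ maximalIdeal R) → IsWeaklyRegular M fs → d + 1 ≤ fs.length →
    ∀ (a : Ideal R), ringKrullDim (R ⧸ a) < d → ∀ l ∈ a, IsSMulRegular M l →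
    ∀ x : M, (∀ r ∈ a, r • x ∈ l • (⊤ : Submodule R M)) → x ∈ l • (⊤ : Submodule R M) := by
  induction d with
  | zero =>
    intro M _ _ _ fs hfs hreg hlen a ha l hl hlreg x hx
    have : a = ⊤ := by
      by_contra hne
      have : Nontrivial (R ⧸ a) := Ideal.Quotient.nontrivial_iff.2 hne
      exact absurd ha (not_lt.2 (by simpa using ringKrullDim_nonneg_of_nontrivial (R := R ⧸ a)))
    simpa using hx 1 (by simp [this])
  | succ d ih =>
    intro M _ _ _ fs hfs hreg hlen a ha l hl hlreg x hx
    obtain _ | ⟨f, fs⟩ := fs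
    · simp at hlen
    have hfm := hfs f (by simp)
    have hall := hreg
    rw [isWeaklyRegular_cons_iff] at hreg
    -- an element of `a` regular on `M` and on `M / f M`
    have hkill : ∀ {M' : Type u} [AddCommGroup M'] [Module R M'] [Module.Finite R M']
        (gs : List R), (∀ g ∈ gs, g ∈ maximalIdeal R) → IsWeaklyRegular M' gs →
        d + 1 ≤ gs.length → ∀ u : M', (∀ r ∈ a, r • u = 0) → u = 0 := by
      intro M' _ _ _ gs hgs hgreg hglen u hu
      by_contra hne
      have h1 := length_le_ringKrullDim_quotient_torsionOf gs hgs hgreg u hne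
      have h2 : ringKrullDim (R ⧸ Ideal.torsionOf R M' u) ≤ ringKrullDim (R ⧸ a) :=
        ringKrullDim_quotient_le_of_le (fun r hr => by
          rw [Ideal.mem_torsionOf_iff]; exact hu r hr)
      have h3 := lt_of_le_of_lt (h1.trans h2) ha
      have h4 : gs.length < d + 1 := by exact_mod_cast h3
      omega
    obtain ⟨l', hl', hl'reg⟩ : ∃ r ∈ a, IsSMulRegular (M × QuotSMulTop f M) r := by
      have := (IsSMulRegular.subsingleton_linearMap_iff (R := R) (N := R ⧸ a)
        (M := M × QuotSMulTop f M)).1 (by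
          refine subsingleton_of_forall_eq 0 fun φ => ?_
          have hz : ∀ r ∈ a, r • φ 1 = 0 := by
            intro r hr
            rw [← map_smul, Algebra.smul_def, mul_one]
            have : algebraMap R (R ⧸ a) r = 0 := Ideal.Quotient.eq_zero_iff_mem.2 hr
            rw [this, map_zero]
          have h1 : φ 1 = 0 := by
            apply Prod.ext
            · exact hkill (f :: fs) hfs hall (by simpa using by simp at hlen; omega) _
                (fun r hr => congrArg Prod.fst (hz r hr))
            · exact hkill fs (fun g hg => hfs g (by simp [hg])) hreg.2
                (by simpa using hlen) _ (fun r hr => congrArg Prod.snd (hz r hr))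
          ext
          · simpa using congrArg Prod.fst h1
          · simpa using congrArg Prod.snd h1)
      rwa [Ideal.annihilator_quotient] at this
    have hl'M : IsSMulRegular M l' := fun u v huv => by
      have := @hl'reg (u, 0) (v, 0) (by simpa using huv)
      exact congrArg Prod.fst this
    have hl'F : IsSMulRegular (QuotSMulTop f M) l' := fun u v huv => by
      have := @hl'reg (0, u) (0, v) (by simpa using huv)
      exact congrArg Prod.snd this
    -- exchange `l` for `l'`
    obtain ⟨z, -, hz⟩ := Submodule.mem_smul_pointwise_iff_exists _ _ _ |>.1 (hx l' hl')
    have haz : ∀ r ∈ a, ∃ w, r • z = l' • w := by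
      intro r hr
      obtain ⟨w, -, hw⟩ := Submodule.mem_smul_pointwise_iff_exists _ _ _ |>.1 (hx r hr)
      refine ⟨w, hlreg ?_⟩
      simp only
      rw [smul_comm, hz, smul_comm, ← hw, smul_comm]
    suffices hzmem : ∃ w, z = l' • w by
      obtain ⟨w, hw⟩ := hzmem
      have : x = l • w := hl'M (by simp only; rw [← hz, hw, smul_comm])
      rw [this]
      exact Submodule.smul_mem_pointwise_smul _ _ _ trivial
    by_contra hzn
    have hfl' : IsSMulRegular (QuotSMulTop l' M) f := by
      refine isSMulRegular_quotient_iff_mem_of_smul_mem _ _ |>.2 fun u hu => ?_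
      obtain ⟨w, -, hw⟩ := Submodule.mem_smul_pointwise_iff_exists _ _ _ |>.1 hu
      have h1 := isSMulRegular_quotient_iff_mem_of_smul_mem _ _ |>.1 hl'F w
        (by rw [hw]; exact Submodule.smul_mem_pointwise_smul _ _ _ trivial)
      obtain ⟨w', -, hw'⟩ := Submodule.mem_smul_pointwise_iff_exists _ _ _ |>.1 h1
      have : u = l' • w' := hreg.1 (by simp only; rw [← hw, ← hw', smul_comm])
      rw [this]
      exact Submodule.smul_mem_pointwise_smul _ _ _ trivial
    have hne : (Submodule.Quotient.mk z : QuotSMulTop l' M) ≠ 0 := by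
      rw [Ne, Submodule.Quotient.mk_eq_zero]
      intro h
      obtain ⟨w, -, hw⟩ := Submodule.mem_smul_pointwise_iff_exists _ _ _ |>.1 h
      exact hzn ⟨w, hw.symm⟩
    obtain ⟨x', hx'1, hx'2, -⟩ := exists_notMem_smul_top_of_ne_zero hfm hfl' hne
    obtain ⟨z', rfl⟩ := Submodule.Quotient.mk_surjective _ x'
    set b := Ideal.torsionOf R _ (Submodule.Quotient.mk z' : QuotSMulTop l' M) with hb
    have hab : a ≤ b := by
      rw [hx'2]
      intro r hr
      rw [Ideal.mem_torsionOf_iff, ← Submodule.Quotient.mk_smul, Submodule.Quotient.mk_eq_zero]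
      obtain ⟨w, hw⟩ := haz r hr
      rw [hw]
      exact Submodule.smul_mem_pointwise_smul _ _ _ trivial
    have hdim : ringKrullDim (R ⧸ (b ⊔ Ideal.span {f})) < d := by
      have h1 := ringKrullDim_quotient_add_one_le_of_torsionOf_le hfl'
        (Submodule.Quotient.mk z' : QuotSMulTop l' M) (b := b ⊔ Ideal.span {f}) le_sup_left
        (Ideal.mem_sup_right (Ideal.mem_span_singleton_self f))
      have h2 := lt_of_le_of_lt (h1.trans (ringKrullDim_quotient_le_of_le hab)) ha
      push_cast at h2
      by_contra hcon
      exact absurd h2 (not_lt.2 (by gcongr; exact not_lt.1 hcon))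
    have hfin := ih (M := QuotSMulTop f M) fs (fun g hg => hfs g (by simp [hg])) hreg.2
      (by simpa using hlen) (b ⊔ Ideal.span {f}) hdim l' (Ideal.mem_sup_left (hab hl')) hl'F
      (Submodule.Quotient.mk z') (by
        intro r hr
        obtain ⟨r1, hr1, r2, hr2, rfl⟩ := Submodule.mem_sup.1 hr
        obtain ⟨r3, rfl⟩ := Ideal.mem_span_singleton'.1 hr2
        rw [hb, Ideal.mem_torsionOf_iff, ← Submodule.Quotient.mk_smul,
          Submodule.Quotient.mk_eq_zero] at hr1
        obtain ⟨w, -, hw⟩ := Submodule.mem_smul_pointwise_iff_exists _ _ _ |>.1 hr1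
        have : ((r1 + r3 * f) • (Submodule.Quotient.mk z' : QuotSMulTop f M)) =
            l' • Submodule.Quotient.mk w := by
          rw [← Submodule.Quotient.mk_smul, ← Submodule.Quotient.mk_smul, Submodule.Quotient.eq,
            add_smul, ← hw, add_sub_cancel_left, mul_comm, mul_smul]
          exact Submodule.smul_mem_pointwise_smul _ _ _ trivial
        rw [this]
        exact Submodule.smul_mem_pointwise_smul _ _ _ trivial)
    obtain ⟨w, -, hw⟩ := Submodule.mem_smul_pointwise_iff_exists _ _ _ |>.1 hfin
    obtain ⟨w, rfl⟩ := Submodule.Quotient.mk_surjective _ w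
    rw [← Submodule.Quotient.mk_smul, Submodule.Quotient.eq] at hw
    obtain ⟨y, -, hy⟩ := Submodule.mem_smul_pointwise_iff_exists _ _ _ |>.1 hw
    apply hx'1
    have : (Submodule.Quotient.mk z' : QuotSMulTop l' M) = f • Submodule.Quotient.mk (-y) := by
      rw [← Submodule.Quotient.mk_smul, Submodule.Quotient.eq, smul_neg, hy]
      have : z' - -(l' • w - z') = l' • w := by abel
      rw [this]
      exact Submodule.smul_mem_pointwise_smul _ _ _ trivial
    rw [this]
    exact Submodule.smul_mem_pointwise_smul _ _ _ trivial

open RingTheory.Sequence in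
theorem isWeaklyRegular_of_isRegSeqOn {k : Type} [Field k] {σ : Type} [Fintype σ] [DecidableEq σ]
    {I : Ideal (MvPolynomial σ k)} {fs : List (MvPolynomial σ k)} (h : IsRegSeqOn k σ I fs) :
    IsWeaklyRegular (MvPolynomial σ k ⧸ I) fs := by
  rw [isWeaklyRegular_iff_Fin]
  intro i
  have hset : {h | ∃ j : Fin fs.length, j < i ∧ fs.get j = h} = {h | h ∈ fs.take i} := by
    ext x
    simp only [Set.mem_ofPred_eq, List.mem_take_iff_getElem]
    constructor
    · rintro ⟨j, hj, rfl⟩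
      exact ⟨j, by simpa using hj, by simp⟩
    · rintro ⟨j, hj, rfl⟩
      have hj' : j < i := by omega
      exact ⟨⟨j, by omega⟩, hj', rfl⟩
  have h1 := h.1 i
  rw [hset] at h1
  have key : ∀ g : MvPolynomial σ k, (Ideal.Quotient.mk I g) ∈
      (Ideal.ofList (fs.take i) • ⊤ : Submodule (MvPolynomial σ k) (MvPolynomial σ k ⧸ I)) ↔
      g ∈ I ⊔ Ideal.span {h | h ∈ fs.take i} := by
    intro g
    have h2 : (Ideal.ofList (fs.take i) • ⊤ : Submodule (MvPolynomial σ k) (MvPolynomial σ k ⧸ I))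
        = Submodule.map (Submodule.mkQ I) (Ideal.ofList (fs.take i)) := by
      rw [← Submodule.range_mkQ I, ← Submodule.map_top, ← Submodule.map_smul'']
      simp
    rw [h2]
    change Submodule.mkQ I g ∈ _ ↔ _
    rw [← Submodule.mem_comap, Submodule.comap_map_mkQ]
  refine isSMulRegular_quotient_iff_mem_of_smul_mem _ _ |>.2 fun u hu => ?_
  obtain ⟨g, rfl⟩ := Ideal.Quotient.mk_surjective u
  rw [key]
  apply h1
  rw [← key]
  exact hu

theorem ringKrullDim_quotient_map_le_of_isLocalization {R : Type*} [CommRing R] (S : Submonoid R)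
    (A : Type*) [CommRing A] [Algebra R A] [IsLocalization S A] (J : Ideal R) :
    ringKrullDim (A ⧸ J.map (algebraMap R A)) ≤ ringKrullDim (R ⧸ J) := by
  have hinj := PrimeSpectrum.localization_comap_injective (A ⧸ J.map (algebraMap R A))
    (Algebra.algebraMapSubmonoid (R ⧸ J) S)
  refine Order.krullDim_le_of_strictMono
    (PrimeSpectrum.comap (algebraMap (R ⧸ J) (A ⧸ J.map (algebraMap R A)))) ?_
  intro p q hpq
  exact lt_of_le_of_ne (Ideal.comap_mono hpq.le) fun h => hpq.ne (hinj h)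

open RingTheory.Sequence IsLocalRing in
theorem length_le_of_isRegSeqOn {k : Type} [Field k] {σ : Type} [Fintype σ] [DecidableEq σ]
    {I J : Ideal (MvPolynomial σ k)} (hI : I.IsPrime) {fs : List (MvPolynomial σ k)}
    (hfs : ∀ f ∈ fs, MvPolynomial.coeff 0 f = 0) (hreg : IsRegSeqOn k σ I fs)
    {d : ℕ} (hd : ringKrullDim (MvPolynomial σ k ⧸ J) < d)
    {l x : MvPolynomial σ k} (hlJ : l ∈ J) (hlI : l ∉ I)
    (hJx : ∀ a ∈ J, a * x ∈ I ⊔ Ideal.span {l})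
    (hx : ∀ s : MvPolynomial σ k, MvPolynomial.coeff 0 s ≠ 0 → s * x ∉ I ⊔ Ideal.span {l}) :
    fs.length ≤ d := by
  classical
  by_contra! hlen
  let R := MvPolynomial σ k
  let m : Ideal R := RingHom.ker (MvPolynomial.constantCoeff (R := k) (σ := σ))
  have hmp : m.IsPrime := RingHom.ker_isPrime _
  have hmem : ∀ r : R, r ∈ m.primeCompl ↔ MvPolynomial.coeff 0 r ≠ 0 := fun r => Iff.rfl
  let A := Localization.AtPrime m
  let M := LocalizedModule m.primeCompl (R ⧸ I)
  let φ : (R ⧸ I) →ₗ[R] M := LocalizedModule.mkLinearMap m.primeCompl (R ⧸ I)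
  have hfin : Module.Finite A M := Module.Finite.of_isLocalizedModule m.primeCompl φ
  have hwr := (isWeaklyRegular_of_isRegSeqOn hreg).of_isLocalizedModule A m.primeCompl φ
  have hlreg : IsSMulRegular (R ⧸ I) l := by
    refine isSMulRegular_quotient_iff_mem_of_smul_mem _ _ |>.2 fun u hu => ?_
    exact (hI.mem_or_mem hu).resolve_left hlI
  have hlreg' : IsSMulRegular M (algebraMap R A l) := by
    have h1 : IsWeaklyRegular (R ⧸ I) [l] := (isWeaklyRegular_singleton_iff _ _).2 hlreg
    have := h1.of_isLocalizedModule A m.primeCompl φ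
    exact (isWeaklyRegular_singleton_iff _ _).1 this
  have hmain := mem_smul_top_of_ringKrullDim_lt (R := A) d (M := M) (fs.map (algebraMap R A))
    (by
      intro f hf
      obtain ⟨g, hg, rfl⟩ := List.mem_map.1 hf
      exact (IsLocalization.AtPrime.to_map_mem_maximal_iff A m g).2 (hfs g hg))
    hwr (by simpa using hlen) (J.map (algebraMap R A))
    (lt_of_le_of_lt (ringKrullDim_quotient_map_le_of_isLocalization m.primeCompl A J) hd)
    (algebraMap R A l) (Ideal.mem_map_of_mem _ hlJ) hlreg' (φ (Ideal.Quotient.mk I x)) (by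
      intro r hr
      have : J.map (algebraMap R A) ≤ ((algebraMap R A l • (⊤ : Submodule A M)).comap
          (LinearMap.toSpanSingleton A M (φ (Ideal.Quotient.mk I x)))) := by
        rw [Ideal.map_le_iff_le_comap]
        intro a ha
        obtain ⟨i, hi, z, hz, hiz⟩ := Submodule.mem_sup.1 (hJx a ha)
        obtain ⟨w, rfl⟩ := Ideal.mem_span_singleton'.1 hz
        change algebraMap R A a • φ (Ideal.Quotient.mk I x) ∈ algebraMap R A l • (⊤ : Submodule A M)
        rw [algebraMap_smul, ← map_smul]
        have h3 : a • (Ideal.Quotient.mk I x) = l • Ideal.Quotient.mk I w := by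
          change Ideal.Quotient.mk I (a * x) = Ideal.Quotient.mk I (l * w)
          rw [← hiz, map_add, Ideal.Quotient.eq_zero_iff_mem.2 hi, zero_add, mul_comm]
        rw [h3, map_smul, ← algebraMap_smul A l]
        exact Submodule.smul_mem_pointwise_smul _ _ _ trivial
      exact this hr)
  obtain ⟨w', -, hw⟩ := Submodule.mem_smul_pointwise_iff_exists _ _ _ |>.1 hmain
  obtain ⟨⟨w, s⟩, hs⟩ := IsLocalizedModule.surj m.primeCompl φ w'
  obtain ⟨w, rfl⟩ := Ideal.Quotient.mk_surjective w
  have h1 : φ ((s : R) • Ideal.Quotient.mk I x) = φ (l • Ideal.Quotient.mk I w) := by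
    rw [map_smul, map_smul, ← hs, ← hw]
    change (s : R) • algebraMap R A l • w' = l • ((s : R) • w')
    rw [algebraMap_smul, smul_comm]
  obtain ⟨t, ht⟩ := (IsLocalizedModule.eq_iff_exists m.primeCompl φ).1 h1
  have h2 : Ideal.Quotient.mk I ((t : R) * (s * x)) = Ideal.Quotient.mk I (t * (l * w)) := ht
  rw [Ideal.Quotient.eq] at h2
  refine hx (t * s) ((hmem _).1 (t * s).2) ?_
  have : (t : R) * s * x = (t * (s * x) - t * (l * w)) + (t * w) * l := by ring
  rw [this]
  exact Ideal.add_mem _ (Ideal.mem_sup_left h2)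
    (Ideal.mem_sup_right (Ideal.mul_mem_left _ _ (Ideal.mem_span_singleton_self _)))

end RegularSequence

theorem mem_vanIdeal {k : Type} [Field k] {ι : Type} [Fintype ι] [DecidableEq ι]
    {C : Set (ι → k)} {f : MvPolynomial ι k} :
    f ∈ vanIdeal k ι C ↔ ∀ x ∈ C, eval x f = 0 := by
  simp [vanIdeal, RingHom.mem_ker]

theorem eval_smul_of_isHomogeneous {k : Type*} [CommSemiring k] {ι : Type*}
    {f : MvPolynomial ι k} {m : ℕ} (hf : f.IsHomogeneous m) (t : k) (x : ι → k) :
    eval (t • x) f = t ^ m * eval x f := by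
  rw [eval_eq, eval_eq, Finset.mul_sum]
  refine Finset.sum_congr rfl fun d hd => ?_
  have h1 := hf.degree_eq_sum_deg_support hd
  simp only [Pi.smul_apply, smul_eq_mul, mul_pow, Finset.prod_mul_distrib]
  rw [Finset.prod_pow_eq_pow_sum]
  rw [← h1]
  ring

theorem eval_eq_zero_of_forall_smul {k : Type*} [Field k] [Infinite k] {ι : Type*}
    {f : MvPolynomial ι k} {x : ι → k} (h : ∀ t : k, eval (t • x) f = 0) (m : ℕ) :
    eval x (homogeneousComponent m f) = 0 := by
  let p : Polynomial k := ∑ i ∈ Finset.range (f.totalDegree + 1),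
    Polynomial.monomial i (eval x (homogeneousComponent i f))
  have hp : p = 0 := by
    apply Polynomial.funext
    intro t
    rw [Polynomial.eval_zero, ← h t, ← sum_homogeneousComponent f, map_sum,
      Polynomial.eval_finsetSum]
    refine Finset.sum_congr rfl fun i _ => ?_
    rw [Polynomial.eval_monomial,
      eval_smul_of_isHomogeneous (homogeneousComponent_isHomogeneous _ _),
      mul_comm]
  have hc : p.coeff m = if m < f.totalDegree + 1 then eval x (homogeneousComponent m f) else 0 := by
    simp [p, Polynomial.coeff_monomial]
  rw [hp, Polynomial.coeff_zero] at hc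
  split_ifs at hc with hm
  · exact hc.symm
  · rw [homogeneousComponent_eq_zero _ _ (by omega), map_zero]

theorem homogeneousComponent_mem_vanIdeal {k : Type} [Field k] [Infinite k] {ι : Type} [Fintype ι]
    [DecidableEq ι] {C : Set (ι → k)} (hC : ∀ x ∈ C, ∀ t : k, t • x ∈ C)
    {f : MvPolynomial ι k} (hf : f ∈ vanIdeal k ι C) (m : ℕ) :
    homogeneousComponent m f ∈ vanIdeal k ι C := by
  rw [mem_vanIdeal] at hf ⊢
  exact fun x hx => eval_eq_zero_of_forall_smul (fun t => hf _ (hC x hx t)) m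

theorem derivation_apply_eq_sum_pderiv {k : Type*} [CommSemiring k] {ι : Type*} [Fintype ι]
    (D : Derivation k (MvPolynomial ι k) (MvPolynomial ι k)) (f : MvPolynomial ι k) :
    D f = ∑ i, pderiv i f * D (X i) := by
  classical
  have hsum : ∀ g, (∑ i, D (X i) • pderiv i : Derivation k (MvPolynomial ι k)
      (MvPolynomial ι k)) g = ∑ i, pderiv i g * D (X i) := by
    intro g
    have h1 := congrFun (map_sum (Derivation.coeFnAddMonoidHom (R := k) (A := MvPolynomial ι k)
      (M := MvPolynomial ι k)) (fun i => D (X i) • pderiv i) Finset.univ) g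
    refine h1.trans ?_
    rw [Finset.sum_apply]
    exact Finset.sum_congr rfl fun i _ => mul_comm _ _
  have h : D = ∑ i, D (X i) • pderiv i := by
    apply derivation_ext
    intro j
    rw [hsum]
    simp [pderiv_X, Pi.single_apply, ite_mul]
  conv_lhs => rw [h]
  exact hsum f

/-- The algebra map to power series obtained by integrating a derivation from a point. -/
theorem exists_algHom_powerSeries_of_derivation {k : Type*} [Field k] [CharZero k] {R : Type*}
    [CommRing R] [Algebra k R] (D : Derivation k R R) (ε : R →ₐ[k] k) :
    ∃ γ : R →ₐ[k] PowerSeries k, ∀ f m,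
      PowerSeries.coeff m (γ f) = (m.factorial : k)⁻¹ * ε (D^[m] f) := by
  let g : R → PowerSeries k := fun f => PowerSeries.mk fun m => (m.factorial : k)⁻¹ * ε (D^[m] f)
  have hg : ∀ f m, PowerSeries.coeff m (g f) = (m.factorial : k)⁻¹ * ε (D^[m] f) :=
    fun f m => PowerSeries.coeff_mk _ _
  have hadd : ∀ f h, g (f + h) = g f + g h := by
    intro f h
    ext m
    rw [map_add, hg, hg, hg, iterate_map_add, map_add, mul_add]
  have hstep : ∀ f m, PowerSeries.coeff (m + 1) (g f) * ((m : k) + 1) =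
      PowerSeries.coeff m (g (D f)) := by
    intro f m
    have h1 : ((m : k) + 1) ≠ 0 := by exact_mod_cast Nat.succ_ne_zero m
    have h2 : (m.factorial : k) ≠ 0 := by exact_mod_cast Nat.factorial_ne_zero m
    rw [hg, hg, Function.iterate_succ_apply, Nat.factorial_succ]
    push_cast
    field_simp
  have hder : ∀ f, PowerSeries.derivative k (g f) = g (D f) := by
    intro f
    ext m
    rw [PowerSeries.coeff_derivative, hstep]
  have hmul : ∀ m f h, PowerSeries.coeff m (g (f * h)) = PowerSeries.coeff m (g f * g h) := by
    intro m
    induction m with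
    | zero =>
      intro f h
      simp [PowerSeries.coeff_mul, hg]
    | succ m ih =>
      intro f h
      have h1 : ((m : k) + 1) ≠ 0 := by exact_mod_cast Nat.succ_ne_zero m
      apply mul_right_cancel₀ h1
      rw [hstep, ← PowerSeries.coeff_derivative, Derivation.leibniz, Derivation.leibniz, hder, hder,
        smul_eq_mul, smul_eq_mul, smul_eq_mul, smul_eq_mul, hadd, map_add, map_add, ih, ih]
  have halg : ∀ c : k, g (algebraMap k R c) = algebraMap k (PowerSeries k) c := by
    intro c
    ext m
    rw [hg, PowerSeries.algebraMap_apply, Algebra.algebraMap_self_apply, PowerSeries.coeff_C]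
    rcases m with _ | m
    · simp
    · rw [Function.iterate_succ_apply, Derivation.map_algebraMap, iterate_map_zero]
      simp
  refine ⟨{ toFun := g, map_one' := ?_, map_mul' := ?_, map_zero' := ?_, map_add' := hadd,
            commutes' := halg }, hg⟩
  · simpa using halg 1
  · intro f h
    ext m
    exact hmul m f h
  · simpa using halg 0

/-- On a smooth cone every tangent vector at a nonzero point extends to a polynomial vector field
tangent to the cone. -/
theorem exists_derivation_of_isSmoothOfCodim {k : Type} [Field k] {ι : Type} [Fintype ι]
    [DecidableEq ι] {C : Set (ι → k)} (hV : IsProjVariety k ι C) {N : ℕ}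
    (hs : IsSmoothOfCodim k ι C N) {e : ι → k} (he : e ∈ C) (he0 : e ≠ 0) {v : ι → k}
    (hv : ∀ f ∈ vanIdeal k ι C, ∑ i, eval e (pderiv i f) * v i = 0) :
    ∃ D : Derivation k (MvPolynomial ι k) (MvPolynomial ι k),
      (∀ f ∈ vanIdeal k ι C, D f ∈ vanIdeal k ι C) ∧ ∀ i, eval e (D (X i)) = v i := by
  classical
  let S : (ι → k) → Set (ι → k) := fun x => {v : ι → k | ∃ f ∈ vanIdeal k ι C,
    v = fun i => MvPolynomial.eval x (MvPolynomial.pderiv i f)}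
  have hse : Module.finrank k (Submodule.span k (S e)) = N := hs e he he0
  obtain ⟨g, hgS, hgspan, hgli⟩ : ∃ g : Fin N → ι → k, (∀ i, g i ∈ S e) ∧
      Submodule.span k (Set.range g) = Submodule.span k (S e) ∧ LinearIndependent k g := by
    rw [← hse]
    exact Submodule.exists_fun_fin_finrank_span_eq k (S e)
  choose f hf hfg using hgS
  let F : Matrix (Fin N) ι (MvPolynomial ι k) := fun a i => pderiv i (f a)
  let Fe : (ι → k) → Matrix (Fin N) ι k := fun x a i => eval x (pderiv i (f a))
  have hFe : ∀ x, Fe x = F.map (eval x) := fun x => rfl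
  have hrow : LinearIndependent k (Fe e).row := by
    have : (Fe e).row = g := by
      funext a
      exact (hfg a).symm
    rwa [this]
  have hsurj : Function.Surjective (Fe e).mulVec := by
    have h1 := hrow.rank_matrix
    rw [Matrix.rank] at h1
    have h2 : LinearMap.range (Fe e).mulVecLin = ⊤ := by
      apply Submodule.eq_top_of_finrank_eq
      rw [h1]
      simp
    exact LinearMap.range_eq_top.1 h2
  obtain ⟨B, hB⟩ := Matrix.mulVec_surjective_iff_exists_right_inverse.1 hsurj
  let G : Matrix (Fin N) (Fin N) (MvPolynomial ι k) := F * B.map MvPolynomial.C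
  have hGe : ∀ x, G.map (eval x) = Fe x * B := by
    intro x
    have h1 : (B.map MvPolynomial.C).map (eval x) = B := by
      ext i j
      simp
    rw [hFe, ← h1]
    exact Matrix.map_mul
  let vR : ι → (MvPolynomial ι k) := fun i => MvPolynomial.C (v i)
  let W : ι → (MvPolynomial ι k) :=
    G.det • vR - (B.map MvPolynomial.C).mulVec (G.adjugate.mulVec (F.mulVec vR))
  have hFW : F.mulVec W = 0 := by
    have h1 : F.mulVec ((B.map MvPolynomial.C).mulVec (G.adjugate.mulVec (F.mulVec vR))) =
        G.det • F.mulVec vR := by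
      rw [Matrix.mulVec_mulVec]
      change G.mulVec _ = _
      rw [Matrix.mulVec_mulVec, Matrix.mul_adjugate, Matrix.smul_mulVec, Matrix.one_mulVec]
    simp only [W]
    rw [Matrix.mulVec_sub, Matrix.mulVec_smul]
    exact sub_eq_zero.2 h1.symm
  have hdet : eval e G.det = 1 := by
    rw [RingHom.map_det, RingHom.mapMatrix_apply, hGe, hB, Matrix.det_one]
  refine ⟨mkDerivation k W, ?_, ?_⟩
  · intro h hh
    obtain ⟨i₀, hi₀⟩ : ∃ i, e i ≠ 0 := Function.ne_iff.1 he0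
    have hX : (X i₀ : (MvPolynomial ι k)) ∉ vanIdeal k ι C := by
      rw [mem_vanIdeal]
      intro hX
      exact hi₀ (by simpa using hX e he)
    have hG : G.det ∉ vanIdeal k ι C := by
      rw [mem_vanIdeal]
      intro hG
      exact one_ne_zero (hdet.symm.trans (hG e he))
    have hmem : G.det * (X i₀ * mkDerivation k W h) ∈ vanIdeal k ι C := by
      rw [mem_vanIdeal]
      intro x hx
      rw [map_mul, map_mul, eval_X]
      by_cases hx0 : x i₀ = 0
      · simp [hx0]
      by_cases hdx : eval x G.det = 0
      · simp [hdx]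
      have hxne : x ≠ 0 := fun h => hx0 (by simp [h])
      have hu : IsUnit (Fe x * B) := by
        rw [Matrix.isUnit_iff_isUnit_det, ← hGe, ← RingHom.mapMatrix_apply, ← RingHom.map_det]
        exact isUnit_iff_ne_zero.2 hdx
      have hli : LinearIndependent k (Fe x).row := by
        rw [← Matrix.vecMul_injective_iff]
        intro a b hab
        have h1 := congrArg (fun w => Matrix.vecMul w B) hab
        simp only [Matrix.vecMul_vecMul] at h1
        exact Matrix.vecMul_injective_of_isUnit hu h1
      have hspan : Submodule.span k (Set.range (Fe x).row) = Submodule.span k (S x) := by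
        apply Submodule.eq_of_le_of_finrank_eq
        · apply Submodule.span_mono
          rintro _ ⟨a, rfl⟩
          exact ⟨f a, hf a, rfl⟩
        · rw [finrank_span_eq_card hli, Fintype.card_fin]
          exact (hs x hx hxne).symm
      have hhS : (fun i => eval x (pderiv i h)) ∈ Submodule.span k (Set.range (Fe x).row) := by
        rw [hspan]
        exact Submodule.subset_span ⟨h, hh, rfl⟩
      have hz : ∀ w ∈ Submodule.span k (Set.range (Fe x).row),
          ∑ i, w i * eval x (W i) = 0 := by
        intro w hw
        induction hw using Submodule.span_induction with
        | mem w hw =>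
          obtain ⟨a, rfl⟩ := hw
          have := congrArg (eval x) (congrFun hFW a)
          simpa [Matrix.mulVec, dotProduct, F, Fe, Matrix.row] using this
        | zero => simp
        | add u w _ _ h1 h2 => simp [add_mul, Finset.sum_add_distrib, h1, h2]
        | smul c w _ h1 => simp [mul_assoc, ← Finset.mul_sum, h1]
      have h3 := hz _ hhS
      rw [derivation_apply_eq_sum_pderiv, map_sum]
      simp only [map_mul, mkDerivation_X]
      rw [h3]
      simp
    exact (hV.prime.mem_or_mem ((hV.prime.mem_or_mem hmem).resolve_left hG)).resolve_left hX
  · intro i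
    have h1 : (fun i => eval e ((F.mulVec vR) i)) = 0 := by
      funext a
      simpa [Matrix.mulVec, dotProduct, F, vR] using hv (f a) (hf a)
    have h2 : ∀ a, eval e ((F.mulVec vR) a) = 0 := fun a => congrFun h1 a
    rw [mkDerivation_X]
    simp only [W, Pi.sub_apply, Pi.smul_apply, smul_eq_mul, map_sub, map_mul, hdet, one_mul]
    simp only [Matrix.mulVec, dotProduct, map_sum, map_mul] at h2 ⊢
    simp only [h2, mul_zero, Finset.sum_const_zero, sub_zero]
    simp [vR]

/-- A smooth cone carries formal arcs through any nonzero point in any tangent direction. -/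
theorem exists_arc_of_isSmoothOfCodim {k : Type} [Field k] [CharZero k] {ι : Type} [Fintype ι]
    [DecidableEq ι] {C : Set (ι → k)} (hV : IsProjVariety k ι C) {N : ℕ}
    (hs : IsSmoothOfCodim k ι C N) {e : ι → k} (he : e ∈ C) (he0 : e ≠ 0) {v : ι → k}
    (hv : ∀ f ∈ vanIdeal k ι C, ∑ i, eval e (pderiv i f) * v i = 0) :
    ∃ γ : MvPolynomial ι k →ₐ[k] PowerSeries k, (∀ f ∈ vanIdeal k ι C, γ f = 0) ∧
      ∀ i, PowerSeries.coeff 0 (γ (X i)) = e i ∧ PowerSeries.coeff 1 (γ (X i)) = v i := by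
  obtain ⟨D, hD, hDv⟩ := exists_derivation_of_isSmoothOfCodim hV hs he he0 hv
  obtain ⟨γ, hγ⟩ := exists_algHom_powerSeries_of_derivation D (aeval e)
  refine ⟨γ, fun f hf => ?_, fun i => ⟨?_, ?_⟩⟩
  · ext m
    have h1 : ∀ m, D^[m] f ∈ vanIdeal k ι C := by
      intro m
      induction m with
      | zero => exact hf
      | succ m ih => rw [Function.iterate_succ_apply']; exact hD _ ih
    have h2 := mem_vanIdeal.1 (h1 m) e he
    rw [hγ, aeval_eq_eval, h2]
    simp
  · simp [hγ]
  · simp [hγ, aeval_eq_eval, hDv]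

/-- The dimension of the space of forms of degree `m` in `s + 1` variables. -/
theorem finrank_homogeneousSubmodule_eq_choose {k : Type} [Field k] {σ : Type} [Fintype σ]
    {s : ℕ} (hs : Fintype.card σ = s + 1) (m : ℕ) :
    Module.finrank k (homogeneousSubmodule σ k m) = (s + m).choose s := by
  classical
  have e : (homogeneousSubmodule σ k m) ≃ₗ[k] ({d : σ →₀ ℕ | d.degree = m} →₀ k) :=
    (LinearEquiv.ofEq _ _ (homogeneousSubmodule_eq_finsupp_supported σ k m)).trans
      (AddMonoidAlgebra.supportedEquivFinsupp _)
  have h : {d : σ →₀ ℕ | d.degree = m} = ↑(Finset.finsuppAntidiag (Finset.univ : Finset σ) m) := by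
    ext d
    simp [Finset.mem_finsuppAntidiag, Finsupp.degree_eq_sum]
  rw [e.finrank_eq, h]
  have h2 : s + 1 + m - 1 = s + m := by omega
  simp [Finset.card_finsuppAntidiag_nat_eq_choose, hs, h2]
  exact Nat.choose_symm_add.symm

instance finite_homogeneousSubmodule {k : Type} [Field k] {σ : Type} [Fintype σ] (m : ℕ) :
    Module.Finite k (homogeneousSubmodule σ k m) :=
  Module.Finite.iff_fg.2 (homogeneousSubmodule_fg σ k m)

theorem finrank_le_idealHilb_add {k : Type} [Field k] {σ : Type} [Fintype σ]
    (I : Ideal (MvPolynomial σ k)) (m : ℕ) {V : Type} [AddCommGroup V] [Module k V]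
    [Module.Finite k V] (φ : V →ₗ[k] MvPolynomial σ k) (hφ : ∀ v, (φ v).IsHomogeneous m)
    (K : Submodule k V) (hK : ∀ v, φ v ∈ I → v ∈ K) :
    Module.finrank k V ≤ idealHilb k σ I m + Module.finrank k K := by
  set H := homogeneousSubmodule σ k m
  set P : Submodule k H := (idealPiece k σ I m).comap H.subtype
  have hP : Module.finrank k P = Module.finrank k (idealPiece k σ I m) :=
    (Submodule.comapSubtypeEquivOfLe inf_le_right).finrank_eq
  have h1 : Module.finrank k (H ⧸ P) = idealHilb k σ I m := by
    have h := Submodule.finrank_quotient_add_finrank P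
    change _ = Module.finrank k H - Module.finrank k (idealPiece k σ I m)
    omega
  let ψ : V →ₗ[k] H ⧸ P := P.mkQ ∘ₗ φ.codRestrict H hφ
  have h2 := ψ.finrank_range_add_finrank_ker
  have h3 : Module.finrank k (LinearMap.range ψ) ≤ Module.finrank k (H ⧸ P) :=
    Submodule.finrank_le _
  have h4 : LinearMap.ker ψ ≤ K := by
    intro v hv
    refine hK v ?_
    have : φ.codRestrict H hφ v ∈ P := by simpa [ψ] using hv
    exact this.1
  have h5 := Submodule.finrank_mono h4
  omega

theorem le_of_hasDegree_of_forall_mul_choose_le {k : Type} [Field k] {σ : Type} [Fintype σ]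
    [DecidableEq σ] {C : Set (σ → k)} {n d K a : ℕ} (hd : HasDegree k σ C n d)
    (h : ∀ m, a ≤ m → K * (m - a + n).choose n ≤ hilb k σ C m) : K ≤ d := by
  have h1 : ∀ m, a ≤ m → K * (m - a) ^ n ≤ hilb k σ C m * n.factorial := by
    intro m hm
    refine le_trans ?_ (Nat.mul_le_mul_right _ (h m hm))
    rw [mul_assoc]
    refine Nat.mul_le_mul_left _ ?_
    rw [mul_comm, ← Nat.ascFactorial_eq_factorial_mul_choose]
    exact (Nat.pow_le_pow_left (Nat.le_succ _) n).trans (Nat.pow_succ_le_ascFactorial _ _)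
  have h2 : Filter.Tendsto (fun m : ℕ => (K : ℝ) * (((m : ℝ) - a) / m) ^ n) Filter.atTop
      (nhds ((K : ℝ) * 1 ^ n)) := by
    refine Filter.Tendsto.const_mul _ (Filter.Tendsto.pow ?_ n)
    have h3 : Filter.Tendsto (fun m : ℕ => (1 : ℝ) - (a : ℝ) / m) Filter.atTop (nhds (1 - 0)) :=
      tendsto_const_nhds.sub (tendsto_const_div_atTop_nhds_zero_nat _)
    rw [sub_zero] at h3
    refine h3.congr' ?_
    filter_upwards [Filter.eventually_gt_atTop 0] with m hm
    have : (m : ℝ) ≠ 0 := by positivity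
    field_simp
  rw [one_pow, mul_one] at h2
  have h4 : (K : ℝ) ≤ d := by
    refine le_of_tendsto_of_tendsto h2 hd ?_
    filter_upwards [Filter.eventually_gt_atTop 0, Filter.eventually_ge_atTop a] with m hm hma
    rw [div_pow, mul_div_assoc']
    have : (K : ℝ) * ((m : ℝ) - a) ^ n ≤ hilb k σ C m * n.factorial := by
      rw [← Nat.cast_sub hma]
      exact_mod_cast h1 m hma
    gcongr
  exact_mod_cast h4

theorem mul_choose_add_choose_le (n K m : ℕ) (h : K ≤ m) :
    K * (m - K + n).choose n + (n + 1 + (m - K)).choose (n + 1) ≤ (n + 1 + m).choose (n + 1) := by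
  induction m generalizing K with
  | zero =>
    obtain rfl : K = 0 := by omega
    simp
  | succ m ih =>
    rcases K with _ | K
    · simp
    · have h1 := ih K (by omega)
      have h2 : n + 1 + (m + 1) = (n + 1 + m) + 1 := by omega
      have h3 : m + 1 - (K + 1) = m - K := by omega
      rw [h2, Nat.choose_succ_succ, h3, add_mul, one_mul]
      have h4 := Nat.choose_le_choose n (show m - K + n ≤ n + 1 + m by omega)
      have h5 : (n + 1 + m).choose (n + 1) = (n + 1 + m).choose n.succ := rfl
      omega

/-- A bound on the growth of the Hilbert function: it eventually dominates at most `d` times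
the Hilbert function of a (shifted) projective `n`-space. -/
def HilbGrowthLE {k : Type} [Field k] {σ : Type} [Fintype σ] (I : Ideal (MvPolynomial σ k))
    (n d : ℕ) : Prop :=
  ∀ K a : ℕ, (∀ m, a ≤ m → K * (m - a + n).choose n ≤ idealHilb k σ I m) → K ≤ d

/-- Any `n + 2` linear forms satisfy a homogeneous relation modulo an ideal of projective
dimension at most `n`. -/
theorem HilbGrowthLE.exists_relation {k : Type} [Field k] {σ τ : Type} [Fintype σ] [Fintype τ]
    {I : Ideal (MvPolynomial σ k)} {n d : ℕ} (hI : HilbGrowthLE I n d)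
    (hτ : Fintype.card τ = n + 2) (l : τ → MvPolynomial σ k) (hl : ∀ i, (l i).IsHomogeneous 1) :
    ∃ f : MvPolynomial τ k, f ≠ 0 ∧ (∃ m, f.IsHomogeneous m) ∧ aeval l f ∈ I := by
  by_contra! hcon
  have h1 : ∀ m, d + 1 ≤ m → (d + 1) * (m - (d + 1) + n).choose n ≤ idealHilb k σ I m := by
    intro m hm
    have h2 := finrank_le_idealHilb_add I m
      ((aeval l).toLinearMap ∘ₗ (homogeneousSubmodule τ k m).subtype)
      (fun v => by
        have := v.2.aeval l (n := 1) hl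
        simpa using this) ⊥ (fun v hv => by
        by_contra h0
        exact hcon v (by simpa using h0) ⟨m, v.2⟩ hv)
    rw [finrank_homogeneousSubmodule_eq_choose (s := n + 1) hτ, finrank_bot, add_zero] at h2
    exact (Nat.le_of_add_right_le (mul_choose_add_choose_le _ _ _ hm)).trans h2
  have := hI _ _ h1
  omega

theorem MvPolynomial.IsHomogeneous.degree_eq_of_mem_support {k : Type} [Field k] {σ : Type}
    {f : MvPolynomial σ k} {m : ℕ} (hf : f.IsHomogeneous m) {d : σ →₀ ℕ} (hd : d ∈ f.support) :
    d.degree = m := by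
  rw [Finsupp.degree_eq_weight_one]
  exact hf (mem_support_iff.1 hd)

theorem X_pow_dvd_algHom_of_isHomogeneous {k : Type} [Field k] {σ : Type}
    (γ : MvPolynomial σ k →ₐ[k] PowerSeries k) {f : MvPolynomial σ k} {m : ℕ}
    (hf : f.IsHomogeneous m) (h : ∀ v ∈ f.vars, PowerSeries.X ∣ γ (X v)) :
    PowerSeries.X ^ m ∣ γ f := by
  rw [f.as_sum, map_sum]
  refine Finset.dvd_sum fun d hd => ?_
  rw [monomial_eq, map_mul, Finsupp.prod, map_prod]
  refine Dvd.dvd.mul_left ?_ _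
  have h1 := hf.degree_eq_of_mem_support hd
  rw [← h1, Finsupp.degree_apply, ← Finset.prod_pow_eq_pow_sum]
  refine Finset.prod_dvd_prod_of_dvd _ _ fun v hv => ?_
  rw [map_pow]
  exact pow_dvd_pow_of_dvd (h v ((mem_vars_iff_mem_support v).2 ⟨d, hd, hv⟩)) _

theorem eq_zero_of_forall_X_pow_dvd_aeval {k : Type} [Field k] [Infinite k] {τ : Type}
    [Fintype τ] {g : MvPolynomial (Option τ) k} {m : ℕ} (hg : g.IsHomogeneous m)
    (h : ∀ a : τ → k, ∃ (u : PowerSeries k) (b : τ → PowerSeries k),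
      PowerSeries.constantCoeff u = 1 ∧ (∀ i, PowerSeries.constantCoeff (b i) = a i) ∧
      PowerSeries.X ^ (m + 1) ∣
        aeval (fun o : Option τ => o.elim u fun i => PowerSeries.X * b i) g) : g = 0 := by
  classical
  by_contra hg0
  let w : (Option τ →₀ ℕ) → ℕ := fun d => ∑ i, d (some i)
  have hdeg : ∀ d ∈ g.support, d none + w d = m := by
    intro d hd
    have := hg.degree_eq_of_mem_support hd
    rw [Finsupp.degree_eq_sum, Fintype.sum_option] at this
    exact this
  obtain ⟨d0, hd0, hmin⟩ := g.support.exists_min_image w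
    (Finset.nonempty_of_ne_empty (by simpa using hg0))
  let P : MvPolynomial τ k :=
    ∑ d ∈ g.support with w d = w d0, monomial d.some (coeff d g)
  have hP : P = 0 := by
    refine MvPolynomial.funext fun a => ?_
    obtain ⟨u, b, hu, hb, hdvd⟩ := h a
    have h1 : PowerSeries.coeff (w d0)
        (aeval (fun o : Option τ => o.elim u fun i => PowerSeries.X * b i) g) = 0 := by
      refine PowerSeries.X_pow_dvd_iff.1 hdvd _ ?_
      have := hdeg d0 hd0
      omega
    have h2 : ∀ d ∈ g.support, PowerSeries.coeff (w d0)
        (aeval (fun o : Option τ => o.elim u fun i => PowerSeries.X * b i)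
          (monomial d (coeff d g))) =
        if w d = w d0 then coeff d g * ∏ i, a i ^ d (some i) else 0 := by
      intro d hd
      have h3 : aeval (fun o : Option τ => o.elim u fun i => PowerSeries.X * b i)
          (monomial d (coeff d g)) = PowerSeries.X ^ w d *
            (PowerSeries.C (coeff d g) * (u ^ d none * ∏ i, b i ^ d (some i))) := by
        rw [aeval_monomial, Finsupp.prod_fintype _ _ (by simp), Fintype.prod_option]
        simp only [Option.elim, mul_pow, Finset.prod_mul_distrib, w,
          Finset.prod_pow_eq_pow_sum]
        change PowerSeries.C (coeff d g) * _ = _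
        ring
      rw [h3, PowerSeries.coeff_X_pow_mul']
      have := hmin d hd
      by_cases heq : w d = w d0
      · simp [heq, hu, hb, map_prod]
      · rw [if_neg (by omega), if_neg heq]
    rw [g.as_sum, map_sum, map_sum, Finset.sum_congr rfl h2, ← Finset.sum_filter] at h1
    rw [map_zero, ← h1, map_sum]
    refine Finset.sum_congr rfl fun d hd => ?_
    rw [eval_monomial, Finsupp.prod_fintype _ _ (by simp)]
    rfl
  have h4 : coeff d0.some P = coeff d0 g := by
    simp only [P, coeff_sum, coeff_monomial]
    rw [Finset.sum_eq_single d0]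
    · simp
    · intro d hd hne
      rw [Finset.mem_filter] at hd
      rw [if_neg]
      intro heq
      apply hne
      have h5 := hdeg d hd.1
      have h6 := hdeg d0 hd0
      ext o
      rcases o with _ | i
      · omega
      · exact DFunLike.congr_fun heq i
    · intro h; simp [hd0] at h
  rw [hP, coeff_zero] at h4
  exact mem_support_iff.1 hd0 h4.symm

/-- The ideal of a variety in coordinates adapted to points `eᵢ` (`i : ι`) spanning a
complement of the common zeros of the `ι`-coordinates; the `τ`-coordinates vanish at the `eᵢ` and
are coordinates on each of the projectivized tangent spaces there. -/
structure IsAdapted {k : Type} [Field k] {ι τ : Type} [Fintype ι] [Fintype τ]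
    (I : Ideal (MvPolynomial (ι ⊕ τ) k)) : Prop where
  prime : I.IsPrime
  homogeneousComponent_mem : ∀ f ∈ I, ∀ m, homogeneousComponent m f ∈ I
  eq_zero_of_isHomogeneous_one : ∀ f ∈ I, f.IsHomogeneous 1 → f = 0
  exists_arc : ∀ (i : ι) (a : τ → k), ∃ γ : MvPolynomial (ι ⊕ τ) k →ₐ[k] PowerSeries k,
    (∀ f ∈ I, γ f = 0) ∧ PowerSeries.coeff 0 (γ (X (Sum.inl i))) = 1 ∧
    (∀ j, j ≠ i → PowerSeries.coeff 0 (γ (X (Sum.inl j))) = 0) ∧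
    ∀ u, PowerSeries.coeff 0 (γ (X (Sum.inr u))) = 0 ∧
      PowerSeries.coeff 1 (γ (X (Sum.inr u))) = a u
  hilbGrowthLE : HilbGrowthLE I (Fintype.card τ) (Fintype.card ι)

namespace IsAdapted

/-- The variables `x_i` and `h_u`. -/
def optionVar {ι τ : Type} (i : ι) : Option τ → ι ⊕ τ := fun o => o.elim (Sum.inl i) Sum.inr

variable {k : Type} [Field k] {ι τ : Type} [Fintype ι] [Fintype τ]
  {I : Ideal (MvPolynomial (ι ⊕ τ) k)}

theorem eq_zero_of_X_mul_add_mem [Infinite k] (hI : IsAdapted I) (i : ι)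
    {g : MvPolynomial (Option τ) k} {m : ℕ} (hg : g.IsHomogeneous m)
    {r : MvPolynomial (ι ⊕ τ) k}
    (hr : ∀ γ : MvPolynomial (ι ⊕ τ) k →ₐ[k] PowerSeries k,
      (∀ v, v ≠ Sum.inl i → PowerSeries.X ∣ γ (X v)) → PowerSeries.X ^ (m + 1) ∣ γ r)
    (h : X (Sum.inl i) * rename (optionVar i) g + r ∈ I) : g = 0 := by
  refine eq_zero_of_forall_X_pow_dvd_aeval hg fun a => ?_
  obtain ⟨γ, hγI, h1, h2, h3⟩ := hI.exists_arc i a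
  have hX : ∀ v, v ≠ Sum.inl i → PowerSeries.X ∣ γ (X v) := by
    rintro (j | u) hv
    · rw [PowerSeries.X_dvd_iff, ← PowerSeries.coeff_zero_eq_constantCoeff_apply]
      exact h2 j (by rintro rfl; exact hv rfl)
    · rw [PowerSeries.X_dvd_iff, ← PowerSeries.coeff_zero_eq_constantCoeff_apply]
      exact (h3 u).1
  choose b hb using fun u : τ => hX (Sum.inr u) (by simp)
  refine ⟨γ (X (Sum.inl i)), b, by simpa using h1, fun u => ?_, ?_⟩
  · have := (h3 u).2
    rw [hb, ← zero_add 1, PowerSeries.coeff_succ_X_mul] at this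
    simpa using this
  · have h4 : aeval (fun o : Option τ => o.elim (γ (X (Sum.inl i))) fun u => PowerSeries.X * b u) g
        = γ (rename (optionVar i) g) := by
      rw [← AlgHom.comp_apply]
      congr 1
      ext1 o
      rcases o with _ | u <;> simp [optionVar, hb]
    rw [h4]
    have h5 := hγI _ h
    rw [map_add, map_mul, add_eq_zero_iff_eq_neg] at h5
    have h6 : IsUnit (γ (X (Sum.inl i))) := by
      rw [PowerSeries.isUnit_iff_constantCoeff, ← PowerSeries.coeff_zero_eq_constantCoeff_apply,
        h1]
      exact isUnit_one
    rw [← h6.dvd_mul_left, h5, dvd_neg]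
    exact hr γ hX

theorem eq_zero_of_X_mul_rename_add_mem [Infinite k] (hI : IsAdapted I) (i : ι)
    {g : MvPolynomial τ k} {m : ℕ} (hg : g.IsHomogeneous m)
    {r : MvPolynomial (ι ⊕ τ) k}
    (hr : ∀ γ : MvPolynomial (ι ⊕ τ) k →ₐ[k] PowerSeries k,
      (∀ v, v ≠ Sum.inl i → PowerSeries.X ∣ γ (X v)) → PowerSeries.X ^ (m + 1) ∣ γ r)
    (h : X (Sum.inl i) * rename Sum.inr g + r ∈ I) : g = 0 := by
  have h1 := hI.eq_zero_of_X_mul_add_mem i (g := rename some g) hg.rename_isHomogeneous hr (by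
    rw [rename_rename]; exact h)
  exact rename_injective _ (Option.some_injective _) (by simpa using h1)

theorem eq_zero_of_rename_optionVar_mem [Infinite k] (hI : IsAdapted I) (i : ι)
    {g : MvPolynomial (Option τ) k} (h : rename (optionVar i) g ∈ I) : g = 0 := by
  have h1 : ∀ m, homogeneousComponent m g = 0 := by
    intro m
    refine hI.eq_zero_of_X_mul_add_mem i (homogeneousComponent_isHomogeneous m g) (r := 0)
      (by simp) ?_
    rw [add_zero]
    refine I.mul_mem_left _ ?_
    have h2 := hI.homogeneousComponent_mem _ h m
    rwa [← rename_homogeneousComponent] at h2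
  rw [← sum_homogeneousComponent g]
  simp [h1]

theorem eq_zero_of_rename_inr_mem [Infinite k] [Nonempty ι] (hI : IsAdapted I)
    {g : MvPolynomial τ k} (h : rename Sum.inr g ∈ I) : g = 0 := by
  obtain ⟨i⟩ := ‹Nonempty ι›
  have h1 := hI.eq_zero_of_rename_optionVar_mem i (g := rename some g) (by
    rw [rename_rename]; exact h)
  exact rename_injective _ (Option.some_injective _) (by simpa using h1)

end IsAdapted

theorem exists_eq_span_singleton_of_forall_C_mem {A : Type} [CommRing A] [IsDomain A]
    [UniqueFactorizationMonoid A] {P : Ideal (Polynomial A)} (hP : P.IsPrime) (hne : P ≠ ⊥)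
    (hC : ∀ a, Polynomial.C a ∈ P → a = 0) : ∃ f, P = Ideal.span {f} := by
  classical
  have hex : ∃ d, ∃ f ∈ P, f ≠ 0 ∧ f.natDegree = d := by
    obtain ⟨f, hf, hf0⟩ := Submodule.exists_mem_ne_zero_of_ne_bot hne
    exact ⟨_, f, hf, hf0, rfl⟩
  obtain ⟨f0, hf0, hf00, hd⟩ := Nat.find_spec hex
  have hmin : ∀ g ∈ P, g ≠ 0 → f0.natDegree ≤ g.natDegree := by
    intro g hg hg0
    rw [hd]
    exact Nat.find_min' hex ⟨g, hg, hg0, rfl⟩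
  have hspan : Ideal.span {f0} ≠ ⊥ := by simpa using hf00
  obtain ⟨f, hfp, hfP, hff0⟩ : ∃ f, Prime f ∧ f ∈ P ∧ f ∣ f0 := by
    obtain ⟨s, hs, u, hu⟩ := UniqueFactorizationMonoid.exists_prime_factors f0 hf00
    have h1 : s.prod ∈ P := by
      have : s.prod = f0 * ↑u⁻¹ := by rw [← hu]; simp
      rw [this]
      exact P.mul_mem_right _ hf0
    obtain ⟨f, hfs, hfP⟩ := (hP.multiset_prod_mem_iff_exists_mem s).1 h1
    refine ⟨f, hs f hfs, hfP, ?_⟩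
    rw [← hu]
    exact (Multiset.dvd_prod hfs).mul_right _
  have hfmin : ∀ g ∈ P, g ≠ 0 → f.natDegree ≤ g.natDegree := fun g hg hg0 =>
    (Polynomial.natDegree_le_of_dvd hff0 hf00).trans (hmin g hg hg0)
  have hfpos : 0 < f.natDegree := by
    by_contra h
    have h1 := Polynomial.eq_C_of_natDegree_eq_zero (Nat.eq_zero_of_not_pos h)
    rw [h1] at hfP
    have h2 := hC _ hfP
    rw [h2, map_zero] at h1
    exact hfp.ne_zero h1
  have key : ∀ d, ∀ g ∈ P, g.natDegree ≤ d → ∃ a : A, a ≠ 0 ∧ f ∣ Polynomial.C a * g := by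
    intro d
    induction d with
    | zero =>
      intro g hg hgd
      have h0 : g = 0 := by
        by_contra h
        have := hfmin g hg h
        omega
      exact ⟨1, one_ne_zero, by simp [h0]⟩
    | succ d ih =>
      intro g hg hgd
      by_cases h0 : g = 0
      · exact ⟨1, one_ne_zero, by simp [h0]⟩
      have h1 := hfmin g hg h0
      have h2 := Polynomial.natDegree_cancelLeads_lt_of_natDegree_le_natDegree h1 (by omega)
      have h3 : f.cancelLeads g ∈ P :=
        P.sub_mem (P.mul_mem_left _ hg) (P.mul_mem_left _ hfP)
      obtain ⟨a, ha, hdvd⟩ := ih _ h3 (by omega)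
      refine ⟨a * f.leadingCoeff, mul_ne_zero ha (by simpa using hfp.ne_zero), ?_⟩
      rw [Polynomial.cancelLeads, Nat.sub_eq_zero_of_le h1, pow_zero, mul_one, mul_sub] at hdvd
      have h4 := (dvd_sub_comm.1 hdvd)
      have h5 : f ∣ Polynomial.C a * (Polynomial.C g.leadingCoeff *
          Polynomial.X ^ (g.natDegree - f.natDegree) * f) :=
        Dvd.dvd.mul_left (Dvd.intro_left _ rfl) _
      rw [dvd_sub_right h5] at h4
      rwa [map_mul, mul_assoc]
  refine ⟨f, le_antisymm (fun g hg => ?_) ((Ideal.span_singleton_le_iff_mem _).2 hfP)⟩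
  rw [Ideal.mem_span_singleton]
  obtain ⟨a, ha, hdvd⟩ := key _ g hg le_rfl
  refine (hfp.dvd_or_dvd hdvd).resolve_left fun h => ?_
  have := Polynomial.natDegree_le_of_dvd h (by simpa using ha)
  rw [Polynomial.natDegree_C] at this
  omega

theorem exists_eq_span_singleton_of_forall_rename_mem {k : Type} [Field k] {σ : Type} [Finite σ]
    {P : Ideal (MvPolynomial (Option σ) k)} (hP : P.IsPrime) (hne : P ≠ ⊥)
    (hC : ∀ g : MvPolynomial σ k, rename some g ∈ P → g = 0) : ∃ f, P = Ideal.span {f} := by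
  let E := (optionEquivLeft k σ).toRingEquiv
  obtain ⟨f, hf⟩ := exists_eq_span_singleton_of_forall_C_mem (P := P.comap E.symm)
    (Ideal.IsPrime.comap _) (fun h => hne (by
      rw [eq_bot_iff]
      intro x hx
      have : E x ∈ P.comap E.symm := by simpa [Ideal.mem_comap] using hx
      rw [h] at this
      simpa using this))
    (fun a ha => hC a (by
      rw [Ideal.mem_comap] at ha
      convert ha using 1
      rw [RingEquiv.eq_symm_apply]
      have : (((optionEquivLeft k σ) : MvPolynomial (Option σ) k →ₐ[k] _).comp (rename some)) =
          (Algebra.ofId (MvPolynomial σ k) (Polynomial (MvPolynomial σ k))).restrictScalars k := by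
        ext1 i
        simp [Algebra.ofId_apply]
      exact DFunLike.congr_fun this a))
  refine ⟨E.symm f, ?_⟩
  ext x
  have h1 : x ∈ P ↔ E x ∈ P.comap E.symm := by simp
  rw [h1, hf, Ideal.mem_span_singleton, Ideal.mem_span_singleton]
  constructor
  · intro h
    have := map_dvd E.symm h
    simpa using this
  · intro h
    have := map_dvd E h
    simpa using this

theorem isHomogeneous_of_span_singleton {k : Type} [Field k] {σ : Type}
    {f : MvPolynomial σ k} (hf0 : f ≠ 0)
    (h : ∀ g ∈ Ideal.span {f}, ∀ m, homogeneousComponent m g ∈ Ideal.span {f}) :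
    f.IsHomogeneous f.totalDegree := by
  have h1 := h f (Ideal.mem_span_singleton_self f) f.totalDegree
  obtain ⟨q, hq⟩ := Ideal.mem_span_singleton.1 h1
  have h2 : homogeneousComponent f.totalDegree f ≠ 0 := by
    obtain ⟨d, hd, hdeg⟩ := f.support.exists_mem_eq_sup (Finset.nonempty_of_ne_empty
      (by simpa using hf0)) (fun s => s.sum fun _ e => e)
    intro h0
    have h3 := coeff_homogeneousComponent f.totalDegree f d
    rw [h0, if_pos (by rw [totalDegree, hdeg]; rfl), coeff_zero] at h3
    exact mem_support_iff.1 hd h3.symm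
  have hq0 : q ≠ 0 := by rintro rfl; simp [hq] at h2
  have h3 := (homogeneousComponent_isHomogeneous f.totalDegree f)
  have h4 := h3.totalDegree h2
  rw [hq, totalDegree_mul_of_isDomain hf0 hq0] at h4
  have h5 := totalDegree_eq_zero_iff_eq_C.1 (show q.totalDegree = 0 by omega)
  have hc : coeff 0 q ≠ 0 := by
    intro h0; rw [h0, map_zero] at h5; exact hq0 h5
  have h6 : f = (coeff 0 q)⁻¹ • homogeneousComponent f.totalDegree f := by
    conv_rhs => rw [hq, h5]
    rw [mul_comm, ← smul_eq_C_mul, smul_smul]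
    simp [hc]
  rw [h6]
  exact (homogeneousSubmodule σ k _).smul_mem _ (h6 ▸ h3)

/-- The variables `x_j`, `x_i` and `h_u`. -/
def IsAdapted.pairVar {ι τ : Type} (i j : ι) : Option (Option τ) → ι ⊕ τ :=
  fun o => o.elim (Sum.inl j) (optionVar i)

theorem IsAdapted.pairVar_injective {ι τ : Type} {i j : ι} (hij : i ≠ j) :
    Function.Injective (pairVar i j : Option (Option τ) → ι ⊕ τ) := by
  rintro (_ | _ | u) (_ | _ | v) h <;> simp_all [pairVar, optionVar]

theorem MvPolynomial.IsHomogeneous.of_mul_left {k : Type} [Field k] {σ : Type}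
    {f g : MvPolynomial σ k} {m n : ℕ} (hf : f.IsHomogeneous m) (hf0 : f ≠ 0)
    (h : (f * g).IsHomogeneous (m + n)) : g.IsHomogeneous n := by
  have h1 : f * homogeneousComponent n g = f * g := by
    have h2 := congrArg (homogeneousComponent (m + n)) (show f * g =
      ∑ j ∈ Finset.range (g.totalDegree + 1), f * homogeneousComponent j g by
        rw [← Finset.mul_sum, sum_homogeneousComponent])
    rw [homogeneousComponent_of_mem h, if_pos rfl, map_sum] at h2
    rw [h2]
    have h3 : ∀ j, homogeneousComponent (m + n) (f * homogeneousComponent j g) =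
        if n = j then f * homogeneousComponent n g else 0 := by
      intro j
      rw [homogeneousComponent_of_mem (hf.mul (homogeneousComponent_isHomogeneous j g))]
      by_cases hj : n = j
      · simp [hj]
      · rw [if_neg (by omega), if_neg hj]
    rw [Finset.sum_congr rfl fun j _ => h3 j, Finset.sum_ite_eq]
    split_ifs with hn
    · rfl
    · rw [homogeneousComponent_eq_zero _ _ (by simpa using hn), mul_zero]
  rw [← mul_left_cancel₀ hf0 h1]
  exact homogeneousComponent_isHomogeneous n g

namespace IsAdapted

theorem X_dvd_of_mem_vars_rename {k : Type} [Field k] {ι τ σ : Type} {f : σ → ι ⊕ τ}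
    {g : MvPolynomial σ k} {i : ι}
    (hf : ∀ s, f s ≠ Sum.inl i) {γ : MvPolynomial (ι ⊕ τ) k →ₐ[k] PowerSeries k}
    (hγ : ∀ v, v ≠ Sum.inl i → PowerSeries.X ∣ γ (X v)) :
    ∀ v ∈ (rename f g).vars, PowerSeries.X ∣ γ (X v) := by
  classical
  intro v hv
  have := vars_rename f g hv
  obtain ⟨s, -, rfl⟩ := Finset.mem_image.1 this
  exact hγ _ (hf s)

variable {k : Type} [Field k] {ι τ : Type} [Fintype ι] [Fintype τ]
  {I : Ideal (MvPolynomial (ι ⊕ τ) k)}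

theorem eq_zero_of_rename_pairVar_add_sum_mem [Infinite k] [DecidableEq ι]
    (hI : IsAdapted I) {i j : ι}
    {m : ℕ} {s : MvPolynomial (Option (Option τ)) k} (hs : s.IsHomogeneous (m + 1))
    {g : {l : ι // l ≠ i ∧ l ≠ j} → MvPolynomial (Option τ) k}
    (hg : ∀ l, (g l).IsHomogeneous m)
    (h : rename (pairVar i j) s + ∑ l, X (Sum.inl l.1) * rename (optionVar l.1) (g l) ∈ I)
    (l : {l : ι // l ≠ i ∧ l ≠ j}) : g l = 0 := by
  rw [← Finset.add_sum_erase _ _ (Finset.mem_univ l), add_left_comm] at h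
  refine hI.eq_zero_of_X_mul_add_mem l.1 (hg l) (fun γ hγ => ?_) h
  rw [map_add]
  refine dvd_add ?_ ?_
  · refine X_pow_dvd_algHom_of_isHomogeneous γ hs.rename_isHomogeneous
      (X_dvd_of_mem_vars_rename (i := l.1) ?_ hγ)
    rintro (_ | _ | u)
    · simpa [pairVar] using l.2.2.symm
    · simpa [pairVar, optionVar] using l.2.1.symm
    · simp [pairVar, optionVar]
  · rw [map_sum]
    refine Finset.dvd_sum fun l' hl' => ?_
    have hne : l'.1 ≠ l.1 := fun h => Finset.ne_of_mem_erase hl' (Subtype.ext h)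
    rw [map_mul, pow_succ']
    refine mul_dvd_mul (hγ _ (by simpa using hne)) ?_
    refine X_pow_dvd_algHom_of_isHomogeneous γ (hg l').rename_isHomogeneous
      (X_dvd_of_mem_vars_rename (i := l.1) ?_ hγ)
    rintro (_ | u)
    · simpa [optionVar] using hne
    · simp [optionVar]

theorem exists_quadric [Infinite k] [DecidableEq ι] (hI : IsAdapted I) {i j : ι} (hij : i ≠ j) :
    ∃ q : MvPolynomial (Option (Option τ)) k, q ≠ 0 ∧ q.IsHomogeneous 2 ∧
      rename (pairVar i j) q ∈ I := by
  set P := I.comap (rename (pairVar i j) : MvPolynomial (Option (Option τ)) k →ₐ[k] _) with hPdef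
  have hmemP : ∀ f, f ∈ P ↔ rename (pairVar i j) f ∈ I := fun f => Iff.rfl
  have hPprime : P.IsPrime := by
    have := hI.prime
    exact Ideal.IsPrime.comap _
  have hcard : Fintype.card (Option (Option τ)) = Fintype.card τ + 2 := by simp
  obtain ⟨f1, hf10, -, hf1⟩ := hI.hilbGrowthLE.exists_relation hcard
    (fun o => X (pairVar i j o)) (fun o => isHomogeneous_X _ _)
  have hPne : P ≠ ⊥ := by
    intro h
    have : f1 ∈ P := by
      rw [hmemP, rename_eq_aeval]
      exact hf1
    rw [h] at this
    exact hf10 this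
  obtain ⟨f, hf⟩ := exists_eq_span_singleton_of_forall_rename_mem hPprime hPne (fun g hg => by
    refine hI.eq_zero_of_rename_optionVar_mem i ?_
    rw [hmemP, rename_rename] at hg
    exact hg)
  have hf0 : f ≠ 0 := by
    rintro rfl
    exact hPne (by simpa using hf)
  have hfP : f ∈ P := hf ▸ Ideal.mem_span_singleton_self f
  have hhom : f.IsHomogeneous f.totalDegree := by
    refine isHomogeneous_of_span_singleton hf0 ?_
    rw [← hf]
    intro g hg m
    rw [hmemP, rename_homogeneousComponent]
    exact hI.homogeneousComponent_mem _ hg m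
  rcases lt_trichotomy f.totalDegree 2 with hlt | heq | hgt
  · exfalso
    have h01 : f.totalDegree = 0 ∨ f.totalDegree = 1 := by omega
    rcases h01 with h | h
    · rw [totalDegree_eq_zero_iff_eq_C] at h
      refine hPprime.ne_top (Ideal.eq_top_of_isUnit_mem _ hfP ?_)
      rw [h] at hf0 ⊢
      refine (IsUnit.mk0 (coeff 0 f) ?_).map C
      rintro h0
      simp [h0] at hf0
    · rw [h] at hhom
      have := hI.eq_zero_of_isHomogeneous_one _ hfP hhom.rename_isHomogeneous
      exact hf0 (rename_injective _ (pairVar_injective hij) (by simpa using this))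
  · exact ⟨f, hf0, heq ▸ hhom, hfP⟩
  · exfalso
    set δ := f.totalDegree
    have hkey : ∀ m, δ ≤ m →
        (m + 1 + Fintype.card τ + 1).choose (Fintype.card τ + 1) +
          (Fintype.card ι - 2) * (Fintype.card τ + m).choose (Fintype.card τ) ≤
        idealHilb k (ι ⊕ τ) I (m + 1) +
          (m + 1 - δ + Fintype.card τ + 1).choose (Fintype.card τ + 1) := by
      intro m hm
      let S := homogeneousSubmodule (Option (Option τ)) k
      let ψ : (S (m + 1) × ({l : ι // l ≠ i ∧ l ≠ j} → homogeneousSubmodule (Option τ) k m)) →ₗ[k]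
          MvPolynomial (ι ⊕ τ) k :=
        LinearMap.coprod ((rename (pairVar i j)).toLinearMap ∘ₗ (S (m + 1)).subtype)
          (LinearMap.lsum k _ k fun l => LinearMap.mulLeft k (X (Sum.inl l.1)) ∘ₗ
            (rename (optionVar l.1)).toLinearMap ∘ₗ (homogeneousSubmodule (Option τ) k m).subtype)
      have hψ : ∀ v, ψ v = rename (pairVar i j) v.1.1 +
          ∑ l, X (Sum.inl l.1) * rename (optionVar l.1) (v.2 l).1 := by
        intro v
        simp [ψ]
      let κ : S (m + 1 - δ) →ₗ[k]
          (S (m + 1) × ({l : ι // l ≠ i ∧ l ≠ j} → homogeneousSubmodule (Option τ) k m)) :=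
        LinearMap.inl k _ _ ∘ₗ LinearMap.codRestrict (S (m + 1))
          (LinearMap.mulLeft k f ∘ₗ (S (m + 1 - δ)).subtype) (fun v => by
            have := hhom.mul v.2
            rw [Nat.add_sub_cancel' (by omega)] at this
            exact this)
      have h1 := finrank_le_idealHilb_add I (m + 1) ψ (fun v => by
        rw [hψ]
        refine IsHomogeneous.add v.1.2.rename_isHomogeneous (IsHomogeneous.sum _ _ _ fun l _ => ?_)
        have := (isHomogeneous_X k (Sum.inl l.1 : ι ⊕ τ)).mul
          ((v.2 l).2.rename_isHomogeneous (f := optionVar l.1))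
        rwa [add_comm 1 m] at this) (LinearMap.range κ) (by
        rintro ⟨s, g⟩ hv
        rw [hψ] at hv
        have h2 := hI.eq_zero_of_rename_pairVar_add_sum_mem s.2 (g := fun l => (g l).1)
          (fun l => (g l).2) hv
        have h3 : s.1 ∈ P := by
          rw [hmemP]
          simpa [h2] using hv
        rw [hf, Ideal.mem_span_singleton] at h3
        obtain ⟨q, hq⟩ := h3
        have h4 : q.IsHomogeneous (m + 1 - δ) := by
          refine hhom.of_mul_left hf0 ?_
          rw [← hq, Nat.add_sub_cancel' (by omega)]
          exact s.2
        refine ⟨⟨q, h4⟩, ?_⟩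
        refine Prod.ext (Subtype.ext hq.symm) ?_
        funext l
        exact (Subtype.ext (h2 l)).symm)
      have h5 := LinearMap.finrank_range_le κ
      rw [Module.finrank_prod, Module.finrank_pi_fintype,
        finrank_homogeneousSubmodule_eq_choose (s := Fintype.card τ + 1) hcard] at h1
      rw [finrank_homogeneousSubmodule_eq_choose (s := Fintype.card τ + 1) hcard] at h5
      simp only [finrank_homogeneousSubmodule_eq_choose (k := k) (s := Fintype.card τ)
        (Fintype.card_option (α := τ)), Finset.sum_const, Finset.card_univ, smul_eq_mul] at h1
      have h6 : Fintype.card {l : ι // l ≠ i ∧ l ≠ j} = Fintype.card ι - 2 := by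
        rw [Fintype.card_subtype]
        have : (Finset.univ.filter fun l => l ≠ i ∧ l ≠ j) = (Finset.univ.erase i).erase j := by
          ext l; simp [and_comm]
        rw [this, Finset.card_erase_of_mem (by simpa using hij.symm),
          Finset.card_erase_of_mem (Finset.mem_univ _), Finset.card_univ]
        omega
      rw [h6] at h1
      have h7 : Fintype.card τ + 1 + (m + 1) = m + 1 + Fintype.card τ + 1 := by omega
      have h8 : Fintype.card τ + 1 + (m + 1 - δ) = m + 1 - δ + Fintype.card τ + 1 := by omega
      rw [h7] at h1
      rw [h8] at h5
      omega
    have h2ι : 2 ≤ Fintype.card ι := by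
      have : Nontrivial ι := ⟨i, j, hij⟩
      exact Fintype.one_lt_card
    have := hI.hilbGrowthLE (Fintype.card ι + 1) (δ + 1) (fun m hm => by
      obtain ⟨m, rfl⟩ : ∃ m', m = m' + 1 := ⟨m - 1, by omega⟩
      have h1 := hkey m (by omega)
      have h2 := mul_choose_add_choose_le (Fintype.card τ) 3 (m + 1) (by omega)
      have h3 : (m + 1 - δ + Fintype.card τ + 1).choose (Fintype.card τ + 1) ≤
          (Fintype.card τ + 1 + (m + 1 - 3)).choose (Fintype.card τ + 1) :=
        Nat.choose_le_choose _ (by omega)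
      have h4 : (m + 1 - (δ + 1) + Fintype.card τ).choose (Fintype.card τ) ≤
          (m + 1 - 3 + Fintype.card τ).choose (Fintype.card τ) :=
        Nat.choose_le_choose _ (by omega)
      have h5 : (m + 1 - (δ + 1) + Fintype.card τ).choose (Fintype.card τ) ≤
          (Fintype.card τ + m).choose (Fintype.card τ) :=
        Nat.choose_le_choose _ (by omega)
      have h6 : Fintype.card ι + 1 = 3 + (Fintype.card ι - 2) := by omega
      have h7 : Fintype.card τ + 1 + (m + 1) = m + 1 + Fintype.card τ + 1 := by omega
      rw [h7] at h2
      rw [h6, add_mul]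
      have h8 := Nat.mul_le_mul_left 3 h4
      have h9 := Nat.mul_le_mul_left (Fintype.card ι - 2) h5
      omega)
    omega

end IsAdapted

theorem exists_eq_X_none_mul_add_rename_some {k : Type} [Field k] {σ : Type} {m : ℕ}
    {f : MvPolynomial (Option σ) k} (hf : f.IsHomogeneous (m + 1)) :
    ∃ (g : MvPolynomial (Option σ) k) (r : MvPolynomial σ k), g.IsHomogeneous m ∧
      r.IsHomogeneous (m + 1) ∧ f = X none * g + rename some r := by
  classical
  have key : ∀ s : Finset (Option σ →₀ ℕ), (∀ d ∈ s, d.degree = m + 1) →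
      ∃ (g : MvPolynomial (Option σ) k) (r : MvPolynomial σ k), g.IsHomogeneous m ∧
      r.IsHomogeneous (m + 1) ∧ ∑ d ∈ s, monomial d (coeff d f) = X none * g + rename some r := by
    intro s
    induction s using Finset.induction_on with
    | empty => exact fun _ => ⟨0, 0, isHomogeneous_zero _ _ _, isHomogeneous_zero _ _ _, by simp⟩
    | insert d s hd ih =>
      intro h
      obtain ⟨g, r, hg, hr, hs⟩ := ih fun d hd => h d (Finset.mem_insert_of_mem hd)
      have hdd := h d (Finset.mem_insert_self d s)
      rw [Finset.sum_insert hd, hs]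
      by_cases h0 : d none = 0
      · have h1 : Finsupp.mapDomain some d.some = d := by
          ext o
          rcases o with _ | u
          · rw [Finsupp.mapDomain_of_notMem_range, h0]
            simp
          · rw [Finsupp.mapDomain_apply (Option.some_injective _)]
            simp
        refine ⟨g, monomial d.some (coeff d f) + r, hg, (isHomogeneous_monomial _ ?_).add hr, ?_⟩
        · rw [← hdd]
          conv_rhs => rw [← h1]
          rw [Finsupp.degree_mapDomain]
        · rw [map_add, rename_monomial, h1]
          ring
      · have h1 : Finsupp.single none 1 + (d - Finsupp.single none 1) = d := by
          refine add_tsub_cancel_of_le ?_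
          rw [Finsupp.single_le_iff]
          omega
        refine ⟨monomial (d - Finsupp.single none 1) (coeff d f) + g, r,
          (isHomogeneous_monomial _ ?_).add hg, hr, ?_⟩
        · have h2 := congrArg Finsupp.degree h1
          rw [map_add, hdd, Finsupp.degree_single] at h2
          omega
        · rw [mul_add, X, monomial_mul, h1, one_mul]
          ring
  obtain ⟨g, r, hg, hr, h⟩ := key f.support fun d hd => hf.degree_eq_of_mem_support hd
  exact ⟨g, r, hg, hr, by rw [← h]; exact f.as_sum⟩

theorem exists_eq_C_mul_X_none_add_rename_some {k : Type} [Field k] {σ : Type}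
    {f : MvPolynomial (Option σ) k} (hf : f.IsHomogeneous 1) :
    ∃ (c : k) (r : MvPolynomial σ k), r.IsHomogeneous 1 ∧ f = C c * X none + rename some r := by
  obtain ⟨g, r, hg, hr, rfl⟩ := exists_eq_X_none_mul_add_rename_some (m := 0) hf
  refine ⟨coeff 0 g, r, hr, ?_⟩
  rw [mul_comm, ← totalDegree_eq_zero_iff_eq_C.1 (Nat.le_zero.1 hg.totalDegree_le)]

namespace IsAdapted

theorem X_pow_dvd_rename_inr {k : Type} [Field k] {ι τ : Type} (i : ι) {g : MvPolynomial τ k}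
    {m : ℕ} (hg : g.IsHomogeneous m)
    {γ : MvPolynomial (ι ⊕ τ) k →ₐ[k] PowerSeries k}
    (hγ : ∀ v, v ≠ Sum.inl i → PowerSeries.X ∣ γ (X v)) :
    PowerSeries.X ^ m ∣ γ (rename Sum.inr g) :=
  X_pow_dvd_algHom_of_isHomogeneous γ hg.rename_isHomogeneous
    (X_dvd_of_mem_vars_rename (i := i) (by simp) hγ)

variable {k : Type} [Field k] {ι τ : Type} [Fintype ι] [Fintype τ]
  {I : Ideal (MvPolynomial (ι ⊕ τ) k)}

theorem eval_single_eq_zero [DecidableEq ι] [DecidableEq τ] (hI : IsAdapted I) (i : ι)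
    {f : MvPolynomial (ι ⊕ τ) k} (hf : f ∈ I) : eval (Pi.single (Sum.inl i) 1) f = 0 := by
  obtain ⟨γ, hγI, h1, h2, h3⟩ := hI.exists_arc i 0
  have h4 : (PowerSeries.constantCoeff (R := k)).comp γ.toRingHom =
      eval (Pi.single (Sum.inl i) 1) := by
    refine ringHom_ext (fun r => ?_) ?_
    · have : γ (C r) = PowerSeries.C r := γ.commutes r
      simp [this]
    · rintro (j | u)
      · by_cases h : j = i
        · subst h
          simpa using h1
        · have h5 : (Sum.inl j : ι ⊕ τ) ≠ Sum.inl i := by simpa using h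
          simpa [Pi.single_eq_of_ne h5] using h2 j h
      · simpa using (h3 u).1
  rw [← h4]
  simp [hγI f hf]

theorem exists_quadric_eq [Infinite k] [DecidableEq ι] (hI : IsAdapted I) {i j : ι}
    (hij : i ≠ j) : ∃ α α' b : MvPolynomial τ k, α.IsHomogeneous 1 ∧ α'.IsHomogeneous 1 ∧
      b.IsHomogeneous 2 ∧ X (Sum.inl i) * X (Sum.inl j) + rename Sum.inr α * X (Sum.inl j) +
        rename Sum.inr α' * X (Sum.inl i) + rename Sum.inr b ∈ I := by
  classical
  obtain ⟨q, hq0, hq, hqI⟩ := hI.exists_quadric hij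
  obtain ⟨g, r, hg, hr, rfl⟩ := exists_eq_X_none_mul_add_rename_some hq
  obtain ⟨a, g', hg', rfl⟩ := exists_eq_C_mul_X_none_add_rename_some hg
  obtain ⟨c, l, hl, rfl⟩ := exists_eq_C_mul_X_none_add_rename_some hg'
  obtain ⟨r1, b, hr1, hb, rfl⟩ := exists_eq_X_none_mul_add_rename_some hr
  obtain ⟨d, l', hl', rfl⟩ := exists_eq_C_mul_X_none_add_rename_some hr1
  have hq2 : C a * X (Sum.inl j) ^ 2 + C d * X (Sum.inl i) ^ 2 +
      C c * (X (Sum.inl i) * X (Sum.inl j)) + rename Sum.inr l * X (Sum.inl j) +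
        rename Sum.inr l' * X (Sum.inl i) + rename Sum.inr b ∈ I := by
    convert hqI using 1
    simp only [map_add, map_mul, rename_X, rename_C, rename_rename]
    have h1 : (pairVar i j ∘ some ∘ some : τ → ι ⊕ τ) = Sum.inr := rfl
    have h2 : ((pairVar i j ∘ some) ∘ some : τ → ι ⊕ τ) = Sum.inr := rfl
    have h3 : (pairVar i j (none : Option (Option τ))) = Sum.inl j := rfl
    have h4 : (pairVar i j (some (none : Option τ))) = Sum.inl i := rfl
    rw [h3, h4, h1]
    ring
  have hr0 : ∀ (i : ι) (f : MvPolynomial τ k) (m : ℕ), f.IsHomogeneous (m + 1) →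
      eval (Pi.single (Sum.inl i : ι ⊕ τ) (1 : k)) (rename Sum.inr f) = 0 := by
    intro i f m hf
    rw [eval_rename]
    have : (Pi.single (Sum.inl i : ι ⊕ τ) (1 : k)) ∘ Sum.inr = (0 : τ → k) := by
      funext u; simp
    rw [this]
    simpa using eval_smul_of_isHomogeneous hf (0 : k) (0 : τ → k)
  have hne : (Sum.inl i : ι ⊕ τ) ≠ Sum.inl j := by simpa using hij
  have ha : a = 0 := by
    have := hI.eval_single_eq_zero j hq2
    simpa [hr0 _ _ _ hl, hr0 _ _ _ hl', hr0 _ _ _ hb, Pi.single_eq_of_ne hne] using this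
  have hd : d = 0 := by
    have := hI.eval_single_eq_zero i hq2
    simpa [hr0 _ _ _ hl, hr0 _ _ _ hl', hr0 _ _ _ hb, Pi.single_eq_of_ne hne.symm] using this
  subst ha hd
  simp only [map_zero, zero_mul, zero_add] at hq2
  have hc : c ≠ 0 := by
    rintro rfl
    simp only [map_zero, zero_mul, zero_add] at hq2
    have h1 : l = 0 := by
      refine hI.eq_zero_of_X_mul_rename_add_mem j hl
        (r := rename Sum.inr l' * X (Sum.inl i) + rename Sum.inr b) (fun γ hγ => ?_)
        (by convert hq2 using 1; ring)
      rw [map_add, map_mul, pow_succ]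
      refine dvd_add (mul_dvd_mul (X_pow_dvd_rename_inr j hl' hγ) (hγ _ hne)) ?_
      rw [← pow_succ]
      exact X_pow_dvd_rename_inr j hb hγ
    subst h1
    have h2 : l' = 0 := by
      refine hI.eq_zero_of_X_mul_rename_add_mem i hl'
        (r := rename Sum.inr b) (fun γ hγ => X_pow_dvd_rename_inr i hb hγ)
        (by convert hq2 using 1; simp; ring)
    subst h2
    have : Nonempty ι := ⟨i⟩
    have h3 : b = 0 := hI.eq_zero_of_rename_inr_mem (by simpa using hq2)
    subst h3
    simp at hq0
  refine ⟨C c⁻¹ * l, C c⁻¹ * l', C c⁻¹ * b, hl.C_mul _, hl'.C_mul _, hb.C_mul _, ?_⟩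
  convert I.mul_mem_left (C c⁻¹) hq2 using 1
  have h1 : (C c⁻¹ * C c : MvPolynomial (ι ⊕ τ) k) = 1 := by
    rw [← map_mul, inv_mul_cancel₀ hc, map_one]
  simp only [map_mul, rename_C, mul_add, ← mul_assoc, h1]
  ring

end IsAdapted

namespace IsAdapted

variable {k : Type} [Field k] {ι τ : Type} [Fintype ι] [Fintype τ]
  {I : Ideal (MvPolynomial (ι ⊕ τ) k)}

theorem exists_quadrics [Infinite k] [LinearOrder ι] (hI : IsAdapted I) :
    ∃ α b : ι → ι → MvPolynomial τ k,
      (∀ i j, i ≠ j → (α i j).IsHomogeneous 1 ∧ (b i j).IsHomogeneous 2) ∧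
      ∀ i j, i ≠ j → X (Sum.inl i) * X (Sum.inl j) + rename Sum.inr (α i j) * X (Sum.inl j) +
        rename Sum.inr (α j i) * X (Sum.inl i) + rename Sum.inr (b i j) ∈ I := by
  have h : ∀ i j : ι, ∃ α α' b : MvPolynomial τ k, i ≠ j → α.IsHomogeneous 1 ∧
      α'.IsHomogeneous 1 ∧ b.IsHomogeneous 2 ∧
      X (Sum.inl i) * X (Sum.inl j) + rename Sum.inr α * X (Sum.inl j) +
        rename Sum.inr α' * X (Sum.inl i) + rename Sum.inr b ∈ I := by
    intro i j
    by_cases hij : i = j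
    · exact ⟨0, 0, 0, fun h => absurd hij h⟩
    · obtain ⟨α, α', b, h⟩ := hI.exists_quadric_eq hij
      exact ⟨α, α', b, fun _ => h⟩
  choose A A' B hAB using h
  refine ⟨fun i j => if i < j then A i j else A' j i, fun i j => if i < j then B i j else B j i,
    fun i j hij => ?_, fun i j hij => ?_⟩
  · rcases hij.lt_or_gt with h | h
    · simpa [h] using ⟨(hAB i j hij).1, (hAB i j hij).2.2.1⟩
    · simpa [h.not_gt] using ⟨(hAB j i hij.symm).2.1, (hAB j i hij.symm).2.2.1⟩
  · rcases hij.lt_or_gt with h | h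
    · simpa [h, h.not_gt] using (hAB i j hij).2.2.2
    · simp only [h, h.not_gt, if_true, if_false]
      convert (hAB j i hij.symm).2.2.2 using 1
      ring

theorem sub_mul_sub_eq [Infinite k] (hI : IsAdapted I)
    {α b : ι → ι → MvPolynomial τ k}
    (hα : ∀ i j, i ≠ j → (α i j).IsHomogeneous 1) (hb : ∀ i j, i ≠ j → (b i j).IsHomogeneous 2)
    (hq : ∀ i j, i ≠ j → X (Sum.inl i) * X (Sum.inl j) + rename Sum.inr (α i j) * X (Sum.inl j) +
        rename Sum.inr (α j i) * X (Sum.inl i) + rename Sum.inr (b i j) ∈ I)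
    {i j l : ι} (hij : i ≠ j) (hil : i ≠ l) (hjl : j ≠ l) :
    (α i j - α i l) * (α j i - α j l) = α i j * α j i - b i j := by
  have h1 : b i j - (α i j - α i l) * α j l - α j i * α i l = 0 := by
    refine hI.eq_zero_of_X_mul_rename_add_mem l (m := 2)
      (r := X (Sum.inl j) * rename Sum.inr
          (α l i * α i j - b i l - (α i j - α i l) * α l j) +
        rename Sum.inr (α l i * b i j - (α i j - α i l) * b j l - α j i * b i l)) ?_ ?_ ?_
    · exact ((hb i j hij).sub (((hα i j hij).sub (hα i l hil)).mul (hα j l hjl))).sub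
        ((hα j i hij.symm).mul (hα i l hil))
    · intro γ hγ
      rw [map_add, map_mul]
      refine dvd_add ?_ ?_
      · rw [pow_succ']
        refine mul_dvd_mul (hγ _ (by simpa using hjl)) (X_pow_dvd_rename_inr l ?_ hγ)
        exact (((hα l i hil.symm).mul (hα i j hij)).sub (hb i l hil)).sub
          (((hα i j hij).sub (hα i l hil)).mul (hα l j hjl.symm))
      · refine X_pow_dvd_rename_inr l ?_ hγ
        exact (((hα l i hil.symm).mul (hb i j hij)).sub
          (((hα i j hij).sub (hα i l hil)).mul (hb j l hjl))).sub
          ((hα j i hij.symm).mul (hb i l hil))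
    · have e1 := I.mul_mem_left (X (Sum.inl l)) (hq i j hij)
      have e2 := I.mul_mem_left (X (Sum.inl j)) (hq i l hil)
      have e3 := I.mul_mem_left (rename Sum.inr (α i j - α i l)) (hq j l hjl)
      have e4 := I.mul_mem_left (rename Sum.inr (α j i)) (hq i l hil)
      have e5 := I.mul_mem_left (rename Sum.inr (α l i)) (hq i j hij)
      convert I.add_mem (I.sub_mem (I.sub_mem (I.sub_mem e1 e2) e3) e4) e5 using 1
      simp only [map_sub, map_mul]
      ring
  linear_combination h1

theorem mul_sub_ne_zero (hI : IsAdapted I) {i j : ι}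
    {a a' b : MvPolynomial τ k} (ha : a.IsHomogeneous 1) (ha' : a'.IsHomogeneous 1)
    (hq : X (Sum.inl i) * X (Sum.inl j) + rename Sum.inr a * X (Sum.inl j) +
        rename Sum.inr a' * X (Sum.inl i) + rename Sum.inr b ∈ I) : a * a' - b ≠ 0 := by
  intro h
  have hb : b = a * a' := by linear_combination -h
  have h1 : (X (Sum.inl i) + rename Sum.inr a) * (X (Sum.inl j) + rename Sum.inr a') ∈ I := by
    convert hq using 1
    rw [hb, map_mul]
    ring
  have key : ∀ (i : ι) (a : MvPolynomial τ k), a.IsHomogeneous 1 →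
      X (Sum.inl i) + rename Sum.inr a ∉ I := by
    classical
    intro i a ha hmem
    have h2 := hI.eq_zero_of_isHomogeneous_one _ hmem
      ((isHomogeneous_X _ _).add ha.rename_isHomogeneous)
    have h3 := congrArg (eval (Pi.single (Sum.inl i : ι ⊕ τ) (1 : k))) h2
    rw [map_add, eval_rename] at h3
    have : (Pi.single (Sum.inl i : ι ⊕ τ) (1 : k)) ∘ Sum.inr = (0 : τ → k) := by
      funext u; simp
    rw [this] at h3
    have h4 := eval_smul_of_isHomogeneous ha (0 : k) (0 : τ → k)
    simp only [smul_zero, pow_one, zero_mul] at h4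
    simp at h3 h4
    simp [h4] at h3
  rcases hI.prime.mem_or_mem h1 with h | h
  · exact key i a ha h
  · exact key j a' ha' h

end IsAdapted

theorem prime_of_isHomogeneous_one {k : Type} [Field k] {σ : Type}
    {f : MvPolynomial σ k} (hf : f.IsHomogeneous 1) (hf0 : f ≠ 0) : Prime f := by
  rw [← UniqueFactorizationMonoid.irreducible_iff_prime]
  refine irreducible_of_totalDegree_eq_one (hf.totalDegree hf0) fun x hx => ?_
  obtain ⟨d, hd⟩ := ne_zero_iff.1 hf0
  rcases eq_or_ne x 0 with rfl | h
  · exact absurd (zero_dvd_iff.1 (hx d)) hd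
  · exact IsUnit.mk0 x h

theorem exists_smul_eq_of_dvd {k : Type} [Field k] {σ : Type}
    {f g : MvPolynomial σ k} (hf : f.IsHomogeneous 1) (hf0 : f ≠ 0) (hg : g.IsHomogeneous 1)
    (h : f ∣ g) : ∃ t : k, g = t • f := by
  obtain ⟨q, rfl⟩ := h
  have h1 : q.IsHomogeneous 0 := hf.of_mul_left hf0 hg
  refine ⟨coeff 0 q, ?_⟩
  conv_lhs => rw [totalDegree_eq_zero_iff_eq_C.1 (Nat.le_zero.1 h1.totalDegree_le)]
  rw [smul_eq_C_mul, mul_comm]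

theorem exists_smul_eq_of_dvd_mul {k : Type} [Field k] {σ : Type}
    {f g g' : MvPolynomial σ k} (hf : f.IsHomogeneous 1) (hf0 : f ≠ 0) (hg : g.IsHomogeneous 1)
    (hg' : g'.IsHomogeneous 1) (h : f ∣ g * g') : (∃ t : k, g = t • f) ∨ ∃ t : k, g' = t • f :=
  ((prime_of_isHomogeneous_one hf hf0).dvd_or_dvd h).imp (exists_smul_eq_of_dvd hf hf0 hg)
    (exists_smul_eq_of_dvd hf hf0 hg')

section Collinear

variable {k : Type} [Field k] {ι σ : Type} {α β : ι → ι → MvPolynomial σ k}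

theorem sub_ne_zero_of_mul_eq
    (h : ∀ i j l, i ≠ j → i ≠ l → j ≠ l → (α i j - α i l) * (α j i - α j l) = β i j)
    (hβ : ∀ i j, i ≠ j → β i j ≠ 0) {i j l : ι} (hij : i ≠ j) (hil : i ≠ l) (hjl : j ≠ l) :
    α i j - α i l ≠ 0 := by
  intro h0
  apply hβ i j hij
  rw [← h i j l hij hil hjl, h0, zero_mul]

theorem exists_eq_smul_or_exists_eq_smul (hα : ∀ i j, i ≠ j → (α i j).IsHomogeneous 1)
    (h : ∀ i j l, i ≠ j → i ≠ l → j ≠ l → (α i j - α i l) * (α j i - α j l) = β i j)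
    (hβ : ∀ i j, i ≠ j → β i j ≠ 0) {i j l m o : ι} (hij : i ≠ j) (hil : i ≠ l) (him : i ≠ m)
    (hjl : j ≠ l) (hjm : j ≠ m) (hio : i ≠ o) (hjo : j ≠ o)
    (hind : ∀ t : k, α i j - α i m ≠ t • (α i j - α i l)) :
    (∃ s : k, α i j - α i o = s • (α i j - α i l)) ∨
      ∃ s : k, α i j - α i o = s • (α i j - α i m) := by
  have hom : ∀ a b c, a ≠ b → a ≠ c → (α a b - α a c).IsHomogeneous 1 :=
    fun a b c hab hac => (hα a b hab).sub (hα a c hac)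
  have hl := sub_ne_zero_of_mul_eq h hβ hij hil hjl
  have ho := sub_ne_zero_of_mul_eq h hβ hij hio hjo
  have h1 : (α i j - α i l) ∣ (α i j - α i m) * (α j i - α j m) := by
    rw [h i j m hij him hjm, ← h i j l hij hil hjl]
    exact dvd_mul_right _ _
  rcases exists_smul_eq_of_dvd_mul (hom _ _ _ hij hil) hl (hom _ _ _ hij him)
    (hom _ _ _ hij.symm hjm) h1 with ⟨t, ht⟩ | ⟨t, ht⟩
  · exact absurd ht (hind t)
  have ht0 : t ≠ 0 := by
    rintro rfl
    rw [zero_smul] at ht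
    exact sub_ne_zero_of_mul_eq h hβ hij.symm hjm him ht
  have h2 : (α i j - α i o) ∣ (α i j - α i m) * (t • (α i j - α i l)) := by
    rw [← ht, h i j m hij him hjm, ← h i j o hij hio hjo]
    exact dvd_mul_right _ _
  have inv : ∀ (f g : MvPolynomial σ k) (s : k), g ≠ 0 → g = s • f → f = s⁻¹ • g := by
    rintro f g s hg rfl
    rw [smul_smul, inv_mul_cancel₀, one_smul]
    rintro rfl
    simp at hg
  rcases exists_smul_eq_of_dvd_mul (hom _ _ _ hij hio) ho (hom _ _ _ hij him)
    ((homogeneousSubmodule σ k 1).smul_mem t (hom _ _ _ hij hil)) h2 with ⟨s, hs⟩ | ⟨s, hs⟩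
  · exact Or.inr ⟨_, inv _ _ s (sub_ne_zero_of_mul_eq h hβ hij him hjm) hs⟩
  · refine Or.inl ⟨s⁻¹ * t, ?_⟩
    rw [mul_smul]
    exact inv _ _ s (smul_ne_zero ht0 hl) hs

theorem exists_sub_eq_smul_sub [Fintype ι] (hcard : 5 ≤ Fintype.card ι)
    (hα : ∀ i j, i ≠ j → (α i j).IsHomogeneous 1)
    (h : ∀ i j l, i ≠ j → i ≠ l → j ≠ l → (α i j - α i l) * (α j i - α j l) = β i j)
    (hβ : ∀ i j, i ≠ j → β i j ≠ 0) {i j l m : ι} (hij : i ≠ j) (hil : i ≠ l) (him : i ≠ m)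
    (hjl : j ≠ l) (hjm : j ≠ m) (hlm : l ≠ m) :
    ∃ t : k, α i j - α i m = t • (α i j - α i l) := by
  classical
  by_contra! hind
  obtain ⟨o, ho⟩ : ∃ o, o ∉ ({i, j, l, m} : Finset ι) := by
    by_contra! hall
    have h1 := Finset.card_le_card (fun x _ => hall x : Finset.univ ⊆ ({i, j, l, m} : Finset ι))
    have h2 := Finset.card_le_four (a := i) (b := j) (c := l) (d := m)
    rw [Finset.card_univ] at h1
    omega
  simp only [Finset.mem_insert, Finset.mem_singleton, not_or] at ho
  obtain ⟨hoi, hoj, hol, hom⟩ := ho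
  have key : ∀ s t : k, s • (α i j - α i l) + t • (α i j - α i m) = 0 → s = 0 ∧ t = 0 := by
    intro s t hst
    have ht : t = 0 := by
      by_contra ht
      apply hind (-(t⁻¹ * s))
      have : α i j - α i m = t⁻¹ • (t • (α i j - α i m)) := by
        rw [smul_smul, inv_mul_cancel₀ ht, one_smul]
      rw [this, eq_neg_of_add_eq_zero_right hst, smul_neg, smul_smul, neg_smul]
    subst ht
    rw [zero_smul, add_zero] at hst
    exact ⟨(smul_eq_zero.1 hst).resolve_right (sub_ne_zero_of_mul_eq h hβ hij hil hjl), rfl⟩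
  have d1 := exists_eq_smul_or_exists_eq_smul hα h hβ hij hil him hjl hjm (Ne.symm hoi)
    (Ne.symm hoj) hind
  have d2 := exists_eq_smul_or_exists_eq_smul hα h hβ him hij hil hjm.symm hlm.symm (Ne.symm hoi)
    (Ne.symm hom) (fun t ht => by
      have := (key 1 (t - 1) (by linear_combination (norm := module) ht)).1
      simp at this)
  have d3 := exists_eq_smul_or_exists_eq_smul hα h hβ hil hij him hjl.symm hlm (Ne.symm hoi)
    (Ne.symm hol) (fun t ht => by
      have := (key (-1 + t) 1 (by linear_combination (norm := module) ht)).2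
      simp at this)
  have n1 := sub_ne_zero_of_mul_eq h hβ hij (Ne.symm hoi) (Ne.symm hoj)
  have n2 := sub_ne_zero_of_mul_eq h hβ him (Ne.symm hoi) (Ne.symm hom)
  have n3 := sub_ne_zero_of_mul_eq h hβ hil (Ne.symm hoi) (Ne.symm hol)
  rcases d1 with ⟨s, hs⟩ | ⟨s, hs⟩
  · rcases d2 with ⟨r, hr⟩ | ⟨r, hr⟩
    · have := (key s (r - 1) (by linear_combination (norm := module) hr - hs)).1
      rw [this, zero_smul] at hs
      exact n1 hs
    · obtain ⟨h1, h2⟩ := key (s - r) (r - 1) (by linear_combination (norm := module) hr - hs)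
      have hs1 : s = 1 := by linear_combination h1 + h2
      rw [hs1, one_smul] at hs
      exact n3 (by linear_combination hs)
  · rcases d3 with ⟨r, hr⟩ | ⟨r, hr⟩
    · have := (key (r - 1) s (by linear_combination (norm := module) hr - hs)).2
      rw [this, zero_smul] at hs
      exact n1 hs
    · obtain ⟨h1, h2⟩ := key (r - 1) (s - r) (by linear_combination (norm := module) hr - hs)
      have hs1 : s = 1 := by linear_combination h1 + h2
      rw [hs1, one_smul] at hs
      exact n2 (by linear_combination hs)

theorem exists_eq_add_smul [Fintype ι] (hcard : 5 ≤ Fintype.card ι)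
    (hα : ∀ i j, i ≠ j → (α i j).IsHomogeneous 1)
    (h : ∀ i j l, i ≠ j → i ≠ l → j ≠ l → (α i j - α i l) * (α j i - α j l) = β i j)
    (hβ : ∀ i j, i ≠ j → β i j ≠ 0) :
    ∃ (μ ν : ι → MvPolynomial σ k) (s t : ι → ι → k),
      (∀ i, (μ i).IsHomogeneous 1 ∧ (ν i).IsHomogeneous 1 ∧ ν i ≠ 0) ∧
      (∀ i j l, i ≠ j → i ≠ l → j ≠ l → s i j ≠ s i l) ∧
      (∀ i j l, i ≠ j → i ≠ l → j ≠ l → (s i j - s i l) * (s j i - s j l) = t i j) ∧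
      (∀ i j, i ≠ j → α i j = μ i + s i j • ν i) ∧
      ∀ i j, i ≠ j → β i j = t i j • (ν i * ν j) := by
  classical
  have h1 : ∀ S : Finset ι, S.card ≤ 2 → ∃ j, j ∉ S := by
    intro S hS
    by_contra! hall
    have h1 := Finset.card_le_card (fun x _ => hall x : Finset.univ ⊆ S)
    rw [Finset.card_univ] at h1
    omega
  have h2 : ∀ i, ∃ j l : ι, i ≠ j ∧ i ≠ l ∧ j ≠ l := by
    intro i
    obtain ⟨j, hj⟩ := h1 {i} (by simp)
    obtain ⟨l, hl⟩ := h1 {i, j} Finset.card_le_two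
    simp only [Finset.mem_insert, Finset.mem_singleton, not_or] at hj hl
    exact ⟨j, l, Ne.symm hj, Ne.symm hl.1, Ne.symm hl.2⟩
  choose p q hip hiq hpq using h2
  have h3 : ∀ i j, ∃ s : k, i ≠ j → α i j = α i (p i) + s • (α i (p i) - α i (q i)) := by
    intro i j
    by_cases hij : i = j
    · exact ⟨0, fun h => absurd hij h⟩
    by_cases hj : j = p i
    · exact ⟨0, fun _ => by rw [hj]; simp⟩
    by_cases hj' : j = q i
    · exact ⟨-1, fun _ => by rw [hj']; module⟩
    obtain ⟨t, ht⟩ := exists_sub_eq_smul_sub hcard hα h hβ (hip i) (hiq i) hij (hpq i)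
      (Ne.symm hj) (Ne.symm hj')
    exact ⟨-t, fun _ => by linear_combination (norm := module) -ht⟩
  choose s hs using h3
  have hν : ∀ i, α i (p i) - α i (q i) ≠ 0 := fun i =>
    sub_ne_zero_of_mul_eq h hβ (hip i) (hiq i) (hpq i)
  have hne : ∀ i j l, i ≠ j → i ≠ l → j ≠ l → s i j ≠ s i l := by
    intro i j l hij hil hjl heq
    apply sub_ne_zero_of_mul_eq h hβ hij hil hjl
    rw [hs i j hij, hs i l hil, heq, sub_self]
  have hprod : ∀ i j l, i ≠ j → i ≠ l → j ≠ l → β i j = ((s i j - s i l) * (s j i - s j l)) •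
      ((α i (p i) - α i (q i)) * (α j (p j) - α j (q j))) := by
    intro i j l hij hil hjl
    rw [← h i j l hij hil hjl, hs i j hij, hs i l hil, hs j i hij.symm, hs j l hjl]
    simp only [smul_eq_C_mul, map_mul, map_sub]
    ring
  have h4 : ∀ i j, ∃ t : k, i ≠ j →
      β i j = t • ((α i (p i) - α i (q i)) * (α j (p j) - α j (q j))) := by
    intro i j
    by_cases hij : i = j
    · exact ⟨0, fun h => absurd hij h⟩
    obtain ⟨l, hl⟩ := h1 {i, j} Finset.card_le_two
    simp only [Finset.mem_insert, Finset.mem_singleton, not_or] at hl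
    exact ⟨_, fun _ => hprod i j l hij (Ne.symm hl.1) (Ne.symm hl.2)⟩
  choose t ht using h4
  refine ⟨fun i => α i (p i), fun i => α i (p i) - α i (q i), s, t, fun i => ⟨hα _ _ (hip i),
    (hα _ _ (hip i)).sub (hα _ _ (hiq i)), hν i⟩, hne, fun i j l hij hil hjl => ?_, hs, ht⟩
  refine smul_left_injective k (mul_ne_zero (hν i) (hν j)) ?_
  exact (hprod i j l hij hil hjl).symm.trans (ht i j hij)

end Collinear

namespace IsAdapted

variable {k : Type} [Field k] {ι τ : Type} [Fintype ι] [Fintype τ]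
  {I : Ideal (MvPolynomial (ι ⊕ τ) k)}

theorem exists_normal_form [Infinite k] [LinearOrder ι] (hI : IsAdapted I)
    (hcard : 5 ≤ Fintype.card ι) :
    ∃ (μ ν : ι → MvPolynomial τ k) (s t : ι → ι → k),
      (∀ i, (μ i).IsHomogeneous 1 ∧ (ν i).IsHomogeneous 1) ∧
      (∀ i j l, i ≠ j → i ≠ l → j ≠ l → s i j ≠ s i l) ∧
      (∀ i j l, i ≠ j → i ≠ l → j ≠ l → (s i j - s i l) * (s j i - s j l) = t i j) ∧
      ∀ i j, i ≠ j →
        (X (Sum.inl i) + rename Sum.inr (μ i) + s i j • rename Sum.inr (ν i)) *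
          (X (Sum.inl j) + rename Sum.inr (μ j) + s j i • rename Sum.inr (ν j)) -
        t i j • (rename Sum.inr (ν i) * rename Sum.inr (ν j)) ∈ I := by
  obtain ⟨α, b, hαb, hq⟩ := hI.exists_quadrics
  obtain ⟨μ, ν, s, t, hμν, hs, ht, hα, hb⟩ := exists_eq_add_smul (β := fun i j =>
      α i j * α j i - b i j) hcard (fun i j h => (hαb i j h).1)
    (fun i j l hij hil hjl => hI.sub_mul_sub_eq (fun i j h => (hαb i j h).1)
      (fun i j h => (hαb i j h).2) hq hij hil hjl)
    (fun i j hij => hI.mul_sub_ne_zero (hαb i j hij).1 (hαb j i hij.symm).1 (hq i j hij))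
  refine ⟨μ, ν, s, t, fun i => ⟨(hμν i).1, (hμν i).2.1⟩, hs, ht, fun i j hij => ?_⟩
  convert hq i j hij using 1
  have h1 : b i j = (μ i + s i j • ν i) * (μ j + s j i • ν j) - t i j • (ν i * ν j) := by
    rw [← hα i j hij, ← hα j i hij.symm]
    linear_combination -hb i j hij
  rw [h1, hα i j hij, hα j i hij.symm]
  simp only [map_add, map_sub, map_mul, map_smul]
  ring

end IsAdapted

theorem homogeneousComponent_X_mul {k : Type} [Field k] {σ : Type} (v : σ) (m : ℕ)
    (f : MvPolynomial σ k) :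
    homogeneousComponent (m + 1) (X v * f) = X v * homogeneousComponent m f := by
  conv_lhs => rw [← sum_homogeneousComponent f, Finset.mul_sum, map_sum]
  have h : ∀ j, homogeneousComponent (m + 1) (X v * homogeneousComponent j f) =
      if m = j then X v * homogeneousComponent j f else 0 := by
    intro j
    have h1 := (isHomogeneous_X k v).mul (homogeneousComponent_isHomogeneous j f)
    rw [homogeneousComponent_of_mem h1]
    congr 1
    simp [add_comm 1 j]
  simp only [h, Finset.sum_ite_eq, Finset.mem_range]
  split_ifs with h1
  · rfl
  · rw [homogeneousComponent_eq_zero _ _ (by omega), mul_zero]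

theorem sum_eval_pderiv_mul_mul {k : Type} [Field k] {σ : Type} [Fintype σ]
    (p v : σ → k) (f g : MvPolynomial σ k) :
    ∑ i, eval p (pderiv i (f * g)) * v i =
      eval p f * ∑ i, eval p (pderiv i g) * v i + (∑ i, eval p (pderiv i f) * v i) * eval p g := by
  rw [Finset.mul_sum, Finset.sum_mul, ← Finset.sum_add_distrib]
  refine Finset.sum_congr rfl fun i _ => ?_
  rw [Derivation.leibniz, smul_eq_mul, smul_eq_mul, map_add, map_mul, map_mul]
  ring

theorem sum_eval_pderiv_mul_sub {k : Type} [Field k] {σ : Type} [Fintype σ]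
    (p v : σ → k) (f g : MvPolynomial σ k) :
    ∑ i, eval p (pderiv i (f - g)) * v i =
      ∑ i, eval p (pderiv i f) * v i - ∑ i, eval p (pderiv i g) * v i := by
  simp [sub_mul]

theorem sum_eval_pderiv_mul_smul {k : Type} [Field k] {σ : Type} [Fintype σ]
    (p v : σ → k) (t : k) (f : MvPolynomial σ k) :
    ∑ i, eval p (pderiv i (t • f)) * v i = t * ∑ i, eval p (pderiv i f) * v i := by
  simp [Finset.mul_sum, mul_assoc]

theorem sum_eval_pderiv_mul_of_isHomogeneous_one {k : Type} [Field k] {σ : Type} [Fintype σ]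
    (p v : σ → k) {f : MvPolynomial σ k} (hf : f.IsHomogeneous 1) :
    ∑ i, eval p (pderiv i f) * v i = eval v f := by
  have h := congrArg (eval v) hf.sum_X_mul_pderiv
  rw [one_smul, map_sum] at h
  rw [← h]
  refine Finset.sum_congr rfl fun i _ => ?_
  have h1 : (pderiv i f).IsHomogeneous 0 := hf.pderiv
  rw [totalDegree_eq_zero_iff_eq_C.1 (Nat.le_zero.1 h1.totalDegree_le)]
  simp [mul_comm]

namespace IsAdapted

/-- A polynomial whose monomials involve at most one of the `x`-variables. -/
def normalPoly {k : Type} [Field k] {ι τ : Type} [Fintype ι]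
    (g : ι → MvPolynomial (Option τ) k) (g0 : MvPolynomial τ k) : MvPolynomial (ι ⊕ τ) k :=
  ∑ i, X (Sum.inl i) * rename (optionVar i) (g i) + rename Sum.inr g0

theorem exists_sub_normalPoly_mem {k : Type} [Field k] {ι τ : Type} [Fintype ι]
    {Q : Ideal (MvPolynomial (ι ⊕ τ) k)} {α b : ι → ι → MvPolynomial τ k}
    (hQ : ∀ i j, i ≠ j → X (Sum.inl i) * X (Sum.inl j) + rename Sum.inr (α i j) * X (Sum.inl j) +
        rename Sum.inr (α j i) * X (Sum.inl i) + rename Sum.inr (b i j) ∈ Q)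
    (f : MvPolynomial (ι ⊕ τ) k) : ∃ g g0, f - normalPoly g g0 ∈ Q := by
  classical
  let M : Set (MvPolynomial (ι ⊕ τ) k) := {f | ∃ g g0, f - normalPoly g g0 ∈ Q}
  have hadd : ∀ f f', f ∈ M → f' ∈ M → f + f' ∈ M := by
    rintro f f' ⟨g, g0, h⟩ ⟨g', g0', h'⟩
    refine ⟨g + g', g0 + g0', ?_⟩
    convert Q.add_mem h h' using 1
    simp only [normalPoly, Pi.add_apply, map_add, mul_add, Finset.sum_add_distrib]
    ring
  have hmul : ∀ (p : MvPolynomial τ k) f, f ∈ M → rename Sum.inr p * f ∈ M := by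
    rintro p f ⟨g, g0, h⟩
    refine ⟨fun i => rename some p * g i, p * g0, ?_⟩
    convert Q.mul_mem_left (rename Sum.inr p) h using 1
    have h1 : ∀ i : ι, rename (optionVar i) (rename some p) =
        (rename Sum.inr p : MvPolynomial (ι ⊕ τ) k) := fun i => by rw [rename_rename]; rfl
    simp only [normalPoly, map_mul, h1, mul_sub, mul_add, Finset.mul_sum]
    congr 2
    refine Finset.sum_congr rfl fun i _ => ?_
    ring
  have hmem : ∀ f f', f - f' ∈ Q → f' ∈ M → f ∈ M := by
    rintro f f' h ⟨g, g0, h'⟩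
    refine ⟨g, g0, ?_⟩
    convert Q.add_mem h h' using 1
    ring
  have hone : ∀ i g, X (Sum.inl i) * rename (optionVar i) g ∈ M := by
    intro i g
    refine ⟨Pi.single i g, 0, ?_⟩
    rw [normalPoly, Finset.sum_eq_single i]
    · simp
    · intro j _ hj
      simp [hj]
    · simp
  have hinr : ∀ g : MvPolynomial τ k, rename Sum.inr g ∈ M := fun g => ⟨0, g, by simp [normalPoly]⟩
  have hopt : ∀ i g, rename (optionVar i) g ∈ M := by
    intro i g
    induction g using MvPolynomial.induction_on with
    | C a => simpa using hinr (MvPolynomial.C a)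
    | add p q hp hq => rw [map_add]; exact hadd _ _ hp hq
    | mul_X p o hp =>
      rcases o with _ | u
      · rw [map_mul, rename_X, mul_comm]
        exact hone i p
      · have := hmul (X u) _ hp
        rw [rename_X] at this
        rw [map_mul, rename_X, mul_comm]
        exact this
  have htwo : ∀ i j, i ≠ j → ∀ g, X (Sum.inl i) * rename (optionVar j) g ∈ M := by
    intro i j hij g
    induction g using MvPolynomial.induction_on with
    | C a => simpa using hone i (MvPolynomial.C a)
    | add p q hp hq => rw [map_add, mul_add]; exact hadd _ _ hp hq
    | mul_X p o hp =>
      rcases o with _ | u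
      · refine hmem _ _ (?_ : _ - (rename Sum.inr (-α i j) * (X (Sum.inl j) *
          rename (optionVar j) p) + (rename Sum.inr (-α j i) * (X (Sum.inl i) *
          rename (optionVar j) p) + rename Sum.inr (-b i j) * rename (optionVar j) p)) ∈ Q) ?_
        · convert Q.mul_mem_left (rename (optionVar j) p) (hQ i j hij) using 1
          rw [map_mul, rename_X, map_neg, map_neg, map_neg]
          change _ * (_ * X (Sum.inl j)) - _ = _
          ring
        · exact hadd _ _ (hmul _ _ (hone j p)) (hadd _ _ (hmul _ _ hp) (hmul _ _ (hopt j p)))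
      · have := hmul (X u) _ hp
        rw [rename_X] at this
        rw [map_mul, rename_X, ← mul_assoc, mul_comm]
        exact this
  have hX : ∀ v f, f ∈ M → f * X v ∈ M := by
    rintro (l | u) f hf
    · obtain ⟨g, g0, h⟩ := hf
      refine hmem _ _ (?_ : _ - normalPoly g g0 * X (Sum.inl l) ∈ Q) ?_
      · rw [← sub_mul]
        exact Q.mul_mem_right _ h
      · rw [normalPoly, add_mul, Finset.sum_mul]
        refine hadd _ _ (Finset.sum_induction _ (· ∈ M) hadd ?_ fun i _ => ?_) ?_
        · simpa using hinr 0
        · by_cases hil : i = l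
          · subst hil
            have := hone i (g i * X none)
            rw [map_mul, rename_X, ← mul_assoc] at this
            exact this
          · have := htwo l i (Ne.symm hil) (X none * g i)
            rw [map_mul, rename_X, mul_comm] at this
            exact this
        · exact hmul _ _ (by simpa using hone l 1)
    · have := hmul (X u) f hf
      rw [rename_X, mul_comm] at this
      exact this
  change f ∈ M
  induction f using MvPolynomial.induction_on with
  | C a => simpa using hinr (MvPolynomial.C a)
  | add p q hp hq => exact hadd _ _ hp hq
  | mul_X p v hp => exact hX v p hp

variable {k : Type} [Field k] {ι τ : Type} [Fintype ι] [Fintype τ]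
  {I : Ideal (MvPolynomial (ι ⊕ τ) k)}

theorem normalPoly_eq_zero_of_mem [Infinite k] [Nonempty ι] (hI : IsAdapted I)
    {g : ι → MvPolynomial (Option τ) k} {g0 : MvPolynomial τ k} (h : normalPoly g g0 ∈ I) :
    normalPoly g g0 = 0 := by
  classical
  have hcomp : ∀ m, ∑ i, X (Sum.inl i) * rename (optionVar i) (homogeneousComponent m (g i)) +
      rename Sum.inr (homogeneousComponent (m + 1) g0) ∈ I := by
    intro m
    convert hI.homogeneousComponent_mem _ h (m + 1) using 1
    rw [normalPoly, map_add, map_sum, rename_homogeneousComponent]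
    congr 1
    refine Finset.sum_congr rfl fun i _ => ?_
    rw [rename_homogeneousComponent, homogeneousComponent_X_mul]
  have hg : ∀ i, g i = 0 := by
    intro i
    rw [← sum_homogeneousComponent (g i)]
    refine Finset.sum_eq_zero fun m _ => ?_
    have h1 := hcomp m
    rw [← Finset.add_sum_erase _ _ (Finset.mem_univ i), add_assoc] at h1
    refine hI.eq_zero_of_X_mul_add_mem i (homogeneousComponent_isHomogeneous m _) ?_ h1
    intro γ hγ
    rw [map_add, map_sum]
    refine dvd_add (Finset.dvd_sum fun j hj => ?_) ?_
    · have hji : j ≠ i := Finset.ne_of_mem_erase hj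
      rw [map_mul, pow_succ']
      refine mul_dvd_mul (hγ _ (by simpa using hji)) ?_
      refine X_pow_dvd_algHom_of_isHomogeneous γ
        (homogeneousComponent_isHomogeneous m (g j)).rename_isHomogeneous fun v hv => ?_
      apply hγ
      rintro rfl
      obtain ⟨o, _, ho⟩ := Finset.mem_image.1 (vars_rename _ _ hv)
      rcases o with _ | u
      · exact hji (Sum.inl_injective ho)
      · simp [optionVar] at ho
    · exact X_pow_dvd_rename_inr i (homogeneousComponent_isHomogeneous (m + 1) g0) hγ
  have h2 : normalPoly g g0 = rename Sum.inr g0 := by simp [normalPoly, hg]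
  rw [h2] at h ⊢
  rw [hI.eq_zero_of_rename_inr_mem h, map_zero]

theorem mem_of_forall_mem [Infinite k] [Nonempty ι] (hI : IsAdapted I)
    {Q : Ideal (MvPolynomial (ι ⊕ τ) k)} (hQI : Q ≤ I) {α b : ι → ι → MvPolynomial τ k}
    (hQ : ∀ i j, i ≠ j → X (Sum.inl i) * X (Sum.inl j) + rename Sum.inr (α i j) * X (Sum.inl j) +
        rename Sum.inr (α j i) * X (Sum.inl i) + rename Sum.inr (b i j) ∈ Q) : Q = I := by
  refine le_antisymm hQI fun f hf => ?_
  obtain ⟨g, g0, h⟩ := exists_sub_normalPoly_mem hQ f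
  have h1 : normalPoly g g0 ∈ I := by
    convert I.sub_mem hf (hQI h) using 1
    ring
  rwa [hI.normalPoly_eq_zero_of_mem h1, sub_zero] at h

theorem exists_linear_forms [Infinite k] [LinearOrder ι] (hI : IsAdapted I)
    (hcard : 5 ≤ Fintype.card ι)
    (hcone : ∀ v : ι ⊕ τ → k, (∀ f ∈ I, ∀ (x : ι ⊕ τ → k) (t : k), (∀ g ∈ I, eval x g = 0) →
      eval (x + t • v) f = 0) → v = 0)
    {p : ι ⊕ τ → k} (hp : ∃ f ∈ I, eval p f ≠ 0) :
    ∃ ℓ : Fin 4 → MvPolynomial (ι ⊕ τ) k, (∀ a, (ℓ a).IsHomogeneous 1) ∧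
      ∀ v : ι ⊕ τ → k, (∀ a, eval v (ℓ a) = 0) →
        (∀ q ∈ I, q.IsHomogeneous 2 → eval p q = 0 → ∑ i, eval p (pderiv i q) * v i = 0) →
        v = 0 := by
  obtain ⟨μ, ν, s, t, hμν, hs, ht, hq⟩ := hI.exists_normal_form hcard
  have : Nonempty ι := Fintype.card_pos_iff.1 (by omega)
  obtain ⟨y, hy⟩ : ∃ y : ι → MvPolynomial (ι ⊕ τ) k,
    y = fun i => X (Sum.inl i) + rename Sum.inr (μ i) := ⟨_, rfl⟩
  obtain ⟨z, hz⟩ : ∃ z : ι → MvPolynomial (ι ⊕ τ) k,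
    z = fun i => rename Sum.inr (ν i) := ⟨_, rfl⟩
  have hy1 : ∀ i, (y i).IsHomogeneous 1 := fun i => by
    rw [hy]; exact (isHomogeneous_X _ _).add (hμν i).1.rename_isHomogeneous
  have hz1 : ∀ i, (z i).IsHomogeneous 1 := fun i => by
    rw [hz]; exact (hμν i).2.rename_isHomogeneous
  obtain ⟨q, hqdef⟩ : ∃ q : ι → ι → MvPolynomial (ι ⊕ τ) k, q = fun i j =>
    (y i + s i j • z i) * (y j + s j i • z j) - t i j • (z i * z j) := ⟨_, rfl⟩
  have hqI : ∀ i j, i ≠ j → q i j ∈ I := fun i j hij => by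
    rw [hqdef, hy, hz]; exact hq i j hij
  have hspan : Ideal.span {f | ∃ i j, i ≠ j ∧ f = q i j} = I := by
    refine hI.mem_of_forall_mem (Ideal.span_le.2 ?_) (α := fun i j => μ i + s i j • ν i)
      (b := fun i j => (μ i + s i j • ν i) * (μ j + s j i • ν j) - t i j • (ν i * ν j))
      fun i j hij => Ideal.subset_span ⟨i, j, hij, ?_⟩
    · rintro f ⟨i, j, hij, rfl⟩
      exact hqI i j hij
    · simp only [hqdef, hy, hz, map_add, map_sub, map_mul, map_smul]
      ring
  have hlin : ∀ {f : MvPolynomial (ι ⊕ τ) k}, f.IsHomogeneous 1 → ∀ x v : ι ⊕ τ → k, ∀ a : k,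
      eval (x + a • v) f = eval x f + a * eval v f := by
    intro f hf x v a
    rw [← sum_eval_pderiv_mul_of_isHomogeneous_one x (x + a • v) hf,
      ← sum_eval_pderiv_mul_of_isHomogeneous_one x x hf,
      ← sum_eval_pderiv_mul_of_isHomogeneous_one x v hf, Finset.mul_sum,
      ← Finset.sum_add_distrib]
    refine Finset.sum_congr rfl fun i _ => ?_
    simp only [Pi.add_apply, Pi.smul_apply, smul_eq_mul]
    ring
  have hzero : ∀ v : ι ⊕ τ → k, (∀ i, eval v (y i) = 0 ∧ eval v (z i) = 0) → v = 0 := by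
    intro v hv
    refine hcone v fun f hf x a hx => ?_
    rw [← hspan] at hf
    refine Submodule.span_induction (p := fun f _ => eval (x + a • v) f = 0) ?_ (map_zero _)
      (fun f g _ _ hf hg => by rw [map_add, hf, hg, add_zero])
      (fun c f _ hf => by rw [smul_eq_mul, map_mul, hf, mul_zero]) hf
    rintro f ⟨i, j, hij, rfl⟩
    have h1 := hx _ (hqI i j hij)
    have h2 : ∀ i, eval (x + a • v) (y i) = eval x (y i) := fun i => by
      rw [hlin (hy1 i), (hv i).1, mul_zero, add_zero]
    have h3 : ∀ i, eval (x + a • v) (z i) = eval x (z i) := fun i => by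
      rw [hlin (hz1 i), (hv i).2, mul_zero, add_zero]
    rw [← h1]
    simp only [hqdef, map_sub, map_mul, map_add, smul_eval, h2, h3]
  obtain ⟨i, j, hij, hpij⟩ : ∃ i j, i ≠ j ∧ eval p (q i j) ≠ 0 := by
    by_contra! hall
    obtain ⟨f, hf, hpf⟩ := hp
    apply hpf
    rw [← hspan] at hf
    refine Submodule.span_induction (p := fun f _ => eval p f = 0) ?_ (map_zero _)
      (fun f g _ _ hf hg => by rw [map_add, hf, hg, add_zero])
      (fun c f _ hf => by rw [smul_eq_mul, map_mul, hf, mul_zero]) hf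
    rintro f ⟨i, j, hij, rfl⟩
    exact hall i j hij
  have hq2 : ∀ i j, (q i j).IsHomogeneous 2 := by
    intro i j
    rw [hqdef]
    exact (((hy1 i).add ((homogeneousSubmodule _ k 1).smul_mem _ (hz1 i))).mul
      ((hy1 j).add ((homogeneousSubmodule _ k 1).smul_mem _ (hz1 j)))).sub
      ((homogeneousSubmodule _ k 2).smul_mem _ ((hz1 i).mul (hz1 j)))
  have hB : ∀ (v : ι ⊕ τ → k) i j, ∑ a, eval p (pderiv a (q i j)) * v a =
      (eval p (y i) + s i j * eval p (z i)) * (eval v (y j) + s j i * eval v (z j)) +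
      (eval v (y i) + s i j * eval v (z i)) * (eval p (y j) + s j i * eval p (z j)) -
      t i j * (eval p (z i) * eval v (z j) + eval v (z i) * eval p (z j)) := by
    intro v i j
    have h1 : ∀ i j, (y i + s i j • z i).IsHomogeneous 1 := fun i j =>
      (hy1 i).add ((homogeneousSubmodule _ k 1).smul_mem _ (hz1 i))
    simp only [hqdef, sum_eval_pderiv_mul_sub, sum_eval_pderiv_mul_smul, sum_eval_pderiv_mul_mul]
    simp only [sum_eval_pderiv_mul_of_isHomogeneous_one p v (h1 _ _),
      sum_eval_pderiv_mul_of_isHomogeneous_one p v (hz1 _)]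
    simp only [map_add, smul_eval]
  refine ⟨![y i, z i, y j, z j], ?_, fun v hv hT => hzero v ?_⟩
  · intro a
    fin_cases a
    exacts [hy1 i, hz1 i, hy1 j, hz1 j]
  have v0 : eval v (y i) = 0 := hv 0
  have v1 : eval v (z i) = 0 := hv 1
  have v2 : eval v (y j) = 0 := hv 2
  have v3 : eval v (z j) = 0 := hv 3
  intro l
  by_cases hli : l = i
  · rw [hli]; exact ⟨v0, v1⟩
  by_cases hlj : l = j
  · rw [hlj]; exact ⟨v2, v3⟩
  have hBij : ∑ a, eval p (pderiv a (q i j)) * v a = 0 := by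
    rw [hB, v0, v1, v2, v3]; ring
  have hBl : ∀ m, m ≠ l → ∑ a, eval p (pderiv a (q m l)) * v a = 0 := by
    intro m hml
    have h1 := hT (q m l - (eval p (q m l) / eval p (q i j)) • q i j)
      (I.sub_mem (hqI m l hml) (Submodule.smul_of_tower_mem I _ (hqI i j hij)))
      ((hq2 m l).sub ((homogeneousSubmodule _ k 2).smul_mem _ (hq2 i j)))
      (by rw [map_sub, smul_eval, div_mul_cancel₀ _ hpij, sub_self])
    rwa [sum_eval_pderiv_mul_sub, sum_eval_pderiv_mul_smul, hBij, mul_zero, sub_zero] at h1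
  have e1 := hBl i (Ne.symm hli)
  have e2 := hBl j (Ne.symm hlj)
  rw [hB, v0, v1] at e1
  rw [hB, v2, v3] at e2
  have t1 := ht i l j (Ne.symm hli) hij hlj
  have t2 := ht j l i (Ne.symm hlj) hij.symm hli
  have t3 := ht i j l hij (Ne.symm hli) (Ne.symm hlj)
  have hdet : (s l j - s l i) * eval p (q i j) ≠ 0 :=
    mul_ne_zero (sub_ne_zero.2 (hs l j i hlj hli hij.symm)) hpij
  have hqp : eval p (q i j) = (eval p (y i) + s i j * eval p (z i)) *
      (eval p (y j) + s j i * eval p (z j)) - t i j * (eval p (z i) * eval p (z j)) := by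
    simp only [hqdef, map_sub, map_mul, map_add, smul_eval]
  rw [hqp, ← t3] at hdet
  rw [← t1] at e1
  rw [← t2] at e2
  generalize eval p (y i) = a0, eval p (z i) = b0, eval p (y j) = a1, eval p (z j) = b1 at *
  generalize eval v (y l) = y0, eval v (z l) = z0 at *
  have hz0 : z0 = 0 := by
    refine (mul_eq_zero.1 (?_ : _ * z0 = 0)).resolve_left hdet
    linear_combination (a0 + s i l * b0) * e2 - (a1 + s j l * b1) * e1
  refine ⟨(mul_eq_zero.1 (?_ : _ * y0 = 0)).resolve_left hdet, hz0⟩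
  rw [hz0] at e1 e2
  linear_combination (s l j - s l i) * ((a1 + s j l * b1) - b1 * (s j l - s j i)) * e1 -
    (s l j - s l i) * b0 * (s i l - s i j) * e2

end IsAdapted

theorem eval_aeval_eq_eval {k : Type} [Field k] {σ τ : Type} (x : σ → k) (l : τ → MvPolynomial σ k)
    (f : MvPolynomial τ k) : eval x (aeval l f) = eval (fun o => eval x (l o)) f := by
  induction f using MvPolynomial.induction_on with
  | C a => simp
  | add p q hp hq => rw [map_add, map_add, map_add, hp, hq]
  | mul_X p o hp => rw [map_mul, map_mul, map_mul, hp, aeval_X, eval_X]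

theorem sum_eval_pderiv_aeval {k : Type} [Field k] {σ τ : Type} [Fintype σ] [Fintype τ]
    (x v : σ → k) (l : τ → MvPolynomial σ k)
    (f : MvPolynomial τ k) :
    ∑ i, eval x (pderiv i (aeval l f)) * v i =
      ∑ o, eval (fun o => eval x (l o)) (pderiv o f) * ∑ i, eval x (pderiv i (l o)) * v i := by
  classical
  induction f using MvPolynomial.induction_on with
  | C a => simp
  | add p q hp hq =>
    simp only [map_add, add_mul, Finset.sum_add_distrib] at hp hq ⊢
    rw [hp, hq]
  | mul_X p o hp =>
    rw [map_mul, sum_eval_pderiv_mul_mul, hp, aeval_X]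
    simp only [Derivation.leibniz, smul_eq_mul, map_add, map_mul, pderiv_X, add_mul,
      Finset.sum_add_distrib, eval_X, Finset.sum_mul]
    congr 1
    · rw [Finset.sum_eq_single o]
      · rw [Pi.single_eq_same, map_one, mul_one, eval_aeval_eq_eval]
      · intro b _ hb
        simp [hb.symm]
      · simp
    · refine Finset.sum_congr rfl fun u _ => ?_
      ring

section LinForm

variable {k : Type} [Field k] {σ : Type} [Fintype σ] [DecidableEq σ]

/-- The linear form attached to a linear functional. -/
def linForm : Module.Dual k (σ → k) →ₗ[k] MvPolynomial σ k where
  toFun φ := ∑ i, φ (Pi.single i 1) • X i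
  map_add' φ ψ := by simp [add_smul, Finset.sum_add_distrib]
  map_smul' c φ := by simp [Finset.smul_sum, mul_smul]

theorem linForm_apply (φ : Module.Dual k (σ → k)) :
    linForm φ = ∑ i, φ (Pi.single i 1) • X i := rfl

theorem sum_apply_single_smul (φ : Module.Dual k (σ → k)) (x : σ → k) :
    ∑ i, φ (Pi.single i 1) * x i = φ x := by
  conv_rhs => rw [pi_eq_sum_univ' x, map_sum]
  refine Finset.sum_congr rfl fun i _ => ?_
  rw [map_smul, smul_eq_mul, mul_comm]

theorem eval_linForm (φ : Module.Dual k (σ → k)) (x : σ → k) : eval x (linForm φ) = φ x := by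
  rw [linForm_apply, map_sum, ← sum_apply_single_smul]
  simp

theorem isHomogeneous_linForm (φ : Module.Dual k (σ → k)) : (linForm φ).IsHomogeneous 1 :=
  (homogeneousSubmodule σ k 1).sum_mem fun i _ =>
    (homogeneousSubmodule σ k 1).smul_mem _ (isHomogeneous_X k i)

theorem linForm_injective : Function.Injective (linForm : Module.Dual k (σ → k) → _) := by
  intro φ ψ h
  refine LinearMap.ext fun x => ?_
  rw [← eval_linForm, h, eval_linForm]

theorem exists_linForm_eq {f : MvPolynomial σ k} (hf : f.IsHomogeneous 1) :
    ∃ φ, linForm φ = f := by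
  have h := hf.sum_X_mul_pderiv
  rw [one_smul] at h
  refine ⟨∑ i, coeff 0 (pderiv i f) • LinearMap.proj i, ?_⟩
  conv_rhs => rw [← h]
  rw [linForm_apply]
  refine Finset.sum_congr rfl fun i _ => ?_
  have h1 : (pderiv i f).IsHomogeneous 0 := hf.pderiv
  conv_rhs => rw [totalDegree_eq_zero_iff_eq_C.1 (Nat.le_zero.1 h1.totalDegree_le)]
  rw [mul_comm, ← smul_eq_C_mul]
  congr 1
  simp [Pi.single_apply]

theorem coeff_algHom_linForm (γ : MvPolynomial σ k →ₐ[k] PowerSeries k) (m : ℕ)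
    (φ : Module.Dual k (σ → k)) :
    PowerSeries.coeff m (γ (linForm φ)) = φ fun i => PowerSeries.coeff m (γ (X i)) := by
  rw [linForm_apply, map_sum, map_sum, ← sum_apply_single_smul]
  simp

end LinForm

section Tangent

variable {k : Type} [Field k] {σ : Type} [Fintype σ]

/-- The tangent space at `x` of the scheme defined by `I`. -/
def tangentSpace (I : Ideal (MvPolynomial σ k)) (x : σ → k) : Submodule k (σ → k) where
  carrier := {v | ∀ f ∈ I, ∑ i, eval x (pderiv i f) * v i = 0}
  zero_mem' := by simp
  add_mem' := by
    intro v w hv hw f hf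
    simp only [Pi.add_apply, mul_add, Finset.sum_add_distrib]
    rw [hv f hf, hw f hf, add_zero]
  smul_mem' := by
    intro c v hv f hf
    have := hv f hf
    simp only [Pi.smul_apply, smul_eq_mul, mul_left_comm _ c, ← Finset.mul_sum, this, mul_zero]

theorem finrank_tangentSpace_add [DecidableEq σ] {C : Set (σ → k)} {N : ℕ}
    (hs : IsSmoothOfCodim k σ C N) {x : σ → k} (hx : x ∈ C) (hx0 : x ≠ 0) :
    N + Module.finrank k (tangentSpace (vanIdeal k σ C) x) = Fintype.card σ := by
  have h := hs x hx hx0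
  set S := {v : σ → k | ∃ f ∈ vanIdeal k σ C, v = fun i => eval x (pderiv i f)} with hS
  have h1 := Subspace.finrank_add_finrank_dualCoannihilator_eq
    ((Submodule.span k S).map (dotProductEquiv k σ : (σ → k) →ₗ[k] Module.Dual k (σ → k)))
  rw [LinearEquiv.finrank_map_eq, h, Module.finrank_fintype_fun_eq_card] at h1
  rw [← h1]
  congr 1
  refine congrArg (fun p : Submodule k (σ → k) => Module.finrank k p) ?_
  ext v
  rw [Submodule.mem_dualCoannihilator]
  constructor
  · intro hv φ hφ
    obtain ⟨w, hw, rfl⟩ := hφ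
    induction hw using Submodule.span_induction with
    | mem w hw =>
      obtain ⟨f, hf, rfl⟩ := hw
      exact hv f hf
    | zero => simp
    | add u w _ _ h1 h2 => rw [map_add, LinearMap.add_apply, h1, h2, add_zero]
    | smul c w _ h1 => rw [map_smul, LinearMap.smul_apply, h1, smul_zero]
  · intro hv f hf
    exact hv _ ⟨_, Submodule.subset_span ⟨f, hf, rfl⟩, rfl⟩

theorem self_mem_tangentSpace [Infinite k] [DecidableEq σ] {C : Set (σ → k)}
    (hC : ∀ x ∈ C, ∀ t : k, t • x ∈ C) {x : σ → k} (hx : x ∈ C) :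
    x ∈ tangentSpace (vanIdeal k σ C) x := by
  intro f hf
  conv_lhs => rw [← sum_homogeneousComponent f]
  simp only [map_sum, Finset.sum_mul]
  rw [Finset.sum_comm]
  refine Finset.sum_eq_zero fun m _ => ?_
  have h := congrArg (eval x) (homogeneousComponent_isHomogeneous m f).sum_X_mul_pderiv
  rw [map_sum, nsmul_eq_mul, map_mul,
    mem_vanIdeal.1 (homogeneousComponent_mem_vanIdeal hC hf m) x hx, mul_zero] at h
  rw [← h]
  refine Finset.sum_congr rfl fun i _ => ?_
  rw [map_mul, eval_X, mul_comm]

end Tangent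

theorem exists_rename_some_eq_of_pderiv_eq_zero {k : Type} [Field k] [CharZero k] {σ : Type}
    {f : MvPolynomial (Option σ) k} (h : pderiv none f = 0) : ∃ g, rename some g = f := by
  refine exists_rename_eq_of_vars_subset_range f some (Option.some_injective σ) ?_
  rintro (_ | u) hv
  · obtain ⟨d, hd, hd'⟩ := (mem_vars_iff_mem_support none).1 hv
    have h1 : d = (d - Finsupp.single none 1) + Finsupp.single none 1 := by
      rw [tsub_add_cancel_of_le]
      rw [Finsupp.single_le_iff]
      exact Nat.one_le_iff_ne_zero.2 (Finsupp.mem_support_iff.1 hd')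
    have h2 := congrArg (coeff (d - Finsupp.single none 1)) h
    rw [coeff_pderiv, ← h1, coeff_zero] at h2
    refine absurd ((mul_eq_zero.1 h2).resolve_right ?_) (mem_support_iff.1 hd)
    exact Nat.cast_add_one_ne_zero _
  · exact ⟨u, rfl⟩

theorem aeval_mul_of_isHomogeneous {k A : Type} [Field k] [CommRing A] [Algebra k A] {σ : Type}
    {f : MvPolynomial σ k} {m : ℕ} (hf : f.IsHomogeneous m) (c : A) (b : σ → A) :
    aeval (fun i => c * b i) f = c ^ m * aeval b f := by
  rw [aeval_def, aeval_def, eval₂_eq, eval₂_eq, Finset.mul_sum]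
  refine Finset.sum_congr rfl fun d hd => ?_
  simp only [mul_pow, Finset.prod_mul_distrib, Finset.prod_pow_eq_pow_sum]
  rw [← hf.degree_eq_of_mem_support hd, Finsupp.degree_apply]
  ring

section Jacobian

variable {k : Type} [Field k] [CharZero k] {σ : Type} [Fintype σ] [DecidableEq σ]
  {C : Set (σ → k)} {N n : ℕ}

theorem eq_zero_of_aeval_linForm_mem {τ : Type} [Fintype τ] (hV : IsProjVariety k σ C)
    (hnd : Nondeg k σ C) (hs : IsSmoothOfCodim k σ C N) {e : σ → k} (he : e ∈ C) (he0 : e ≠ 0)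
    (ψ : Option τ → Module.Dual k (σ → k)) (hψe : ∀ o, ψ o e = 0) (hψ0 : ψ none ≠ 0)
    (hψT : ∀ v ∈ tangentSpace (vanIdeal k σ C) e, ψ none v = 0)
    (hψs : ∀ a : τ → k, ∃ v ∈ tangentSpace (vanIdeal k σ C) e, ∀ u, ψ (some u) v = a u)
    {m : ℕ} {φ : MvPolynomial (Option τ) k} (hφ : φ.IsHomogeneous m)
    (h : aeval (fun o => linForm (ψ o)) φ ∈ vanIdeal k σ C) : φ = 0 := by
  induction m generalizing φ with
  | zero =>
    rw [totalDegree_eq_zero_iff_eq_C.1 (Nat.le_zero.1 hφ.totalDegree_le)] at h ⊢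
    have h1 := mem_vanIdeal.1 h e he
    rw [aeval_C] at h1
    rw [show coeff 0 φ = 0 by simpa using h1, map_zero]
  | succ m ih =>
    obtain ⟨g, r, hg, hr, rfl⟩ := exists_eq_X_none_mul_add_rename_some hφ
    have hr0 : r = 0 := by
      refine MvPolynomial.funext fun a => ?_
      rw [map_zero]
      obtain ⟨v, hv, hva⟩ := hψs a
      obtain ⟨γ, hγ, hγe⟩ := exists_arc_of_isSmoothOfCodim hV hs he he0 hv
      have hX : ∀ o, ∃ b : PowerSeries k, γ (linForm (ψ o)) = PowerSeries.X * b := by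
        intro o
        rw [← dvd_def, PowerSeries.X_dvd_iff, ← PowerSeries.coeff_zero_eq_constantCoeff_apply,
          coeff_algHom_linForm]
        simp only [(hγe _).1]
        exact hψe o
      choose b hb using hX
      have hb1 : ∀ o, PowerSeries.constantCoeff (b o) = ψ o v := by
        intro o
        have h1 := coeff_algHom_linForm γ 1 (ψ o)
        rw [hb, ← zero_add 1, PowerSeries.coeff_succ_X_mul,
          PowerSeries.coeff_zero_eq_constantCoeff_apply] at h1
        rw [h1]
        congr 1
        funext i
        exact (hγe i).2
      have h1 := hγ _ h
      have h2 : γ (aeval (fun o => linForm (ψ o)) (X none * g + rename some r)) =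
          aeval (fun o => PowerSeries.X * b o) (X none * g + rename some r) := by
        rw [← AlgHom.comp_apply]
        congr 1
        refine MvPolynomial.algHom_ext fun o => ?_
        simp [hb]
      rw [h2, aeval_mul_of_isHomogeneous hφ] at h1
      have h4 := (mul_eq_zero.1 h1).resolve_left (pow_ne_zero _ PowerSeries.X_ne_zero)
      have h5 := congrArg PowerSeries.constantCoeff h4
      rw [map_add, map_mul, aeval_X, map_add, map_mul, hb1, hψT v hv, zero_mul, zero_add,
        aeval_rename, map_zero] at h5
      rw [← h5, map_aeval]
      refine eval₂Hom_congr (RingHom.ext fun c => ?_) ?_ rfl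
      · simp
      · funext u
        exact ((hb1 (some u)).trans (hva u)).symm
    subst hr0
    rw [map_zero, add_zero] at h ⊢
    rw [map_mul, aeval_X] at h
    rw [ih hg ((hV.prime.mem_or_mem h).resolve_left fun h0 => hψ0 ?_), mul_zero]
    refine linForm_injective ?_
    rw [map_zero]
    exact hnd _ (isHomogeneous_linForm _) fun x hx => mem_vanIdeal.1 h0 x hx

theorem exists_notMem_forall_tangentSpace_inf_eq_bot (hV : IsProjVariety k σ C)
    (hnd : Nondeg k σ C) (hs : IsSmoothOfCodim k σ C N)
    (hgr : HilbGrowthLE (vanIdeal k σ C) n (N + 1)) {e : σ → k} (he : e ∈ C) (he0 : e ≠ 0)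
    (ψ : Option (Fin n) → Module.Dual k (σ → k)) (hψe : ∀ o, ψ o e = 0) (hψ0 : ψ none ≠ 0)
    (hψT : ∀ v ∈ tangentSpace (vanIdeal k σ C) e, ψ none v = 0)
    (hψs : ∀ a : Fin n → k, ∃ v ∈ tangentSpace (vanIdeal k σ C) e, ∀ u, ψ (some u) v = a u) :
    ∃ G ∉ vanIdeal k σ C, ∀ x ∈ C, eval x G ≠ 0 →
      ∀ v ∈ tangentSpace (vanIdeal k σ C) x, (∀ o, ψ o v = 0) → v = 0 := by
  classical
  have hrel : ∀ i : σ, ∃ G ∉ vanIdeal k σ C, ∀ x ∈ C, eval x G ≠ 0 →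
      ∀ v ∈ tangentSpace (vanIdeal k σ C) x, (∀ o, ψ o v = 0) → v i = 0 := by
    intro i
    let l : Option (Option (Fin n)) → MvPolynomial σ k :=
      fun o => o.elim (X i) fun o => linForm (ψ o)
    have hex : ∃ m, ∃ f : MvPolynomial (Option (Option (Fin n))) k, f ≠ 0 ∧ f.IsHomogeneous m ∧
        aeval l f ∈ vanIdeal k σ C := by
      obtain ⟨f, hf0, ⟨m, hm⟩, hf⟩ := hgr.exists_relation (by simp) l (by
        rintro (_ | o)
        · exact isHomogeneous_X _ _
        · exact isHomogeneous_linForm _)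
      exact ⟨m, f, hf0, hm, hf⟩
    obtain ⟨f, hf0, hfm, hf⟩ := Nat.find_spec hex
    have hmin := fun {m} => Nat.find_min hex (m := m)
    generalize Nat.find hex = m at *
    have hd : (pderiv none f) ≠ 0 := by
      intro h0
      obtain ⟨g, rfl⟩ := exists_rename_some_eq_of_pderiv_eq_zero h0
      apply hf0
      rw [eq_zero_of_aeval_linForm_mem hV hnd hs he he0 ψ hψe hψ0 hψT hψs
        ((IsHomogeneous.rename_isHomogeneous_iff (Option.some_injective _)).1 hfm)
        (by rwa [aeval_rename] at hf), map_zero]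
    refine ⟨aeval l (pderiv none f), fun hmem => ?_, fun x hx hGx v hv hψv => ?_⟩
    · have h1 : (pderiv none f).IsHomogeneous (m - 1) := hfm.pderiv
      rcases Nat.eq_zero_or_pos m with rfl | hm
      · rw [totalDegree_eq_zero_iff_eq_C.1 (Nat.le_zero.1 hfm.totalDegree_le)] at hd
        simp at hd
      · exact hmin (by omega) ⟨_, hd, h1, hmem⟩
    · have h1 := hv _ hf
      rw [sum_eval_pderiv_aeval, Fintype.sum_option] at h1
      have h2 : ∀ o, ∑ j, eval x (pderiv j (l (some o))) * v j = 0 := fun o => by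
        rw [← hψv o, ← eval_linForm]
        exact sum_eval_pderiv_mul_of_isHomogeneous_one x v (isHomogeneous_linForm _)
      have h3 : ∑ j, eval x (pderiv j (l none)) * v j = v i := by
        exact (sum_eval_pderiv_mul_of_isHomogeneous_one x v (isHomogeneous_X k i)).trans (eval_X _)
      simp only [h2, mul_zero, Finset.sum_const_zero, add_zero, h3] at h1
      rw [eval_aeval_eq_eval] at hGx
      exact (mul_eq_zero.1 h1).resolve_left hGx
  choose G hG hGv using hrel
  refine ⟨∏ i, G i, fun h => ?_, fun x hx hGx v hv hψv => ?_⟩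
  · obtain ⟨i, _, hi⟩ := (hV.prime.prod_mem_iff).1 h
    exact hG i hi
  · rw [map_prod, Finset.prod_ne_zero_iff] at hGx
    exact funext fun i => hGv i x hx (hGx i (Finset.mem_univ i)) v hv hψv

end Jacobian

section LinearAlgebra

variable {k V : Type} [Field k] [AddCommGroup V] [Module k V]

theorem exists_dual_option_of_inf_le_span [FiniteDimensional k V] {E T : Submodule k V} {n : ℕ}
    {e : V} (heE : e ∈ E) (heT : e ∈ T) (he0 : e ≠ 0) (hT : Module.finrank k T = n + 1)
    (hinf : T ⊓ E ≤ Submodule.span k {e}) (hsup : T ⊔ E < ⊤) :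
    ∃ ψ : Option (Fin n) → Module.Dual k V, (∀ o, ∀ v ∈ E, ψ o v = 0) ∧ ψ none ≠ 0 ∧
      (∀ v ∈ T, ψ none v = 0) ∧ ∀ a : Fin n → k, ∃ v ∈ T, ∀ u, ψ (some u) v = a u := by
  obtain ⟨φ, hφ0, hφ⟩ := Submodule.exists_le_ker_of_lt_top _ hsup
  have h1 : Module.finrank k (T.map E.mkQ) = n := by
    have h2 := (E.mkQ.domRestrict T).finrank_range_add_finrank_ker
    have h3 : LinearMap.ker (E.mkQ.domRestrict T) = Submodule.span k {(⟨e, heT⟩ : T)} := by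
      ext v
      rw [LinearMap.mem_ker, LinearMap.domRestrict_apply, Submodule.mkQ_apply,
        Submodule.Quotient.mk_eq_zero, Submodule.mem_span_singleton]
      constructor
      · intro hv
        obtain ⟨c, hc⟩ := Submodule.mem_span_singleton.1 (hinf ⟨v.2, hv⟩)
        exact ⟨c, Subtype.ext hc⟩
      · rintro ⟨c, rfl⟩
        exact E.smul_mem c heE
    rw [LinearMap.range_domRestrict, h3, finrank_span_singleton, hT] at h2
    · omega
    · simpa using he0
  let b := (Module.finBasisOfFinrankEq k (T.map E.mkQ) h1).equivFun
  obtain ⟨g, hg⟩ := LinearMap.exists_extend (b : T.map E.mkQ →ₗ[k] (Fin n → k))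
  refine ⟨fun o => o.elim φ fun u => LinearMap.proj u ∘ₗ g ∘ₗ E.mkQ, ?_, hφ0, ?_, ?_⟩
  · rintro (_ | u) v hv
    · exact hφ (Submodule.mem_sup_right hv)
    · have : E.mkQ v = 0 := by simpa using hv
      simp only [Option.elim_some, LinearMap.comp_apply, this, map_zero]
  · exact fun v hv => hφ (Submodule.mem_sup_left hv)
  · intro a
    obtain ⟨v, hv, hva⟩ := (b.symm a).2
    refine ⟨v, hv, fun u => ?_⟩
    have h2 := LinearMap.congr_fun hg (b.symm a)
    rw [LinearMap.comp_apply, Submodule.subtype_apply, ← hva] at h2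
    simp only [Option.elim_some, LinearMap.comp_apply, h2]
    simp

theorem exists_basis_sum_inl_eq [FiniteDimensional k V] {ι τ : Type} [Fintype ι] [Fintype τ]
    {e : ι → V} (he : LinearIndependent k e)
    (hcard : Fintype.card ι + Fintype.card τ = Module.finrank k V) :
    ∃ b : Module.Basis (ι ⊕ τ) k V, ∀ i, b (Sum.inl i) = e i := by
  obtain ⟨F, hF⟩ := Submodule.exists_isCompl (Submodule.span k (Set.range e))
  have h1 := Submodule.finrank_add_eq_of_isCompl hF
  rw [finrank_span_eq_card he, ← hcard] at h1
  let bF := (Module.finBasisOfFinrankEq k F (Nat.add_left_cancel h1)).reindex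
    (Fintype.equivFin τ).symm
  have h2 : LinearIndependent k (Sum.elim e fun u => (bF u : V)) := by
    refine he.sum_type (bF.linearIndependent.map' F.subtype (Submodule.ker_subtype F)) ?_
    refine hF.disjoint.mono_right (Submodule.span_le.2 ?_)
    rintro _ ⟨u, rfl⟩
    exact (bF u).2
  rcases isEmpty_or_nonempty (ι ⊕ τ) with hempty | hne
  · have : Subsingleton V := Module.finrank_zero_iff.1 (by
      rw [← hcard, ← Fintype.card_sum, Fintype.card_eq_zero])
    exact ⟨Module.Basis.empty V, fun i => (hempty.false (Sum.inl i)).elim⟩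
  · refine ⟨basisOfLinearIndependentOfCardEqFinrank h2 (by rw [Fintype.card_sum, hcard]),
      fun i => ?_⟩
    rw [coe_basisOfLinearIndependentOfCardEqFinrank]
    rfl

end LinearAlgebra

section GeneralPoints

variable {k : Type} [Field k] {σ : Type} [Fintype σ] [DecidableEq σ] {C : Set (σ → k)} {N n : ℕ}

theorem exists_notMem_vanIdeal_forall_notMem (hnd : Nondeg k σ C) {W : Submodule k (σ → k)}
    (hW : W < ⊤) : ∃ G ∉ vanIdeal k σ C, ∀ x, eval x G ≠ 0 → x ∉ W := by
  obtain ⟨φ, hφ0, hφ⟩ := Submodule.exists_le_ker_of_lt_top _ hW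
  refine ⟨linForm φ, fun h => hφ0 (linForm_injective ?_), fun x hx hxW => hx ?_⟩
  · rw [map_zero]
    exact hnd _ (isHomogeneous_linForm φ) (mem_vanIdeal.1 h)
  · rw [eval_linForm]
    exact hφ hxW

variable [CharZero k]

theorem exists_mem_general (hV : IsProjVariety k σ C)
    (hnd : Nondeg k σ C) (hs : IsSmoothOfCodim k σ C N)
    (hgr : HilbGrowthLE (vanIdeal k σ C) n (N + 1)) (hcard : Fintype.card σ = n + N + 1)
    {m : ℕ} (hm : m ≤ N) (e : Fin m → σ → k) (he : ∀ i, e i ∈ C) (hli : LinearIndependent k e)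
    (hT : ∀ i, tangentSpace (vanIdeal k σ C) (e i) ⊓ Submodule.span k (Set.range e) ≤
      Submodule.span k {e i}) :
    ∃ x ∈ C, x ∉ Submodule.span k (Set.range e) ∧
      (∀ i, x ∉ tangentSpace (vanIdeal k σ C) (e i) ⊔ Submodule.span k (Set.range e)) ∧
      tangentSpace (vanIdeal k σ C) x ⊓ Submodule.span k (Set.range e) = ⊥ := by
  set E := Submodule.span k (Set.range e) with hE
  have hEm : Module.finrank k E = m := by rw [hE, finrank_span_eq_card hli, Fintype.card_fin]
  have hTn : ∀ i, Module.finrank k (tangentSpace (vanIdeal k σ C) (e i)) = n + 1 := by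
    intro i
    have := finrank_tangentSpace_add hs (he i) (hli.ne_zero i)
    omega
  have hself : ∀ i, e i ∈ tangentSpace (vanIdeal k σ C) (e i) := fun i =>
    self_mem_tangentSpace hV.smul_mem (he i)
  have hmemE : ∀ i, e i ∈ E := fun i => Submodule.subset_span ⟨i, rfl⟩
  have hlt : ∀ W : Submodule k (σ → k), Module.finrank k W < n + N + 1 → W < ⊤ := by
    intro W hW
    refine lt_top_iff_ne_top.2 fun h => ?_
    rw [h, finrank_top, Module.finrank_fintype_fun_eq_card] at hW
    omega
  have hsup : ∀ i, tangentSpace (vanIdeal k σ C) (e i) ⊔ E < ⊤ := by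
    intro i
    refine hlt _ ?_
    have h1 := Submodule.finrank_sup_add_finrank_inf_eq (tangentSpace (vanIdeal k σ C) (e i)) E
    have h2 : tangentSpace (vanIdeal k σ C) (e i) ⊓ E = Submodule.span k {e i} :=
      le_antisymm (hT i) ((Submodule.span_singleton_le_iff_mem _ _).2 ⟨hself i, hmemE i⟩)
    rw [h2, finrank_span_singleton (hli.ne_zero i), hTn, hEm] at h1
    omega
  obtain ⟨G₁, hG₁, hG₁x⟩ := exists_notMem_vanIdeal_forall_notMem hnd (hlt E (by omega))
  choose G₂ hG₂ hG₂x using fun i => exists_notMem_vanIdeal_forall_notMem hnd (hsup i)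
  obtain ⟨G₃, hG₃, hG₃x⟩ : ∃ G ∉ vanIdeal k σ C, ∀ x ∈ C, eval x G ≠ 0 →
      tangentSpace (vanIdeal k σ C) x ⊓ E = ⊥ := by
    rcases Nat.eq_zero_or_pos m with rfl | hm0
    · refine ⟨1, (Ideal.ne_top_iff_one _).1 hV.prime.ne_top, fun x _ _ => ?_⟩
      rw [Submodule.finrank_eq_zero.1 hEm, inf_bot_eq]
    · let i : Fin m := ⟨0, hm0⟩
      obtain ⟨ψ, hψE, hψ0, hψT, hψs⟩ := exists_dual_option_of_inf_le_span (hmemE i) (hself i)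
        (hli.ne_zero i) (hTn i) (hT i) (hsup i)
      obtain ⟨G, hG, hGx⟩ := exists_notMem_forall_tangentSpace_inf_eq_bot hV hnd hs hgr (he i)
        (hli.ne_zero i) ψ (fun o => hψE o _ (hmemE i)) hψ0 hψT hψs
      refine ⟨G, hG, fun x hx hxG => (Submodule.eq_bot_iff _).2 fun v hv => ?_⟩
      exact hGx x hx hxG v hv.1 fun o => hψE o v hv.2
  have hprod : G₁ * (∏ i, G₂ i) * G₃ ∉ vanIdeal k σ C := by
    intro h
    rcases hV.prime.mem_or_mem h with h | h
    · rcases hV.prime.mem_or_mem h with h | h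
      · exact hG₁ h
      · obtain ⟨i, _, hi⟩ := hV.prime.prod_mem_iff.1 h
        exact hG₂ i hi
    · exact hG₃ h
  rw [mem_vanIdeal] at hprod
  push Not at hprod
  obtain ⟨x, hx, hxG⟩ := hprod
  rw [map_mul, map_mul, map_prod, mul_ne_zero_iff, mul_ne_zero_iff,
    Finset.prod_ne_zero_iff] at hxG
  exact ⟨x, hx, hG₁x x hxG.1.1, fun i => hG₂x i x (hxG.1.2 i (Finset.mem_univ i)),
    hG₃x x hx hxG.2⟩

theorem exists_linearIndependent_general (hV : IsProjVariety k σ C)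
    (hnd : Nondeg k σ C) (hs : IsSmoothOfCodim k σ C N)
    (hgr : HilbGrowthLE (vanIdeal k σ C) n (N + 1)) (hcard : Fintype.card σ = n + N + 1)
    {m : ℕ} (hm : m ≤ N + 1) : ∃ e : Fin m → σ → k, (∀ i, e i ∈ C) ∧ LinearIndependent k e ∧
      ∀ i, tangentSpace (vanIdeal k σ C) (e i) ⊓ Submodule.span k (Set.range e) ≤
        Submodule.span k {e i} := by
  induction m with
  | zero => exact ⟨Fin.elim0, fun i => i.elim0, linearIndependent_empty_type, fun i => i.elim0⟩
  | succ m ih =>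
    obtain ⟨e, he, hli, hT⟩ := ih (by omega)
    obtain ⟨x, hx, hxE, hxT, hTx⟩ :=
      exists_mem_general hV hnd hs hgr hcard (by omega) e he hli hT
    refine ⟨Fin.cons x e, Fin.cases hx he, linearIndependent_finCons.2 ⟨hli, hxE⟩, ?_⟩
    rw [Fin.range_cons]
    refine Fin.cases ?_ fun i => ?_
    · rintro v ⟨hv, hv'⟩
      obtain ⟨a, w, hw, rfl⟩ := Submodule.mem_span_insert.1 hv'
      rw [Fin.cons_zero] at hv ⊢
      have h1 : w ∈ tangentSpace (vanIdeal k σ C) x ⊓ Submodule.span k (Set.range e) := by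
        refine ⟨?_, hw⟩
        have := sub_mem hv (Submodule.smul_mem _ a (self_mem_tangentSpace hV.smul_mem hx))
        rwa [add_sub_cancel_left] at this
      rw [hTx, Submodule.mem_bot] at h1
      rw [h1, add_zero]
      exact Submodule.smul_mem _ a (Submodule.mem_span_singleton_self x)
    · rintro v ⟨hv, hv'⟩
      obtain ⟨a, w, hw, rfl⟩ := Submodule.mem_span_insert.1 hv'
      rw [Fin.cons_succ] at hv ⊢
      have ha : a = 0 := by
        by_contra ha
        refine hxT i ?_
        have h1 := Submodule.smul_mem _ a⁻¹
          (sub_mem (Submodule.mem_sup_left hv) (Submodule.mem_sup_right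
            (S := tangentSpace (vanIdeal k σ C) (e i)) hw))
        rwa [add_sub_cancel_right, inv_smul_smul₀ ha] at h1
      rw [ha, zero_smul, zero_add] at hv ⊢
      exact hT i ⟨hv, hw⟩

end GeneralPoints

section LinSubst

variable {k : Type} [Field k] {σ τ : Type} [Fintype σ] [DecidableEq σ]

/-- Linear substitution: the ring map given by composition with a linear map. -/
def linSubst (L : (σ → k) →ₗ[k] (τ → k)) : MvPolynomial τ k →ₐ[k] MvPolynomial σ k :=
  aeval fun r => linForm (LinearMap.proj r ∘ₗ L)

theorem linSubst_X (L : (σ → k) →ₗ[k] (τ → k)) (r : τ) :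
    linSubst L (X r) = linForm (LinearMap.proj r ∘ₗ L) := aeval_X _ _

theorem eval_linSubst (L : (σ → k) →ₗ[k] (τ → k)) (f : MvPolynomial τ k) (x : σ → k) :
    eval x (linSubst L f) = eval (L x) f := by
  rw [linSubst, eval_aeval_eq_eval]
  simp only [eval_linForm]
  rfl

theorem MvPolynomial.IsHomogeneous.linSubst {f : MvPolynomial τ k} {m : ℕ}
    (hf : f.IsHomogeneous m) (L : (σ → k) →ₗ[k] (τ → k)) : (linSubst L f).IsHomogeneous m := by
  have := hf.aeval (fun r => linForm (LinearMap.proj r ∘ₗ L)) (n := 1)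
    fun r => isHomogeneous_linForm _
  rwa [one_mul] at this

theorem linSubst_injective [Infinite k] {L : (σ → k) →ₗ[k] (τ → k)}
    (hL : Function.Surjective L) : Function.Injective (linSubst L) := by
  intro f g h
  refine MvPolynomial.funext fun y => ?_
  obtain ⟨x, rfl⟩ := hL y
  rw [← eval_linSubst, h, eval_linSubst]

theorem sum_eval_pderiv_linSubst [Fintype τ] (L : (σ → k) →ₗ[k] (τ → k)) (f : MvPolynomial τ k)
    (x v : σ → k) :
    ∑ i, eval x (pderiv i (linSubst L f)) * v i = ∑ r, eval (L x) (pderiv r f) * L v r := by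
  rw [linSubst, sum_eval_pderiv_aeval]
  refine Finset.sum_congr rfl fun r _ => ?_
  rw [sum_eval_pderiv_mul_of_isHomogeneous_one _ _ (isHomogeneous_linForm _), eval_linForm]
  simp only [eval_linForm]
  rfl

theorem mem_vanIdeal_image [Fintype τ] [DecidableEq τ] {L : (σ → k) →ₗ[k] (τ → k)}
    {C : Set (σ → k)} {f : MvPolynomial τ k} :
    f ∈ vanIdeal k τ (L '' C) ↔ linSubst L f ∈ vanIdeal k σ C := by
  simp only [mem_vanIdeal, Set.forall_mem_image, eval_linSubst]

theorem vanIdeal_image [Fintype τ] [DecidableEq τ] (L : (σ → k) →ₗ[k] (τ → k))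
    (C : Set (σ → k)) :
    vanIdeal k τ (L '' C) = (vanIdeal k σ C).comap (linSubst L) :=
  Ideal.ext fun _ => mem_vanIdeal_image

theorem hilbGrowthLE_image [Infinite k] [Fintype τ] [DecidableEq τ] (L : (σ → k) ≃ₗ[k] (τ → k))
    {C : Set (σ → k)} {n d : ℕ} (h : HilbGrowthLE (vanIdeal k σ C) n d) :
    HilbGrowthLE (vanIdeal k τ (L '' C)) n d := by
  intro K a hK
  refine h K a fun m hm => (hK m hm).trans ?_
  have h1 : Module.finrank k (homogeneousSubmodule τ k m) ≤
      Module.finrank k (homogeneousSubmodule σ k m) :=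
    LinearMap.finrank_le_finrank_of_injective
      (f := (linSubst L.toLinearMap).toLinearMap.restrict fun f hf =>
        MvPolynomial.IsHomogeneous.linSubst hf L.toLinearMap)
      fun f g hfg => Subtype.ext (linSubst_injective L.surjective (congrArg Subtype.val hfg))
  have h2 : Module.finrank k (idealPiece k σ (vanIdeal k σ C) m) ≤
      Module.finrank k (idealPiece k τ (vanIdeal k τ (L '' C)) m) := by
    have : Module.Finite k (idealPiece k τ (vanIdeal k τ (L '' C)) m) :=
      Submodule.finiteDimensional_of_le inf_le_right
    refine LinearMap.finrank_le_finrank_of_injective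
      (f := (linSubst L.symm.toLinearMap).toLinearMap.restrict fun f hf => ⟨?_, ?_⟩)
      fun f g hfg => Subtype.ext (linSubst_injective L.symm.surjective (congrArg Subtype.val hfg))
    · refine mem_vanIdeal.2 ?_
      rintro _ ⟨x, hx, rfl⟩
      refine (eval_linSubst _ _ _).trans ?_
      rw [LinearEquiv.coe_coe, L.symm_apply_apply]
      exact mem_vanIdeal.1 hf.1 x hx
    · exact MvPolynomial.IsHomogeneous.linSubst hf.2 L.symm.toLinearMap
  rw [idealHilb, idealHilb]
  exact tsub_le_tsub h1 h2

end LinSubst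

theorem exists_mem_tangentSpace_forall_coord_inr_eq {k : Type} [Field k] {σ : Type}
    [Fintype σ] {ι τ : Type} [Fintype ι] [Fintype τ] {T : Submodule k (σ → k)}
    (b : Module.Basis (ι ⊕ τ) k (σ → k)) {i : ι}
    (hT : Module.finrank k T = Fintype.card τ + 1)
    (hinf : T ⊓ Submodule.span k (Set.range fun i => b (Sum.inl i)) ≤
      Submodule.span k {b (Sum.inl i)}) (a : τ → k) :
    ∃ v ∈ T, ∀ u, b.equivFun v (Sum.inr u) = a u := by
  let F : T →ₗ[k] (τ → k) := LinearMap.pi fun u => (b.coord (Sum.inr u)) ∘ₗ T.subtype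
  have h1 : (LinearMap.ker F).map T.subtype ≤ Submodule.span k {b (Sum.inl i)} := by
    rintro _ ⟨v, hv, rfl⟩
    refine hinf ⟨v.2, ?_⟩
    have hv' : ∀ u, b.repr v (Sum.inr u) = 0 := fun u => congrFun (LinearMap.mem_ker.1 hv) u
    rw [Submodule.subtype_apply, ← b.sum_repr v, Fintype.sum_sum_type]
    simp only [hv', zero_smul, Finset.sum_const_zero, add_zero]
    exact Submodule.sum_mem _ fun j _ => Submodule.smul_mem _ _ (Submodule.subset_span ⟨j, rfl⟩)
  have h2 : Module.finrank k (LinearMap.ker F) ≤ 1 := by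
    have h3 := Submodule.finrank_mono h1
    rw [finrank_span_singleton (b.ne_zero _)] at h3
    rwa [← LinearEquiv.finrank_eq (Submodule.equivMapOfInjective T.subtype T.injective_subtype _)]
      at h3
  have h3 := F.finrank_range_add_finrank_ker
  have h4 : LinearMap.range F = ⊤ := by
    refine Submodule.eq_top_of_finrank_eq (le_antisymm (Submodule.finrank_le _) ?_)
    rw [Module.finrank_fintype_fun_eq_card]
    omega
  obtain ⟨v, hv⟩ := LinearMap.range_eq_top.1 h4 a
  exact ⟨v, v.2, fun u => congrFun hv u⟩

section Adapted

variable {k : Type} [Field k] [CharZero k] {σ : Type} [Fintype σ] [DecidableEq σ]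
  {C : Set (σ → k)} {N n : ℕ}

theorem isAdapted_vanIdeal_image (hV : IsProjVariety k σ C)
    (hnd : Nondeg k σ C) (hs : IsSmoothOfCodim k σ C N)
    (hgr : HilbGrowthLE (vanIdeal k σ C) n (N + 1)) (hcard : Fintype.card σ = n + N + 1)
    (b : Module.Basis (Fin (N + 1) ⊕ Fin n) k (σ → k)) (hb : ∀ i, b (Sum.inl i) ∈ C)
    (hT : ∀ i, tangentSpace (vanIdeal k σ C) (b (Sum.inl i)) ⊓
      Submodule.span k (Set.range fun i => b (Sum.inl i)) ≤ Submodule.span k {b (Sum.inl i)}) :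
    IsAdapted (vanIdeal k _ (b.equivFun.toLinearMap '' C)) where
  prime := by
    rw [vanIdeal_image]
    have := hV.prime
    exact Ideal.comap_isPrime _ _
  homogeneousComponent_mem f hf m := by
    rw [mem_vanIdeal_image] at hf ⊢
    refine mem_vanIdeal_image.1 (homogeneousComponent_mem_vanIdeal ?_ (mem_vanIdeal_image.2 hf) m)
    rintro _ ⟨x, hx, rfl⟩ t
    exact ⟨t • x, hV.smul_mem x hx t, map_smul _ _ _⟩
  eq_zero_of_isHomogeneous_one f hf hf1 := by
    refine linSubst_injective (L := b.equivFun.toLinearMap) b.equivFun.surjective ?_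
    rw [map_zero]
    exact hnd _ (hf1.linSubst _) (mem_vanIdeal.1 (mem_vanIdeal_image.1 hf))
  exists_arc i a := by
    have hfin : Module.finrank k (tangentSpace (vanIdeal k σ C) (b (Sum.inl i))) =
        Fintype.card (Fin n) + 1 := by
      have := finrank_tangentSpace_add hs (hb i) (b.ne_zero _)
      rw [Fintype.card_fin]
      omega
    obtain ⟨v, hv, hva⟩ := exists_mem_tangentSpace_forall_coord_inr_eq b hfin (hT i) a
    obtain ⟨γ, hγ, hγe⟩ := exists_arc_of_isSmoothOfCodim hV hs (hb i) (b.ne_zero _) hv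
    have h0 : ∀ s, PowerSeries.coeff 0 (γ (linSubst b.equivFun.toLinearMap (X s))) =
        b.equivFun (b (Sum.inl i)) s := by
      intro s
      rw [linSubst_X, coeff_algHom_linForm]
      simp only [(hγe _).1]
      rfl
    refine ⟨γ.comp (linSubst b.equivFun.toLinearMap),
      fun f hf => hγ _ (mem_vanIdeal_image.1 hf), ?_, fun j hj => ?_, fun u => ⟨?_, ?_⟩⟩
    · rw [AlgHom.comp_apply, h0]
      simp
    · rw [AlgHom.comp_apply, h0]
      simp [hj.symm]
    · rw [AlgHom.comp_apply, h0]
      simp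
    · rw [AlgHom.comp_apply, linSubst_X, coeff_algHom_linForm]
      simp only [(hγe _).2]
      exact hva u
  hilbGrowthLE := by
    rw [Fintype.card_fin, Fintype.card_fin]
    exact hilbGrowthLE_image b.equivFun hgr

theorem exists_dual_forms_of_not_isConeVariety (hV : IsProjVariety k σ C)
    (hnd : Nondeg k σ C) (hs : IsSmoothOfCodim k σ C N)
    (hgr : HilbGrowthLE (vanIdeal k σ C) n (N + 1)) (hcard : Fintype.card σ = n + N + 1)
    (hN : 4 ≤ N) (hcone : ¬ IsConeVariety k σ C) {p : σ → k} (hp : p ∉ C) :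
    ∃ φ : Fin 4 → Module.Dual k (σ → k), ∀ v, (∀ a, φ a v = 0) →
      (∀ q ∈ vanIdeal k σ C, q.IsHomogeneous 2 → eval p q = 0 →
        ∑ i, eval p (pderiv i q) * v i = 0) → v = 0 := by
  have hclosed : ∀ x, (∀ f ∈ vanIdeal k σ C, eval x f = 0) → x ∈ C := by
    intro x hx
    rw [hV.closed]
    exact hx
  obtain ⟨e, he, hli, hT⟩ := exists_linearIndependent_general hV hnd hs hgr hcard le_rfl
  obtain ⟨b, hb⟩ := exists_basis_sum_inl_eq (τ := Fin n) hli (by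
    rw [Module.finrank_fintype_fun_eq_card, Fintype.card_fin, Fintype.card_fin]; omega)
  obtain rfl : e = fun i => b (Sum.inl i) := funext fun i => (hb i).symm
  have hI := isAdapted_vanIdeal_image hV hnd hs hgr hcard b he hT
  set L := b.equivFun.toLinearMap with hL
  have hback : ∀ f ∈ vanIdeal k σ C,
      linSubst b.equivFun.symm.toLinearMap f ∈ vanIdeal k _ (L '' C) := by
    intro f hf
    refine mem_vanIdeal.2 ?_
    rintro _ ⟨x, hx, rfl⟩
    refine (eval_linSubst _ _ _).trans ?_
    rw [hL, LinearEquiv.coe_coe, LinearEquiv.coe_coe, LinearEquiv.symm_apply_apply]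
    exact mem_vanIdeal.1 hf x hx
  obtain ⟨ℓ, hℓ, hℓv⟩ := hI.exists_linear_forms (p := L p) (by simpa using by omega) (by
      intro v hv
      by_contra hv0
      refine hcone ⟨b.equivFun.symm v, ?_, b.equivFun.symm.map_ne_zero_iff.2 hv0, ?_⟩
      · refine hclosed _ fun f hf => ?_
        have h1 := hv _ (hback f hf) 0 1 fun g hg => ?_
        · rw [zero_add, one_smul] at h1
          rw [← h1]
          exact (eval_linSubst _ _ _).symm
        · exact mem_vanIdeal.1 hg 0 ⟨0, hV.zero_mem, map_zero _⟩
      · intro x hx s t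
        refine hclosed _ fun f hf => ?_
        have h1 := hv _ (hback f hf) (L (s • x)) t fun g hg =>
          mem_vanIdeal.1 hg _ ⟨_, hV.smul_mem x hx s, rfl⟩
        rw [← h1, eval_linSubst]
        simp only [hL, map_add, map_smul, LinearEquiv.coe_coe, LinearEquiv.symm_apply_apply]) (by
      by_contra! h
      refine hp (hclosed p fun f hf => ?_)
      have h1 := h _ (hback f hf)
      rw [eval_linSubst] at h1
      simpa [hL] using h1)
  refine ⟨fun a => (exists_linForm_eq (hℓ a)).choose ∘ₗ L, fun v hv hq => ?_⟩
  have h1 := hℓv (L v) (fun a => ?_) fun q hqI hq2 hqp => ?_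
  · exact b.equivFun.map_eq_zero_iff.1 h1
  · have := hv a
    rw [LinearMap.comp_apply, ← eval_linForm, (exists_linForm_eq (hℓ a)).choose_spec] at this
    exact this
  · rw [← sum_eval_pderiv_linSubst]
    exact hq _ (mem_vanIdeal_image.1 hqI) (hq2.linSubst L) (by rwa [eval_linSubst])

end Adapted

theorem eval_add_smul_of_isHomogeneous_two {k : Type} [Field k] [CharZero k] {σ : Type}
    [Fintype σ] {q : MvPolynomial σ k} (hq : q.IsHomogeneous 2) (p w : σ → k) (t : k) :
    eval (w + t • p) q = eval w q + t * ∑ i, eval p (pderiv i q) * w i + t ^ 2 * eval p q := by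
  have hlin : ∀ {f : MvPolynomial σ k}, f.IsHomogeneous 1 →
      eval (w + t • p) f = eval w f + t * eval p f := by
    intro f hf
    rw [← sum_eval_pderiv_mul_of_isHomogeneous_one p _ hf,
      ← sum_eval_pderiv_mul_of_isHomogeneous_one p w hf,
      ← sum_eval_pderiv_mul_of_isHomogeneous_one p p hf, Finset.mul_sum,
      ← Finset.sum_add_distrib]
    refine Finset.sum_congr rfl fun i _ => ?_
    simp only [Pi.add_apply, Pi.smul_apply, smul_eq_mul]
    ring
  have hprod : ∀ {f g : MvPolynomial σ k}, f.IsHomogeneous 1 → g.IsHomogeneous 1 →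
      eval (w + t • p) (f * g) = eval w (f * g) +
        t * ∑ i, eval p (pderiv i (f * g)) * w i + t ^ 2 * eval p (f * g) := by
    intro f g hf hg
    rw [sum_eval_pderiv_mul_mul, sum_eval_pderiv_mul_of_isHomogeneous_one p w hf,
      sum_eval_pderiv_mul_of_isHomogeneous_one p w hg, map_mul, map_mul, map_mul, hlin hf, hlin hg]
    ring
  have h2 : (2 : k) • q = ∑ j, X j * pderiv j q := by
    rw [hq.sum_X_mul_pderiv, ofNat_smul_eq_nsmul]
  have h3 : (2 : k) * eval (w + t • p) q = 2 * (eval w q +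
      t * ∑ i, eval p (pderiv i q) * w i + t ^ 2 * eval p q) := by
    have h4 := sum_eval_pderiv_mul_smul p w 2 q
    have h5 : ∀ x, 2 * eval x q = ∑ j, eval x (X j * pderiv j q) := by
      intro x
      rw [← map_sum, ← h2, smul_eval]
    have h6 : 2 * ∑ i, eval p (pderiv i q) * w i =
        ∑ j, ∑ i, eval p (pderiv i (X j * pderiv j q)) * w i := by
      rw [← h4, h2, Finset.sum_comm]
      simp only [map_sum, Finset.sum_mul]
    calc (2 : k) * eval (w + t • p) q
        = ∑ j, eval (w + t • p) (X j * pderiv j q) := h5 _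
      _ = ∑ j, (eval w (X j * pderiv j q) + t * ∑ i, eval p (pderiv i (X j * pderiv j q)) * w i +
            t ^ 2 * eval p (X j * pderiv j q)) :=
          Finset.sum_congr rfl fun j _ => hprod (isHomogeneous_X k j) hq.pderiv
      _ = 2 * eval w q + t * (2 * ∑ i, eval p (pderiv i q) * w i) + t ^ 2 * (2 * eval p q) := by
          rw [Finset.sum_add_distrib, Finset.sum_add_distrib, ← Finset.mul_sum, ← Finset.mul_sum,
            ← h5, ← h5, ← h6]
      _ = _ := by ring
  exact mul_left_cancel₀ two_ne_zero h3

theorem ringKrullDim_quotient_le_of_linForm {k : Type} [Field k] [Infinite k] {ρ : Type}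
    [Fintype ρ] [DecidableEq ρ] {J : Ideal (MvPolynomial ρ k)} {Z : Submodule k (ρ → k)}
    (h : ∀ φ : Module.Dual k (ρ → k), (∀ w ∈ Z, φ w = 0) → linForm φ ∈ J) :
    ringKrullDim (MvPolynomial ρ k ⧸ J) ≤ Module.finrank k Z := by
  let e : Z ≃ₗ[k] (Fin (Module.finrank k Z) → k) := (Module.finBasis k Z).equivFun
  obtain ⟨P, hP⟩ := LinearMap.exists_extend (e : Z →ₗ[k] (Fin (Module.finrank k Z) → k))
  let K : (Fin (Module.finrank k Z) → k) →ₗ[k] (ρ → k) := Z.subtype ∘ₗ e.symm.toLinearMap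
  have hPZ : ∀ w, ∀ hw : w ∈ Z, P w = e ⟨w, hw⟩ := fun w hw => LinearMap.congr_fun hP ⟨w, hw⟩
  have hsurj : Function.Surjective
      (((Ideal.Quotient.mkₐ k J).comp (linSubst P) : _ →ₐ[k] _) :
        MvPolynomial (Fin (Module.finrank k Z)) k →+* MvPolynomial ρ k ⧸ J) := by
    intro a
    obtain ⟨f, rfl⟩ := Ideal.Quotient.mk_surjective a
    refine ⟨linSubst K f, ?_⟩
    have : (((Ideal.Quotient.mkₐ k J).comp (linSubst P)).comp (linSubst K)) =
        Ideal.Quotient.mkₐ k J := by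
      refine MvPolynomial.algHom_ext fun r => ?_
      rw [AlgHom.comp_apply, AlgHom.comp_apply, Ideal.Quotient.mkₐ_eq_mk, Ideal.Quotient.eq]
      have h1 : linSubst P (linSubst K (X r)) - X r =
          linForm (LinearMap.proj r ∘ₗ (K ∘ₗ P - LinearMap.id)) := by
        refine MvPolynomial.funext fun x => ?_
        rw [map_sub, eval_linSubst, eval_linSubst, eval_linForm, eval_X, eval_X]
        rfl
      rw [h1]
      refine h _ fun w hw => ?_
      simp [K, hPZ w hw]
    exact DFunLike.congr_fun this f
  refine (ringKrullDim_le_of_surjective _ hsurj).trans (le_of_eq ?_)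
  rw [MvPolynomial.ringKrullDim_of_isNoetherianRing, ringKrullDim_eq_zero_of_field]
  simp

section Projection

variable {k : Type} [Field k] {σ ρ : Type} [Fintype σ] [DecidableEq σ]

/-- The ideal of all `a` such that `y * a` lies in the subring of the coordinate ring modulo `I`
generated by the linear forms pulled back along `L`. -/
def projConductor (I : Ideal (MvPolynomial σ k)) (L : (σ → k) →ₗ[k] (ρ → k))
    (y : MvPolynomial σ k) : Ideal (MvPolynomial ρ k) where
  carrier := {a | ∃ g, y * linSubst L a - linSubst L g ∈ I}
  zero_mem' := ⟨0, by simp⟩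
  add_mem' := by
    rintro a b ⟨g, hg⟩ ⟨h, hh⟩
    refine ⟨g + h, ?_⟩
    convert I.add_mem hg hh using 1
    rw [map_add, map_add]
    ring
  smul_mem' := by
    rintro c a ⟨g, hg⟩
    refine ⟨c * g, ?_⟩
    convert I.mul_mem_left (linSubst L c) hg using 1
    rw [smul_eq_mul, map_mul, map_mul]
    ring

theorem mem_projConductor {I : Ideal (MvPolynomial σ k)} {L : (σ → k) →ₗ[k] (ρ → k)}
    {y : MvPolynomial σ k} {a : MvPolynomial ρ k} :
    a ∈ projConductor I L y ↔ ∃ g, y * linSubst L a - linSubst L g ∈ I := Iff.rfl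

variable [Fintype ρ] {C : Set (σ → k)} {L : (σ → k) →ₗ[k] (ρ → k)} {p : σ → k}
  {η : Module.Dual k (σ → k)}

theorem tangentSpace_zero_eq_top [Infinite k] (hC : ∀ x ∈ C, ∀ t : k, t • x ∈ C)
    (hnd : Nondeg k σ C) : tangentSpace (vanIdeal k σ C) 0 = ⊤ := by
  refine (Submodule.eq_top_iff'.2 fun v f hf => Finset.sum_eq_zero fun i _ => ?_)
  have h1 := hnd _ (homogeneousComponent_isHomogeneous 1 f)
    (mem_vanIdeal.1 (homogeneousComponent_mem_vanIdeal hC hf 1))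
  have h2 := congrArg (coeff (Finsupp.single i 1)) h1
  rw [coeff_homogeneousComponent, if_pos (by simp), coeff_zero] at h2
  have h3 : eval 0 (pderiv i f) = coeff (Finsupp.single i 1) f := by
    rw [eval_zero, constantCoeff_eq, coeff_pderiv]
    simp
  rw [h3, h2, zero_mul]

theorem coeff_zero_eq_zero_of_mem_projConductor [Infinite k] (hC : ∀ x ∈ C, ∀ t : k, t • x ∈ C)
    (hnd : Nondeg k σ C) (hLp : L p = 0) (hη : η p = 1) {a : MvPolynomial ρ k}
    (ha : a ∈ projConductor (vanIdeal k σ C) L (linForm η)) : coeff 0 a = 0 := by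
  obtain ⟨g, hg⟩ := ha
  have h1 : p ∈ tangentSpace (vanIdeal k σ C) 0 := by
    rw [tangentSpace_zero_eq_top hC hnd]
    trivial
  have h2 := h1 _ hg
  rw [sum_eval_pderiv_mul_sub, sum_eval_pderiv_linSubst, sum_eval_pderiv_mul_mul, hLp,
    sum_eval_pderiv_mul_of_isHomogeneous_one _ _ (isHomogeneous_linForm η), eval_linForm,
    eval_linForm, hη, eval_linSubst, map_zero, map_zero, eval_zero] at h2
  rw [← constantCoeff_eq]
  simpa using h2

variable [DecidableEq ρ]

theorem linForm_mem_projConductor [CharZero k] (hsurj : Function.Surjective L) (hLp : L p = 0)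
    (hker : LinearMap.ker L = Submodule.span k {p}) (hη : η p = 1) {q : MvPolynomial σ k}
    (hqC : q ∈ vanIdeal k σ C) (hq : q.IsHomogeneous 2) (hqp : eval p q = 0)
    {φ : Module.Dual k (ρ → k)} (hφ : ∀ v, φ (L v) = ∑ i, eval p (pderiv i q) * v i) :
    linForm φ ∈ projConductor (vanIdeal k σ C) L (linForm η) := by
  obtain ⟨s, hs⟩ := LinearMap.exists_rightInverse_of_surjective L (LinearMap.range_eq_top.2 hsurj)
  have hs' : ∀ w, L (s w) = w := LinearMap.congr_fun hs
  let s' : (ρ → k) →ₗ[k] (σ → k) := s - (η ∘ₗ s).smulRight p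
  have hs1 : ∀ x, x = s' (L x) + η x • p := by
    intro x
    have h1 : x - s (L x) ∈ LinearMap.ker L := by
      rw [LinearMap.mem_ker, map_sub, hs', sub_self]
    rw [hker] at h1
    obtain ⟨c, hc⟩ := Submodule.mem_span_singleton.1 h1
    have h2 := congrArg η hc
    rw [map_smul, hη, map_sub, smul_eq_mul, mul_one] at h2
    have h3 : s' (L x) = s (L x) - η (s (L x)) • p := rfl
    rw [h3]
    rw [h2] at hc
    linear_combination (norm := module) -hc
  refine ⟨-linSubst s' q, ?_⟩
  have h1 : linForm η * linSubst L (linForm φ) - linSubst L (-linSubst s' q) = q := by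
    refine MvPolynomial.funext fun x => ?_
    rw [map_sub, map_mul, map_neg, map_neg, eval_linSubst, eval_linSubst, eval_linSubst,
      eval_linForm, eval_linForm]
    conv_rhs => rw [hs1 x, eval_add_smul_of_isHomogeneous_two hq, hqp, ← hφ]
    have h2 := congrArg L (hs1 x)
    rw [map_add, map_smul, hLp, smul_zero, add_zero] at h2
    rw [← h2]
    ring
  rwa [h1]

theorem exists_submodule_forall_linForm_mem_projConductor [CharZero k]
    (hsurj : Function.Surjective L) (hker : LinearMap.ker L = Submodule.span k {p}) (hp0 : p ≠ 0)
    (hη : η p = 1) {d : ℕ} {ψ : Fin (d + 1) → Module.Dual k (σ → k)}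
    (hψ : ∀ v, (∀ a, ψ a v = 0) → (∀ q ∈ vanIdeal k σ C, q.IsHomogeneous 2 → eval p q = 0 →
        ∑ i, eval p (pderiv i q) * v i = 0) → v = 0) :
    ∃ Z : Submodule k (ρ → k), Module.finrank k Z ≤ d ∧
      ∀ φ : Module.Dual k (ρ → k), (∀ w ∈ Z, φ w = 0) →
        linForm φ ∈ projConductor (vanIdeal k σ C) L (linForm η) := by
  have hLp : L p = 0 := by
    rw [← LinearMap.mem_ker, hker]
    exact Submodule.mem_span_singleton_self p
  let Λ : Submodule k (Module.Dual k (ρ → k)) :=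
    ((projConductor (vanIdeal k σ C) L (linForm η)).restrictScalars k).comap linForm
  refine ⟨Λ.dualCoannihilator, ?_, fun φ hφ => ?_⟩
  · let T : Submodule k (σ → k) := Λ.dualCoannihilator.comap L
    have hT : ∀ v ∈ T, ∀ q ∈ vanIdeal k σ C, q.IsHomogeneous 2 → eval p q = 0 →
        ∑ i, eval p (pderiv i q) * v i = 0 := by
      intro v hv q hqC hq hqp
      let B : Module.Dual k (σ → k) := ∑ i, eval p (pderiv i q) • LinearMap.proj i
      have hB : ∀ v, B v = ∑ i, eval p (pderiv i q) * v i := fun v => by simp [B]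
      have hBp : B p = 0 := by
        have h1 := congrArg (eval p) hq.sum_X_mul_pderiv
        rw [map_sum, nsmul_eq_mul, map_mul, hqp, mul_zero] at h1
        rw [hB, ← h1]
        exact Finset.sum_congr rfl fun i _ => by rw [map_mul, eval_X, mul_comm]
      have hle : LinearMap.ker L ≤ LinearMap.ker B := by
        rw [hker, Submodule.span_singleton_le_iff_mem]
        exact hBp
      obtain ⟨s, hs⟩ :=
        LinearMap.exists_rightInverse_of_surjective L (LinearMap.range_eq_top.2 hsurj)
      have hφ : ∀ v, (B ∘ₗ s) (L v) = B v := by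
        intro v
        have h1 : s (L v) - v ∈ LinearMap.ker L := by
          rw [LinearMap.mem_ker, map_sub, sub_eq_zero]
          exact LinearMap.congr_fun hs (L v)
        have h2 := hle h1
        rwa [LinearMap.mem_ker, map_sub, sub_eq_zero] at h2
      rw [← hB, ← hφ]
      exact (Submodule.mem_dualCoannihilator _).1 hv _
        (linForm_mem_projConductor hsurj hLp hker hη hqC hq hqp fun v => (hφ v).trans (hB v))
    have h1 : Module.finrank k T ≤ d + 1 := by
      have h2 := LinearMap.finrank_le_finrank_of_injective
        (f := (LinearMap.pi ψ).domRestrict T) (fun v w hvw => by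
          rw [← sub_eq_zero] at hvw ⊢
          rw [← map_sub] at hvw
          exact Subtype.ext (hψ _ (fun a => congrFun hvw a) (hT _ (v - w).2)))
      rwa [Module.finrank_fintype_fun_eq_card, Fintype.card_fin] at h2
    have h2 := (L.domRestrict T).finrank_range_add_finrank_ker
    rw [LinearMap.range_domRestrict, Submodule.map_comap_eq_of_surjective hsurj] at h2
    have h3 : 1 ≤ Module.finrank k (LinearMap.ker (L.domRestrict T)) := by
      rw [Nat.one_le_iff_ne_zero, Ne, Submodule.finrank_eq_zero]
      intro h
      have hpT : p ∈ T := by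
        rw [Submodule.mem_comap, hLp]
        exact zero_mem _
      have h4 : (⟨p, hpT⟩ : T) ∈ LinearMap.ker (L.domRestrict T) := hLp
      rw [h, Submodule.mem_bot] at h4
      exact hp0 (congrArg Subtype.val h4)
    omega
  · have h1 : φ ∈ Λ.dualCoannihilator.dualAnnihilator :=
      (Submodule.mem_dualAnnihilator _).2 hφ
    rw [Subspace.dualCoannihilator_dualAnnihilator_eq] at h1
    exact h1

end Projection

theorem length_le_of_isRegSeqOn_vanIdeal_image {k : Type} [Field k] [CharZero k] {σ ρ : Type}
    [Fintype σ] [DecidableEq σ] [Fintype ρ] [DecidableEq ρ] {C : Set (σ → k)} {N n : ℕ}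
    (hV : IsProjVariety k σ C) (hnd : Nondeg k σ C) (hs : IsSmoothOfCodim k σ C N)
    (hgr : HilbGrowthLE (vanIdeal k σ C) n (N + 1)) (hcard : Fintype.card σ = n + N + 1)
    (hN : 4 ≤ N) (hcone : ¬ IsConeVariety k σ C) {p : σ → k} (hp0 : p ≠ 0) (hp : p ∉ C)
    {L : (σ → k) →ₗ[k] (ρ → k)} (hker : LinearMap.ker L = Submodule.span k {p})
    (hsurj : Function.Surjective L) {fs : List (MvPolynomial ρ k)}
    (hfs : ∀ f ∈ fs, coeff 0 f = 0) (hreg : IsRegSeqOn k ρ (vanIdeal k ρ (L '' C)) fs) :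
    fs.length ≤ 4 := by
  have hLp : L p = 0 := by
    rw [← LinearMap.mem_ker, hker]
    exact Submodule.mem_span_singleton_self p
  obtain ⟨η, hη⟩ : ∃ η : Module.Dual k (σ → k), η p = 1 := by
    obtain ⟨i, hi⟩ := Function.ne_iff.1 hp0
    exact ⟨(p i)⁻¹ • LinearMap.proj i, inv_mul_cancel₀ hi⟩
  obtain ⟨ψ, hψ⟩ := exists_dual_forms_of_not_isConeVariety hV hnd hs hgr hcard hN hcone hp
  obtain ⟨Z, hZ, hZJ⟩ := exists_submodule_forall_linForm_mem_projConductor hsurj hker hp0 hη hψ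
  have hZlt : Z < ⊤ := by
    refine lt_top_iff_ne_top.2 fun h => ?_
    have h1 := L.finrank_range_add_finrank_ker
    rw [LinearMap.range_eq_top.2 hsurj, hker, finrank_span_singleton hp0,
      Module.finrank_fintype_fun_eq_card, ← h] at h1
    omega
  obtain ⟨φ, hφ0, hφ⟩ := Submodule.exists_le_ker_of_lt_top _ hZlt
  have hl := hZJ φ hφ
  have hlC : linSubst L (linForm φ) ∉ vanIdeal k σ C := by
    intro h
    have h1 := hnd _ ((isHomogeneous_linForm φ).linSubst L) (mem_vanIdeal.1 h)
    exact hφ0 (linForm_injective (linSubst_injective hsurj (by rw [h1, map_zero, map_zero])))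
  obtain ⟨x, hx⟩ := mem_projConductor.1 hl
  have hprime : (vanIdeal k ρ (L '' C)).IsPrime := by
    rw [vanIdeal_image]
    have := hV.prime
    exact Ideal.comap_isPrime _ _
  refine length_le_of_isRegSeqOn hprime hfs hreg (d := 4)
    (lt_of_le_of_lt (ringKrullDim_quotient_le_of_linForm hZJ)
      (by exact_mod_cast Nat.lt_succ_of_le hZ))
    hl (fun h => hlC (mem_vanIdeal_image.1 h)) (x := x) (fun a ha => ?_) fun s hs0 hsx => ?_
  · obtain ⟨g, hg⟩ := mem_projConductor.1 ha
    have h1 : a * x - g * linForm φ ∈ vanIdeal k ρ (L '' C) := by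
      rw [mem_vanIdeal_image]
      convert Ideal.sub_mem _ (Ideal.mul_mem_left _ (linSubst L (linForm φ)) hg)
        (Ideal.mul_mem_left _ (linSubst L a) hx) using 1
      rw [map_sub, map_mul, map_mul]
      ring
    rw [← sub_add_cancel (a * x) (g * linForm φ)]
    exact Ideal.add_mem _ (Ideal.mem_sup_left h1)
      (Ideal.mem_sup_right (Ideal.mul_mem_left _ _ (Ideal.mem_span_singleton_self _)))
  · obtain ⟨i, hi, j, hj, hij⟩ := Submodule.mem_sup.1 hsx
    obtain ⟨g, rfl⟩ := Ideal.mem_span_singleton'.1 hj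
    rw [mem_vanIdeal_image] at hi
    refine hs0 (coeff_zero_eq_zero_of_mem_projConductor hV.smul_mem hnd hLp hη
      (mem_projConductor.2 ⟨g, (hV.prime.mem_or_mem ?_).resolve_left hlC⟩))
    convert Ideal.add_mem _ (Ideal.mul_mem_left _ (linSubst L s) hx) hi using 1
    have h1 := congrArg (linSubst L) hij
    rw [map_add, map_mul, map_mul] at h1
    linear_combination -h1

/-- Corollary 2.2.(2). Let `X = π_p(X̃) ⊆ ℙ^{n+c}` (degree `c + 2`) be
the projection of a smooth `n`-dimensional variety of minimal degree
`X̃ ⊆ ℙ^{n+c+1}` (not a cone) from a point `p ∉ X̃`, `c ≥ 3`, `n ≥ 2`.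
If `depth(X) = n - 1`, then `n ≤ 5`. -/
theorem stmt_5 {k : Type} [Field k] [IsAlgClosed k] [CharZero k]
    (n c : ℕ) (hc : 3 ≤ c)
    (Ct : Set (Fin (n + c + 2) → k)) (C : Set (Fin (n + c + 1) → k))
    (hVt : IsProjVariety k (Fin (n + c + 2)) Ct)
    (hndt : Nondeg k (Fin (n + c + 2)) Ct)
    (hdimt : HasDim k (Fin (n + c + 2)) Ct n)
    (hdegt : HasDegree k (Fin (n + c + 2)) Ct n (c + 2))
    (hsmooth : IsSmoothOfCodim k (Fin (n + c + 2)) Ct (c + 1))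
    (hnotcone : ¬ IsConeVariety k (Fin (n + c + 2)) Ct)
    (p : Fin (n + c + 2) → k) (hp0 : p ≠ 0) (hpC : p ∉ Ct)
    (pr : (Fin (n + c + 2) → k) →ₗ[k] (Fin (n + c + 1) → k))
    (hker : LinearMap.ker pr = Submodule.span k {p})
    (hsurj : Function.Surjective pr)
    (hproj : C = pr '' Ct)
    (hdeg : HasDegree k (Fin (n + c + 1)) C n (c + 2))
    (hn : 2 ≤ n)
    (hdepth : arithDepth k (Fin (n + c + 1)) C = n - 1) :
    n ≤ 5 := by
  subst hproj
  have hgr : HilbGrowthLE (vanIdeal k _ Ct) n (c + 1 + 1) := fun K a h =>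
    le_of_hasDegree_of_forall_mul_choose_le hdegt h
  have h4 : arithDepth k (Fin (n + c + 1)) (pr '' Ct) ≤ 4 := by
    refine csSup_le' ?_
    rintro _ ⟨fs, rfl, hfs, hreg⟩
    exact length_le_of_isRegSeqOn_vanIdeal_image hVt hndt hsmooth hgr
      (by rw [Fintype.card_fin]; omega) (by omega) hnotcone hp0 hpC hker hsurj hfs hreg
  omega
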